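/- arXiv:2401.12581 — 4 statements merged into one kernel-verified Lean document; each statement's English description precedes it below -/
import Mathlib

section
/- For every integer m > 2 there exist a twice continuously differentiable function Z : (0,∞) → ℝ, a constant C > 0, and a strictly decreasing sequence (r_j)_{j≥0} of positive real numbers with lim_{j→∞} r_j = 0, such that: Z''(r) + (2/r)Z'(r) + Z(r)^{2m+1} = 0 for all r > 0 (i.e. Z is a radial solution of ΔZ + Z^{2m+1} = 0 on ℝ³∖{0}); |r·Z(r) − 1| ≤ C/r² for all r ≥ 1; lim_{r→∞} r²·Z'(r) = −1; and the zero set {r > 0 : Z(r) = 0} equals {r_j : j ∈ ℕ}. -/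
open Set Filter MeasureTheory
open scoped NNReal Topology

/-- A vector field that is bounded and Lipschitz uniformly on bounded time intervals has a solution
defined for all nonnegative times. -/
theorem exists_forall_nonneg_hasDerivWithinAt {E : Type*} [NormedAddCommGroup E]
    [NormedSpace ℝ E] [CompleteSpace E] (f : ℝ → E → E) (x₀ : E)
    (hlip : ∀ T : ℝ, ∃ K : ℝ≥0, ∀ t ∈ Icc 0 T, LipschitzWith K (f t))
    (hbdd : ∀ T : ℝ, ∃ M : ℝ≥0, ∀ t ∈ Icc 0 T, ∀ x, ‖f t x‖ ≤ M)
    (hcont : ∀ x, ContinuousOn (f · x) (Ici 0)) :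
    ∃ α : ℝ → E, α 0 = x₀ ∧ ∀ t ≥ 0, HasDerivWithinAt α (f t (α t)) (Ici 0) t := by
  have hloc : ∀ n : ℕ, ∃ α : ℝ → E, α 0 = x₀ ∧
      ∀ t ∈ Icc (0 : ℝ) n, HasDerivWithinAt α (f t (α t)) (Icc 0 n) t := by
    intro n
    obtain ⟨K, hK⟩ := hlip n
    obtain ⟨M, hM⟩ := hbdd n
    have hP : IsPicardLindelof f (⟨0, left_mem_Icc.2 n.cast_nonneg⟩ : Icc (0 : ℝ) n) x₀
        (M * n) 0 M K :=
      { lipschitzOnWith := fun t ht ↦ (hK t ht).lipschitzOnWith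
        continuousOn := fun x _ ↦ (hcont x).mono Icc_subset_Ici_self
        norm_le := fun t ht x _ ↦ hM t ht x
        mul_max_le := by simp }
    exact hP.exists_eq_forall_mem_Icc_hasDerivWithinAt₀
  choose α h0 hα using hloc
  have hmono : ∀ {n k : ℕ}, n ≤ k → EqOn (α n) (α k) (Icc 0 n) := by
    intro n k hnk
    obtain ⟨K, hK⟩ := hlip n
    have key : ∀ j : ℕ, n ≤ j → ContinuousOn (α j) (Icc 0 n) ∧
        ∀ t ∈ Ico (0 : ℝ) n, HasDerivWithinAt (α j) (f t (α j t)) (Ici t) t := by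
      intro j hj
      have hj' : (n : ℝ) ≤ j := by exact_mod_cast hj
      refine ⟨fun t ht ↦ ((hα j t ⟨ht.1, ht.2.trans hj'⟩).continuousWithinAt).mono
        (Icc_subset_Icc_right hj'), fun t ht ↦ ?_⟩
      refine (hα j t ⟨ht.1, ht.2.le.trans hj'⟩).mono_of_mem_nhdsWithin ?_
      exact mem_of_superset (Icc_mem_nhdsGE (ht.2.trans_le hj')) (Icc_subset_Icc_left ht.1)
    exact ODE_solution_unique_of_mem_Icc_right (s := fun _ ↦ univ) (v := f) (K := K)
      (fun t ht ↦ (hK t ⟨ht.1, ht.2.le⟩).lipschitzOnWith) (key n le_rfl).1 (key n le_rfl).2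
      (fun _ _ ↦ trivial) (key k hnk).1 (key k hnk).2 (fun _ _ ↦ trivial) ((h0 n).trans (h0 k).symm)
  set β : ℝ → E := fun t ↦ α (⌊t⌋₊ + 1) t with hβ
  have hβα : ∀ n : ℕ, EqOn β (α n) (Icc 0 n) := by
    intro n t ht
    rcases le_total n (⌊t⌋₊ + 1) with h | h
    · exact (hmono h ht).symm
    · exact hmono h ⟨ht.1, by push_cast; exact (Nat.lt_floor_add_one t).le⟩
  refine ⟨β, by simp [hβ, h0], fun t ht ↦ ?_⟩
  have hlt : t < ((⌊t⌋₊ + 1 : ℕ) : ℝ) := by push_cast; exact Nat.lt_floor_add_one t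
  have hmem : t ∈ Icc (0 : ℝ) (⌊t⌋₊ + 1 : ℕ) := ⟨ht, hlt.le⟩
  have h := (hα _ t hmem).congr (hβα _) (hβα _ hmem)
  refine h.mono_of_mem_nhdsWithin ?_
  rw [← Ici_inter_Iic]
  exact inter_mem_nhdsWithin _ (Iic_mem_nhds hlt)

/-- An unbounded set of reals, bounded below and with finitely many elements below every real,
is the range of a strictly increasing sequence tending to infinity. -/
theorem exists_strictMono_range_eq {A : Set ℝ} (hfin : ∀ T, (A ∩ Iic T).Finite)
    (hunb : ∀ T, ∃ a ∈ A, T < a) :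
    ∃ s : ℕ → ℝ, StrictMono s ∧ Tendsto s atTop atTop ∧ range s = A := by
  classical
  let : LocallyFiniteOrder A := LocallyFiniteOrder.ofFiniteIcc fun a b ↦ by
    refine Set.Finite.of_finite_image (f := Subtype.val) ((hfin b).subset ?_)
      Subtype.val_injective.injOn
    rintro _ ⟨x, hx, rfl⟩
    exact ⟨x.2, hx.2⟩
  let : SuccOrder A := LinearLocallyFiniteOrder.succOrder A
  let : PredOrder A := LinearLocallyFiniteOrder.predOrder A
  obtain ⟨a₀, ha₀, -⟩ := hunb 0
  obtain ⟨b, ⟨hbA, hba⟩, hb⟩ := exists_min_image _ id (hfin a₀) ⟨a₀, ha₀, mem_Iic.2 le_rfl⟩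
  let : OrderBot A :=
    { bot := ⟨b, hbA⟩
      bot_le := fun x ↦ by
        rcases le_total x.1 a₀ with h | h
        · exact hb x.1 ⟨x.2, h⟩
        · exact (show b ≤ x.1 from le_trans hba h) }
  have : NoMaxOrder A := ⟨fun x ↦ by
    obtain ⟨y, hy, hxy⟩ := hunb x.1
    exact ⟨⟨y, hy⟩, hxy⟩⟩
  let e : A ≃o ℕ := orderIsoNatOfLinearSuccPredArch
  have hmono : StrictMono fun n ↦ (e.symm n : ℝ) := fun _ _ h ↦ e.symm.strictMono h
  refine ⟨fun n ↦ e.symm n, hmono, ?_, ?_⟩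
  · refine tendsto_atTop_atTop_of_monotone hmono.monotone fun T ↦ ?_
    obtain ⟨y, hy, hTy⟩ := hunb T
    exact ⟨e ⟨y, hy⟩, by simpa using hTy.le⟩
  · ext x
    refine ⟨?_, fun hx ↦ ⟨e ⟨x, hx⟩, by simp⟩⟩
    rintro ⟨n, rfl⟩
    exact (e.symm n).2

/-- The nearest point to `x` in the interval `[-c, c]`. -/
def clamp (c x : ℝ) : ℝ := max (-c) (min x c)

theorem abs_clamp_le {c : ℝ} (hc : 0 ≤ c) (x : ℝ) : |clamp c x| ≤ c :=
  abs_le.2 ⟨le_max_left _ _, max_le (by linarith) (min_le_right _ _)⟩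

theorem clamp_eq_self {c x : ℝ} (h : |x| ≤ c) : clamp c x = x := by
  rw [clamp, min_eq_left (abs_le.1 h).2, max_eq_right (abs_le.1 h).1]

theorem abs_clamp_sub_clamp_le (c x y : ℝ) : |clamp c x - clamp c y| ≤ |x - y| := by
  have h := (LipschitzWith.id.min_const c).const_max (-c) |>.dist_le_mul x y
  simpa [Real.dist_eq, clamp] using h

theorem continuousOn_pow_div_pow {w : ℝ → ℝ} (hw : ContinuousOn w (Ici 0))
    (hle : ∀ s ≥ 0, |w s| ≤ s) {a b : ℕ} (hab : b < a) :
    ContinuousOn (fun s ↦ w s ^ a / s ^ b) (Ici 0) := by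
  intro s hs
  rcases (mem_Ici.1 hs).eq_or_lt with rfl | hs'
  · have h0 : w 0 = 0 := by simpa using hle 0 le_rfl
    have hbd : ∀ s ∈ Ici (0 : ℝ), ‖w s ^ a / s ^ b‖ ≤ s ^ (a - b) := by
      intro s hs
      rcases (mem_Ici.1 hs).eq_or_lt with rfl | hs'
      · simp [h0, show a ≠ 0 by omega, show a - b ≠ 0 by omega]
      · rw [norm_div, norm_pow, norm_pow, Real.norm_eq_abs, Real.norm_eq_abs, abs_of_pos hs',
          div_le_iff₀ (by positivity), ← pow_add, Nat.sub_add_cancel hab.le]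
        exact pow_le_pow_left₀ (abs_nonneg _) (hle s hs) _
    have hz : w 0 ^ a / (0 : ℝ) ^ b = 0 := by simp [h0, show a ≠ 0 by omega]
    rw [ContinuousWithinAt, hz]
    refine squeeze_zero_norm' (eventually_mem_nhdsWithin.mono hbd) ?_
    have h : Tendsto (fun s : ℝ ↦ s ^ (a - b)) (𝓝 0) (𝓝 (0 ^ (a - b))) :=
      (continuous_pow _).tendsto 0
    rw [zero_pow (by omega)] at h
    exact h.mono_left nhdsWithin_le_nhds
  · exact ((hw s hs).pow a).div ((continuous_pow b).continuousWithinAt) (pow_pos hs' b).ne'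

theorem hasDerivAt_sq_max_zero (x : ℝ) :
    HasDerivAt (fun y : ℝ ↦ max y 0 ^ 2) (2 * max x 0) x := by
  rcases lt_trichotomy x 0 with h | rfl | h
  · rw [max_eq_right h.le, mul_zero]
    refine (hasDerivAt_const x (0 : ℝ)).congr_of_eventuallyEq ?_
    filter_upwards [Iio_mem_nhds h] with y hy
    simp [max_eq_right (mem_Iio.1 hy).le]
  · rw [max_self, mul_zero, hasDerivAt_iff_hasFDerivAt]
    have hO : (fun y : ℝ ↦ max y 0 ^ 2) =O[𝓝 0] fun y ↦ ‖y - 0‖ ^ 2 := by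
      refine Asymptotics.IsBigO.of_bound 1 (Eventually.of_forall fun y ↦ ?_)
      rw [sub_zero, norm_pow, norm_pow, norm_norm, one_mul]
      refine pow_le_pow_left₀ (norm_nonneg _) ?_ 2
      rw [Real.norm_eq_abs, Real.norm_eq_abs, abs_of_nonneg (le_max_right _ _)]
      exact max_le (le_abs_self _) (abs_nonneg _)
    exact (hO.hasFDerivAt one_lt_two).hasDerivAt.congr_deriv (by simp) |>.hasFDerivAt
  · rw [max_eq_left h.le]
    have hd : HasDerivAt (fun y : ℝ ↦ y ^ 2) (2 * x) x := by simpa using hasDerivAt_pow 2 x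
    refine hd.congr_of_eventuallyEq ?_
    filter_upwards [Ioi_mem_nhds h] with y hy
    simp [max_eq_left (mem_Ioi.1 hy).le]

/-- The primitive of `clamp 1` vanishing at `0`. -/
noncomputable def clampPrimitive (y : ℝ) : ℝ :=
  (y ^ 2 - max (y - 1) 0 ^ 2 - max (-y - 1) 0 ^ 2) / 2

theorem hasDerivAt_clampPrimitive (y : ℝ) : HasDerivAt clampPrimitive (clamp 1 y) y := by
  have h1 := (hasDerivAt_sq_max_zero (y - 1)).comp y ((hasDerivAt_id y).sub_const 1)
  have h2 := (hasDerivAt_sq_max_zero (-y - 1)).comp y ((hasDerivAt_id y).neg.sub_const 1)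
  have h0 : HasDerivAt (fun y : ℝ ↦ y ^ 2) (2 * y) y := by simpa using hasDerivAt_pow 2 y
  refine (((h0.sub h1).sub h2).div_const 2).congr_deriv ?_
  simp only [clamp]
  rcases le_total y 1 with h | h <;> rcases le_total (-1) y with h' | h'
  · rw [min_eq_left h, max_eq_right h', max_eq_right (by linarith), max_eq_right (by linarith)]
    ring
  · rw [min_eq_left h, max_eq_left h', max_eq_right (by linarith), max_eq_left (by linarith)]
    ring
  · rw [min_eq_right h, max_eq_right (by norm_num : (-1 : ℝ) ≤ 1),
      max_eq_left (by linarith : 0 ≤ y - 1), max_eq_right (by linarith : -y - 1 ≤ 0)]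
    ring
  · linarith

theorem abs_le_one_of_clampPrimitive_le {y : ℝ} (h : clampPrimitive y ≤ 1 / 2) : |y| ≤ 1 := by
  by_contra! hy
  rw [clampPrimitive] at h
  rcases lt_abs.1 hy with hy | hy
  · rw [max_eq_left (by linarith), max_eq_right (by linarith)] at h
    nlinarith
  · rw [max_eq_right (by linarith), max_eq_left (by linarith)] at h
    nlinarith

/-- Under the Kelvin transform the equation becomes `W'' = -W ^ (2 * m + 1) / s ^ 4`; truncating
its nonlinearities makes the vector field globally Lipschitz. -/
noncomputable def truncatedField (m : ℕ) (t : ℝ) (z : ℝ × ℝ) : ℝ × ℝ :=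
  (clamp 1 z.2, -(clamp t z.1 ^ (2 * m + 1) / t ^ 4))

theorem abs_clamp_pow_div_sub_le {m : ℕ} (hm : 2 < m) {t T : ℝ} (ht : t ∈ Icc 0 T) (x y : ℝ) :
    |clamp t x ^ (2 * m + 1) / t ^ 4 - clamp t y ^ (2 * m + 1) / t ^ 4| ≤
      ((2 * m + 1 : ℕ) : ℝ) * T ^ (2 * m - 4) * |x - y| := by
  have hT : 0 ≤ T := ht.1.trans ht.2
  rcases ht.1.eq_or_lt with rfl | h0
  · simp only [ne_eq, OfNat.ofNat_ne_zero, not_false_eq_true, zero_pow, div_zero, sub_zero,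
      abs_zero]
    positivity
  · rw [← sub_div, abs_div, abs_of_pos (pow_pos h0 4), div_le_iff₀ (pow_pos h0 4)]
    have hmax : max |clamp t x| |clamp t y| ≤ t :=
      max_le (abs_clamp_le ht.1 x) (abs_clamp_le ht.1 y)
    calc |clamp t x ^ (2 * m + 1) - clamp t y ^ (2 * m + 1)|
        ≤ |clamp t x - clamp t y| * (2 * m + 1 : ℕ) *
            max |clamp t x| |clamp t y| ^ (2 * m + 1 - 1) := abs_pow_sub_pow_le ..
      _ ≤ |x - y| * (2 * m + 1 : ℕ) * t ^ (2 * m + 1 - 1) := by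
          have h := abs_clamp_sub_clamp_le t x y
          have h' := (abs_nonneg (clamp t x)).trans (le_max_left _ |clamp t y|)
          exact mul_le_mul (mul_le_mul_of_nonneg_right h (Nat.cast_nonneg _))
            (pow_le_pow_left₀ h' hmax _) (pow_nonneg h' _) (by positivity)
      _ = (2 * m + 1 : ℕ) * t ^ (2 * m - 4) * |x - y| * t ^ 4 := by
          rw [show 2 * m + 1 - 1 = (2 * m - 4) + 4 by omega, pow_add]
          ring
      _ ≤ (2 * m + 1 : ℕ) * T ^ (2 * m - 4) * |x - y| * t ^ 4 := by
          gcongr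
          exact ht.2

theorem lipschitzWith_truncatedField {m : ℕ} (hm : 2 < m) (T : ℝ) :
    ∃ K : ℝ≥0, ∀ t ∈ Icc 0 T, LipschitzWith K (truncatedField m t) := by
  refine ⟨Real.toNNReal (1 + ((2 * m + 1 : ℕ) : ℝ) * T ^ (2 * m - 4)), fun t ht ↦ ?_⟩
  have hT : 0 ≤ T := ht.1.trans ht.2
  have hK : 0 ≤ ((2 * m + 1 : ℕ) : ℝ) * T ^ (2 * m - 4) := by positivity
  refine LipschitzWith.of_dist_le_mul fun x y ↦ ?_
  rw [Real.coe_toNNReal _ (by positivity), Prod.dist_eq, Prod.dist_eq]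
  simp only [Real.dist_eq, truncatedField]
  have h1 : |x.1 - y.1| ≤ max |x.1 - y.1| |x.2 - y.2| := le_max_left _ _
  have h2 : |x.2 - y.2| ≤ max |x.1 - y.1| |x.2 - y.2| := le_max_right _ _
  have h0 : 0 ≤ max |x.1 - y.1| |x.2 - y.2| := (abs_nonneg _).trans h1
  refine max_le ?_ ?_
  · have := abs_clamp_sub_clamp_le 1 x.2 y.2
    nlinarith
  · rw [neg_sub_neg, abs_sub_comm]
    have := abs_clamp_pow_div_sub_le hm ht x.1 y.1
    nlinarith

theorem norm_truncatedField_le {m : ℕ} (hm : 2 < m) (T : ℝ) :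
    ∃ M : ℝ≥0, ∀ t ∈ Icc 0 T, ∀ z, ‖truncatedField m t z‖ ≤ M := by
  refine ⟨Real.toNNReal (1 + T ^ (2 * m - 3)), fun t ht z ↦ ?_⟩
  have hT : 0 ≤ T := ht.1.trans ht.2
  have hK : 0 ≤ T ^ (2 * m - 3) := by positivity
  rw [Real.coe_toNNReal _ (by positivity), Prod.norm_def]
  simp only [Real.norm_eq_abs, truncatedField]
  refine max_le ((abs_clamp_le zero_le_one _).trans (by linarith)) ?_
  rw [abs_neg, abs_div, abs_pow, abs_of_nonneg (pow_nonneg ht.1 4)]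
  rcases ht.1.eq_or_lt with rfl | h0
  · simp only [ne_eq, OfNat.ofNat_ne_zero, not_false_eq_true, zero_pow, div_zero]
    positivity
  · rw [div_le_iff₀ (pow_pos h0 4)]
    calc |clamp t z.1| ^ (2 * m + 1) ≤ t ^ (2 * m + 1) :=
          pow_le_pow_left₀ (abs_nonneg _) (abs_clamp_le ht.1 _) _
      _ = t ^ (2 * m - 3) * t ^ 4 := by rw [← pow_add]; congr 1; omega
      _ ≤ (1 + T ^ (2 * m - 3)) * t ^ 4 := by
          gcongr
          have := pow_le_pow_left₀ ht.1 ht.2 (2 * m - 3)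
          linarith

theorem continuousOn_truncatedField {m : ℕ} (hm : 2 < m) (z : ℝ × ℝ) :
    ContinuousOn (truncatedField m · z) (Ici 0) := by
  have h : ContinuousOn (fun t ↦ clamp t z.1) (Ici 0) := by
    unfold clamp
    fun_prop
  exact continuousOn_const.prodMk
    (continuousOn_pow_div_pow h (fun s hs ↦ abs_clamp_le hs _) (by omega)).neg

theorem hasDerivAt_pow_div_pow {w v : ℝ → ℝ} {s : ℝ} (hs : 0 < s) (hw : HasDerivAt w (v s) s)
    (a b : ℕ) :
    HasDerivAt (fun s ↦ w s ^ (a + 1) / s ^ b)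
      ((a + 1) * w s ^ a * v s / s ^ b - b * w s ^ (a + 1) / s ^ (b + 1)) s := by
  refine ((hw.pow (a + 1)).div (hasDerivAt_pow b s) (pow_pos hs b).ne').congr_deriv ?_
  rcases b with _ | b
  · simp
  · simp only [Nat.add_sub_cancel, Nat.cast_add, Nat.cast_one, Pi.pow_apply]
    field_simp
    ring

theorem exists_regular_solution {m : ℕ} (hm : 2 < m) :
    ∃ w v : ℝ → ℝ, ContinuousOn w (Ici 0) ∧ ContinuousOn v (Ici 0) ∧ w 0 = 0 ∧ v 0 = 1 ∧
      (∀ s > 0, HasDerivAt w (v s) s) ∧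
      (∀ s > 0, HasDerivAt v (-(w s ^ (2 * m + 1) / s ^ 4)) s) ∧
      (∀ s ≥ 0, |w s| ≤ s) ∧ ∀ s ≥ 0, |v s| ≤ 1 := by
  obtain ⟨α, h0, hα⟩ := exists_forall_nonneg_hasDerivWithinAt (truncatedField m) (0, 1)
    (lipschitzWith_truncatedField hm) (norm_truncatedField_le hm) (continuousOn_truncatedField hm)
  set w : ℝ → ℝ := fun s ↦ (α s).1 with hw
  set v : ℝ → ℝ := fun s ↦ (α s).2 with hv
  have hw0 : w 0 = 0 := by simp [hw, h0]
  have hv0 : v 0 = 1 := by simp [hv, h0]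
  have hdw : ∀ s ≥ 0, HasDerivWithinAt w (clamp 1 (v s)) (Ici 0) s := fun s hs ↦ by
    simpa [truncatedField] using (hα s hs).hasFDerivWithinAt.fst.hasDerivWithinAt
  have hdv : ∀ s ≥ 0, HasDerivWithinAt v (-(clamp s (w s) ^ (2 * m + 1) / s ^ 4)) (Ici 0) s :=
    fun s hs ↦ by
      simpa [truncatedField] using (hα s hs).hasFDerivWithinAt.snd.hasDerivWithinAt
  have hcw : ContinuousOn w (Ici 0) := fun s hs ↦ (hdw s hs).continuousWithinAt
  have hcv : ContinuousOn v (Ici 0) := fun s hs ↦ (hdv s hs).continuousWithinAt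
  have hle : ∀ s ≥ 0, |w s| ≤ s := by
    intro s hs
    have h := (convex_Ici (0 : ℝ)).norm_image_sub_le_of_norm_hasDerivWithin_le (f := w)
      (f' := fun s ↦ clamp 1 (v s)) (C := 1)
      (fun s hs ↦ hdw s hs) (fun s _ ↦ abs_clamp_le zero_le_one _) self_mem_Ici hs
    simpa [hw0, abs_of_nonneg (show 0 ≤ s from hs)] using h
  have hdw' : ∀ s > 0, HasDerivAt w (clamp 1 (v s)) s := fun s hs ↦
    (hdw s hs.le).hasDerivAt (Ici_mem_nhds hs)
  have hdv' : ∀ s > 0, HasDerivAt v (-(w s ^ (2 * m + 1) / s ^ 4)) s := fun s hs ↦ by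
    have h := (hdv s hs.le).hasDerivAt (Ici_mem_nhds hs)
    rwa [clamp_eq_self (hle s hs.le)] at h
  have henergy : AntitoneOn
      (fun s ↦ clampPrimitive (v s) + w s ^ (2 * m + 1 + 1) / s ^ 4 / (2 * m + 2)) (Ici 0) := by
    refine antitoneOn_of_hasDerivWithinAt_nonpos (convex_Ici 0)
      (f' := fun s ↦ -(4 * w s ^ (2 * m + 2) / s ^ 5 / (2 * m + 2))) ?_ ?_ ?_
    · refine ContinuousOn.add ?_ ((continuousOn_pow_div_pow hcw hle (by omega)).div_const _)
      have : Continuous clampPrimitive :=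
        continuous_iff_continuousAt.2 fun y ↦ (hasDerivAt_clampPrimitive y).continuousAt
      exact this.comp_continuousOn hcv
    · intro s hs
      rw [interior_Ici] at hs ⊢
      have hs : 0 < s := hs
      have h1 := (hasDerivAt_clampPrimitive (v s)).comp s (hdv' s hs)
      have h2 := (hasDerivAt_pow_div_pow (v := fun s ↦ clamp 1 (v s)) hs (hdw' s hs)
        (2 * m + 1) 4).div_const (2 * m + 2)
      refine ((h1.add h2).congr_deriv ?_).hasDerivWithinAt
      push_cast
      field_simp
      ring
    · intro s hs
      rw [interior_Ici] at hs
      have hs : 0 < s := hs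
      have : 0 ≤ w s ^ (2 * m + 2) := (even_two_mul (m + 1)).pow_nonneg _
      rw [neg_nonpos]
      positivity
  have hvle : ∀ s ≥ 0, |v s| ≤ 1 := by
    intro s hs
    have h := henergy self_mem_Ici hs hs
    have h1 : 0 ≤ w s ^ (2 * m + 1 + 1) / s ^ 4 / (2 * m + 2) := by
      have : 0 ≤ w s ^ (2 * m + 1 + 1) := (even_two_mul (m + 1)).pow_nonneg _
      positivity
    have h2 : clampPrimitive (v 0) = 1 / 2 := by norm_num [hv0, clampPrimitive]
    simp only [h2, hw0] at h
    norm_num at h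
    exact abs_le_one_of_clampPrimitive_le (by linarith)
  refine ⟨w, v, hcw, hcv, hw0, hv0, fun s hs ↦ ?_, hdv', hle, hvle⟩
  have h := hdw' s hs
  rwa [clamp_eq_self (hvle s hs.le)] at h

/-- The Pohozaev functional of `W'' = -W ^ (2 * m + 1) / s ^ 4`, where `v` is the derivative
of `w`. -/
noncomputable def pohozaev (m : ℕ) (w v : ℝ → ℝ) (s : ℝ) : ℝ :=
  v s * (s * v s - w s) / 2 + w s ^ (2 * m + 1 + 1) / s ^ 3 / (2 * m + 2)

theorem hasDerivAt_pohozaev {m : ℕ} {w v : ℝ → ℝ} {s : ℝ} (hs : 0 < s)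
    (hw : HasDerivAt w (v s) s) (hv : HasDerivAt v (-(w s ^ (2 * m + 1) / s ^ 4)) s) :
    HasDerivAt (pohozaev m w v) (w s ^ (2 * m + 2) / s ^ 4 * ((m - 2) / (2 * m + 2))) s := by
  have h1 := (hv.mul (((hasDerivAt_id s).mul hv).sub hw)).div_const 2
  have h2 := (hasDerivAt_pow_div_pow hs hw (2 * m + 1) 3).div_const (2 * m + 2)
  refine (h1.add h2).congr_deriv ?_
  simp only [Pi.mul_apply, Pi.sub_apply, id]
  push_cast
  field_simp
  ring

theorem false_of_forall_add_mul_le {u : ℝ → ℝ} {a S k : ℝ} (hk : 0 < k)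
    (h0 : ∀ s ≥ S, 0 ≤ u s) (h : ∀ s ≥ S, u s + k * s ≤ a) : False := by
  have h1 := h0 (max S (a / k + 1)) (le_max_left _ _)
  have h2 := h (max S (a / k + 1)) (le_max_left _ _)
  have h3 : k * (a / k + 1) ≤ k * max S (a / k + 1) :=
    mul_le_mul_of_nonneg_left (le_max_right _ _) hk.le
  have h4 : k * (a / k + 1) = a + k := by field_simp
  linarith

theorem antitoneOn_Ici_of_hasDerivAt_nonpos {u u' : ℝ → ℝ} {S : ℝ}
    (hu : ∀ s ≥ S, HasDerivAt u (u' s) s) (hu' : ∀ s ≥ S, u' s ≤ 0) : AntitoneOn u (Ici S) :=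
  antitoneOn_of_hasDerivWithinAt_nonpos (convex_Ici S)
    (fun s hs ↦ (hu s hs).continuousAt.continuousWithinAt)
    (fun s hs ↦ (hu s (interior_subset hs)).hasDerivWithinAt)
    (fun s hs ↦ hu' s (interior_subset hs))

/-- A positive function with nonincreasing derivative on a half-line is nondecreasing. -/
theorem nonneg_of_antitoneOn_deriv {w v : ℝ → ℝ} {S : ℝ} (hw : ∀ s ≥ S, HasDerivAt w (v s) s)
    (hanti : AntitoneOn v (Ici S)) (hpos : ∀ s ≥ S, 0 < w s) : ∀ s ≥ S, 0 ≤ v s := by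
  intro s hs
  by_contra! hneg
  have hd : AntitoneOn (fun t ↦ w t + -v s * t) (Ici s) :=
    antitoneOn_Ici_of_hasDerivAt_nonpos (u' := fun t ↦ v t + -v s)
      (fun t ht ↦ by
        exact ((hw t (hs.trans ht)).add ((hasDerivAt_id t).const_mul (-v s))).congr_deriv (by simp))
      (fun t ht ↦ by linarith [hanti hs (hs.trans ht : S ≤ t) ht])
  exact false_of_forall_add_mul_le (neg_pos.2 hneg) (fun t ht ↦ (hpos t (hs.trans ht)).le)
    (fun t ht ↦ hd self_mem_Ici ht ht)

theorem exists_mul_deriv_lt {m : ℕ} (hm : 2 < m) {w v : ℝ → ℝ} {S : ℝ} (hS : 0 < S)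
    (hw : ∀ s ≥ S, HasDerivAt w (v s) s)
    (hv : ∀ s ≥ S, HasDerivAt v (-(w s ^ (2 * m + 1) / s ^ 4)) s)
    (hpos : ∀ s ≥ S, 0 < w s) (hvpos : ∀ s ≥ S, 0 ≤ v s) : ∃ s ≥ S, s * v s < w s := by
  by_contra! hcon
  have hmono : MonotoneOn (fun s ↦ w s / s) (Ici S) := by
    have hd : ∀ s ≥ S, HasDerivAt (fun s ↦ w s / s) ((v s * s - w s * 1) / s ^ 2) s :=
      fun s hs ↦ (hw s hs).div (hasDerivAt_id s) (hS.trans_le hs).ne'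
    refine monotoneOn_of_hasDerivWithinAt_nonneg (convex_Ici S)
      (fun s hs ↦ (hd s hs).continuousAt.continuousWithinAt)
      (fun s hs ↦ (hd s (interior_subset hs)).hasDerivWithinAt) (fun s hs ↦ ?_)
    have := hcon s (interior_subset hs)
    exact div_nonneg (by linarith) (sq_nonneg s)
  set k := w S / S with hk
  have hk0 : 0 < k := div_pos (hpos S le_rfl) hS
  have hlow : ∀ s ≥ S, k ^ (2 * m + 1) * S ^ (2 * m - 3) ≤ w s ^ (2 * m + 1) / s ^ 4 := by
    intro s hs
    have hs0 : 0 < s := hS.trans_le hs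
    have h : k ≤ w s / s := hmono self_mem_Ici hs hs
    rw [le_div_iff₀ hs0] at h
    rw [le_div_iff₀ (by positivity)]
    calc k ^ (2 * m + 1) * S ^ (2 * m - 3) * s ^ 4
        ≤ k ^ (2 * m + 1) * s ^ (2 * m - 3) * s ^ 4 := by gcongr
      _ = (k * s) ^ (2 * m + 1) := by
          rw [mul_assoc, ← pow_add, mul_pow]
          congr 2
          omega
      _ ≤ w s ^ (2 * m + 1) := pow_le_pow_left₀ (by positivity) h _
  have hd : AntitoneOn (fun t ↦ v t + k ^ (2 * m + 1) * S ^ (2 * m - 3) * t) (Ici S) :=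
    antitoneOn_Ici_of_hasDerivAt_nonpos
      (u' := fun t ↦ -(w t ^ (2 * m + 1) / t ^ 4) + k ^ (2 * m + 1) * S ^ (2 * m - 3))
      (fun t ht ↦ by
        exact ((hv t ht).add
          ((hasDerivAt_id t).const_mul (k ^ (2 * m + 1) * S ^ (2 * m - 3)))).congr_deriv (by simp))
      (fun t ht ↦ by linarith [hlow t ht])
  exact false_of_forall_add_mul_le (by positivity) hvpos (fun t ht ↦ hd self_mem_Ici ht ht)

theorem not_eventually_pos_of_pohozaev {m : ℕ} (hm : 2 < m) {w v : ℝ → ℝ} {S c : ℝ} (hS : 0 < S)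
    (hw : ∀ s ≥ S, HasDerivAt w (v s) s)
    (hv : ∀ s ≥ S, HasDerivAt v (-(w s ^ (2 * m + 1) / s ^ 4)) s)
    (hc : 0 < c) (hP : ∀ s ≥ S, c ≤ pohozaev m w v s) : ¬ ∀ s ≥ S, 0 < w s := by
  intro hpos
  have hs0 : ∀ s ≥ S, 0 < s := fun s hs ↦ hS.trans_le hs
  have hvpos : ∀ s ≥ S, 0 ≤ v s := by
    refine nonneg_of_antitoneOn_deriv hw (antitoneOn_Ici_of_hasDerivAt_nonpos hv fun s hs ↦ ?_) hpos
    have := hpos s hs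
    have := hs0 s hs
    rw [neg_nonpos]
    positivity
  obtain ⟨s₁, hs₁, hlt⟩ := exists_mul_deriv_lt hm hS hw hv hpos hvpos
  set f : ℝ → ℝ := fun s ↦ s * v s / w s with hf
  have hf0 : ∀ s ≥ S, 0 ≤ f s := fun s hs ↦
    div_nonneg (mul_nonneg (hs0 s hs).le (hvpos s hs)) (hpos s hs).le
  have hdf : ∀ s ≥ S, HasDerivAt f ((f s * (1 - f s) - w s ^ (2 * m) / s ^ 2) / s) s := by
    intro s hs
    have hws := (hpos s hs).ne'
    have hss := (hs0 s hs).ne'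
    refine (((hasDerivAt_id s).mul (hv s hs)).div (hw s hs) hws).congr_deriv ?_
    simp only [Pi.mul_apply, id, hf]
    field_simp
    ring
  have hP' : ∀ s ≥ S, pohozaev m w v s =
      w s ^ 2 / s * ((f s ^ 2 - f s) / 2 + w s ^ (2 * m) / s ^ 2 / (2 * m + 2)) := by
    intro s hs
    have hws := (hpos s hs).ne'
    have hss := (hs0 s hs).ne'
    simp only [pohozaev, hf]
    field_simp
    ring
  have hq : ∀ s ≥ S, (m + 1) * (f s * (1 - f s)) < w s ^ (2 * m) / s ^ 2 := by
    intro s hs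
    have h := hc.trans_le (hP s hs)
    have hw2 : 0 < w s ^ 2 / s := div_pos (pow_pos (hpos s hs) 2) (hs0 s hs)
    rw [hP' s hs] at h
    have h' := pos_of_mul_pos_right h hw2.le
    have hm1 : (0 : ℝ) < 2 * m + 2 := by positivity
    rw [← sub_pos]
    have h'' := mul_pos h' hm1
    have e : ((f s ^ 2 - f s) / 2 + w s ^ (2 * m) / s ^ 2 / (2 * m + 2)) * (2 * m + 2) =
        w s ^ (2 * m) / s ^ 2 - (m + 1) * (f s * (1 - f s)) := by
      field_simp
      ring
    rwa [e] at h''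
  have hfanti : AntitoneOn f (Ici S) := by
    refine antitoneOn_Ici_of_hasDerivAt_nonpos hdf fun s hs ↦
      div_nonpos_of_nonpos_of_nonneg ?_ (hs0 s hs).le
    have hqs := hq s hs
    have hq0 : 0 < w s ^ (2 * m) / s ^ 2 :=
      div_pos (pow_pos (hpos s hs) _) (pow_pos (hs0 s hs) _)
    have hm0 : (0 : ℝ) ≤ m := m.cast_nonneg
    rcases le_total (f s * (1 - f s)) 0 with h | h
    · linarith
    · nlinarith
  have hf1 : f s₁ < 1 := (div_lt_one (hpos _ hs₁)).2 hlt
  have hfle : ∀ s ≥ s₁, f s ≤ f s₁ := fun s hs ↦ hfanti hs₁ (hs₁.trans hs : S ≤ s) hs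
  have hsmall : ∃ s ≥ s₁, f s ≤ 1 / (2 * m + 2) := by
    by_contra! hcon
    set k : ℝ := m * (1 - f s₁) * (1 / (2 * m + 2)) with hk
    have hk0 : 0 < k := by
      have : (0 : ℝ) < m := by exact_mod_cast (by omega : 0 < m)
      have := sub_pos.2 hf1
      positivity
    have hd : AntitoneOn (fun s ↦ f s + k * Real.log s) (Ici s₁) := by
      refine antitoneOn_Ici_of_hasDerivAt_nonpos
        (u' := fun s ↦ (f s * (1 - f s) - w s ^ (2 * m) / s ^ 2) / s + k * s⁻¹)
        (fun s hs ↦ (hdf s (hs₁.trans hs)).add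
          ((Real.hasDerivAt_log (hs0 s (hs₁.trans hs)).ne').const_mul k)) (fun s hs ↦ ?_)
      rw [← div_eq_mul_inv, ← add_div]
      refine div_nonpos_of_nonpos_of_nonneg ?_ (hs0 s (hs₁.trans hs)).le
      have hqs := hq s (hs₁.trans hs)
      have h1 : k ≤ m * (1 - f s) * f s := by
        have h2 := hfle s hs
        have h3 := (hcon s hs).le
        rw [hk]
        gcongr
        have := sub_pos.2 hf1
        nlinarith
      linarith
    have hexp : ∀ t ≥ Real.log s₁, s₁ ≤ Real.exp t := fun t ht ↦ by
      rwa [← Real.log_le_iff_le_exp (hs0 s₁ hs₁)]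
    exact false_of_forall_add_mul_le (u := fun t ↦ f (Real.exp t)) (S := Real.log s₁) hk0
      (fun t ht ↦ hf0 _ (hs₁.trans (hexp t ht)))
      (fun t ht ↦ by simpa using hd self_mem_Ici (hexp t ht) (hexp t ht))
  obtain ⟨s₂, hs₂, hfs₂⟩ := hsmall
  have hs₂S : S ≤ s₂ := hs₁.trans hs₂
  have hgrowth : AntitoneOn (fun s ↦ w s ^ (2 * m + 1 + 1) / s ^ 1) (Ici s₂) := by
    refine antitoneOn_Ici_of_hasDerivAt_nonpos
      (fun s hs ↦ hasDerivAt_pow_div_pow (hs0 s (hs₂S.trans hs)) (hw s (hs₂S.trans hs)) _ _)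
      (fun s hs ↦ ?_)
    have hsS : S ≤ s := hs₂S.trans hs
    have hfs : s * v s / w s ≤ 1 / (2 * m + 2) := (hfanti hs₂S hsS hs).trans hfs₂
    rw [div_le_div_iff₀ (hpos s hsS) (by positivity)] at hfs
    have hss := hs0 s hsS
    have e : (((2 * m + 1 : ℕ) : ℝ) + 1) * w s ^ (2 * m + 1) * v s / s ^ 1 -
        ((1 : ℕ) : ℝ) * w s ^ (2 * m + 1 + 1) / s ^ (1 + 1) =
        w s ^ (2 * m + 1) / s ^ 2 * (s * v s * (2 * m + 2) - 1 * w s) := by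
      push_cast
      field_simp
      ring
    rw [e]
    have := hpos s hsS
    exact mul_nonpos_of_nonneg_of_nonpos (by positivity) (by linarith)
  have hPle : ∀ s ≥ s₂, c * s ^ 2 ≤ w s₂ ^ (2 * m + 1 + 1) / s₂ ^ 1 := by
    intro s hs
    have hsS : S ≤ s := hs₂S.trans hs
    have hss := hs0 s hsS
    have hws := hpos s hsS
    have hg : w s ^ (2 * m + 1 + 1) / s ^ 1 ≤ _ := hgrowth self_mem_Ici hs hs
    refine le_trans ?_ hg
    have h1 := hP s hsS
    have h2 : v s * (s * v s - w s) ≤ 0 := by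
      refine mul_nonpos_of_nonneg_of_nonpos (hvpos s hsS) ?_
      have h3 : s * v s / w s < 1 := ((hfle s (hs₂.trans hs)).trans_lt hf1)
      rw [div_lt_one hws] at h3
      linarith
    have h3 : w s ^ (2 * m + 1 + 1) / s ^ 3 / (2 * m + 2) ≤ w s ^ (2 * m + 1 + 1) / s ^ 3 :=
      div_le_self (by positivity) (by linarith [(m.cast_nonneg : (0 : ℝ) ≤ m)])
    rw [pohozaev] at h1
    calc c * s ^ 2 ≤ w s ^ (2 * m + 1 + 1) / s ^ 3 * s ^ 2 := by
          gcongr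
          linarith
      _ = w s ^ (2 * m + 1 + 1) / s ^ 1 := by field_simp
  refine false_of_forall_add_mul_le (u := fun _ ↦ 0) (S := max s₂ 1) hc (fun _ _ ↦ le_rfl)
    (fun s hs ↦ ?_) (a := w s₂ ^ (2 * m + 1 + 1) / s₂ ^ 1)
  have h1 := hPle s ((le_max_left _ _).trans hs)
  have h2 : 1 ≤ s := (le_max_right _ _).trans hs
  nlinarith [mul_le_mul_of_nonneg_left h2 (mul_nonneg hc.le (zero_le_one.trans h2))]

theorem pohozaev_neg (m : ℕ) (w v : ℝ → ℝ) (s : ℝ) :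
    pohozaev m (fun s ↦ -w s) (fun s ↦ -v s) s = pohozaev m w v s := by
  have h : Even (2 * m + 1 + 1) := ⟨m + 1, by ring⟩
  simp only [pohozaev, h.neg_pow]
  ring

theorem sub_cube_le_regular_solution {m : ℕ} (hm : 2 < m) {w v : ℝ → ℝ}
    (hcw : ContinuousOn w (Ici 0)) (hcv : ContinuousOn v (Ici 0)) (hw0 : w 0 = 0) (hv0 : v 0 = 1)
    (hw : ∀ s > 0, HasDerivAt w (v s) s)
    (hv : ∀ s > 0, HasDerivAt v (-(w s ^ (2 * m + 1) / s ^ 4)) s)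
    (hle : ∀ s ≥ 0, |w s| ≤ s) {s : ℝ} (hs : s ∈ Icc (0 : ℝ) 1) : s - s ^ 3 / 6 ≤ w s := by
  have hsub : Icc (0 : ℝ) 1 ⊆ Ici 0 := Icc_subset_Ici_self
  have hvlow : ∀ t ∈ Icc (0 : ℝ) 1, 1 - t ^ 2 / 2 ≤ v t := by
    intro t ht
    have hmono : MonotoneOn (fun t ↦ v t + t ^ 2 / 2) (Icc 0 1) := by
      refine monotoneOn_of_hasDerivWithinAt_nonneg (convex_Icc 0 1)
        (f' := fun t ↦ -(w t ^ (2 * m + 1) / t ^ 4) + t)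
        ((hcv.mono hsub).add (by fun_prop)) ?_ ?_
      · intro t ht
        rw [interior_Icc] at ht
        refine (((hv t ht.1).add ((hasDerivAt_pow 2 t).div_const 2)).congr_deriv
          ?_).hasDerivWithinAt
        norm_num
      · intro t ht
        rw [interior_Icc] at ht
        have h : w t ^ (2 * m + 1) / t ^ 4 ≤ t := by
          rw [div_le_iff₀ (pow_pos ht.1 4)]
          calc w t ^ (2 * m + 1) ≤ |w t| ^ (2 * m + 1) := by
                rw [← abs_pow]
                exact le_abs_self _
            _ ≤ t ^ (2 * m + 1) := pow_le_pow_left₀ (abs_nonneg _) (hle t ht.1.le) _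
            _ ≤ t ^ 5 := pow_le_pow_of_le_one ht.1.le ht.2.le (by omega)
            _ = t * t ^ 4 := by ring
        linarith
    have h := hmono (left_mem_Icc.2 zero_le_one) ht ht.1
    simp only [hv0] at h
    linarith
  have hmono : MonotoneOn (fun t ↦ w t - (t - t ^ 3 / 6)) (Icc 0 1) := by
    refine monotoneOn_of_hasDerivWithinAt_nonneg (convex_Icc 0 1)
      (f' := fun t ↦ v t - (1 - t ^ 2 / 2)) ((hcw.mono hsub).sub (by fun_prop)) ?_ ?_
    · intro t ht
      rw [interior_Icc] at ht
      refine (((hw t ht.1).sub ((hasDerivAt_id t).sub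
        ((hasDerivAt_pow 3 t).div_const 6))).congr_deriv ?_).hasDerivWithinAt
      norm_num
      ring
    · intro t ht
      exact sub_nonneg.2 (hvlow t (interior_subset ht))
  have h := hmono (left_mem_Icc.2 zero_le_one) hs hs.1
  simp only [hw0] at h
  linarith

theorem pohozaev_monotoneOn_and_pos {m : ℕ} (hm : 2 < m) {w v : ℝ → ℝ}
    (hcw : ContinuousOn w (Ici 0)) (hcv : ContinuousOn v (Ici 0)) (hw0 : w 0 = 0)
    (hw : ∀ s > 0, HasDerivAt w (v s) s)
    (hv : ∀ s > 0, HasDerivAt v (-(w s ^ (2 * m + 1) / s ^ 4)) s)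
    (hle : ∀ s ≥ 0, |w s| ≤ s) (hpos : ∀ s ∈ Ioc (0 : ℝ) 1, 0 < w s) :
    MonotoneOn (pohozaev m w v) (Ici 0) ∧ ∀ s > 0, 0 < pohozaev m w v s := by
  have hcont : ContinuousOn (pohozaev m w v) (Ici 0) := by
    have h := continuousOn_pow_div_pow hcw hle (show 3 < 2 * m + 1 + 1 by omega)
    exact ((hcv.mul ((continuousOn_id.mul hcv).sub hcw)).div_const 2).add (h.div_const _)
  have hm2 : (0 : ℝ) < (m - 2) / (2 * m + 2) := by
    have : (2 : ℝ) < m := by exact_mod_cast hm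
    exact div_pos (by linarith) (by linarith)
  have hmono : MonotoneOn (pohozaev m w v) (Ici 0) := by
    refine monotoneOn_of_hasDerivWithinAt_nonneg (convex_Ici 0) hcont
      (f' := fun s ↦ w s ^ (2 * m + 2) / s ^ 4 * ((m - 2) / (2 * m + 2))) ?_ ?_
    · intro s hs
      rw [interior_Ici] at hs
      exact (hasDerivAt_pohozaev hs (hw s hs) (hv s hs)).hasDerivWithinAt
    · intro s hs
      have h : 0 ≤ w s ^ (2 * m + 2) := (even_two_mul (m + 1)).pow_nonneg _
      have := interior_subset hs
      positivity
  have hstrict : StrictMonoOn (pohozaev m w v) (Icc 0 1) := by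
    refine strictMonoOn_of_hasDerivWithinAt_pos (convex_Icc 0 1) (hcont.mono Icc_subset_Ici_self)
      (f' := fun s ↦ w s ^ (2 * m + 2) / s ^ 4 * ((m - 2) / (2 * m + 2))) ?_ ?_
    · intro s hs
      rw [interior_Icc] at hs
      exact (hasDerivAt_pohozaev hs.1 (hw s hs.1) (hv s hs.1)).hasDerivWithinAt
    · intro s hs
      rw [interior_Icc] at hs
      have h := hpos s ⟨hs.1, hs.2.le⟩
      have := hs.1
      positivity
  have hzero : pohozaev m w v 0 = 0 := by simp [pohozaev, hw0]
  refine ⟨hmono, fun s hs ↦ ?_⟩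
  have hmin : 0 < min s 1 := lt_min hs one_pos
  have h1 := hstrict (left_mem_Icc.2 zero_le_one) ⟨hmin.le, min_le_right _ _⟩ hmin
  rw [hzero] at h1
  exact h1.trans_le (hmono hmin.le hs.le (min_le_left _ _))

theorem finite_zeros_inter_Iic {m : ℕ} {w v : ℝ → ℝ} (hw : ∀ s > 0, HasDerivAt w (v s) s)
    (hpos : ∀ s ∈ Ioc (0 : ℝ) 1, 0 < w s) (hP : ∀ s > 0, 0 < pohozaev m w v s) (T : ℝ) :
    ({s | 0 < s ∧ w s = 0} ∩ Iic T).Finite := by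
  by_contra hinf
  have hsub : {s | 0 < s ∧ w s = 0} ∩ Iic T ⊆ Icc 1 T := by
    rintro s ⟨⟨hs0, hs⟩, hsT⟩
    refine ⟨?_, hsT⟩
    by_contra! h
    exact (hpos s ⟨hs0, h.le⟩).ne' hs
  obtain ⟨z, hz, hacc⟩ := Set.Infinite.exists_accPt_of_subset_isCompact hinf isCompact_Icc hsub
  have hz0 : 0 < z := zero_lt_one.trans_le hz.1
  have hne : ∀ᶠ y in 𝓝[≠] z, w y ≠ 0 := by
    by_cases hwz : w z = 0
    · refine (hw z hz0).eventually_ne fun hvz ↦ ?_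
      have := hP z hz0
      simp [pohozaev, hwz, hvz] at this
    · exact ((hw z hz0).continuousAt.eventually_ne hwz).filter_mono nhdsWithin_le_nhds
  rw [accPt_iff_frequently] at hacc
  obtain ⟨y, ⟨hyz, hy⟩, hy'⟩ := (hacc.and_eventually (eventually_nhdsWithin_iff.1 hne)).exists
  exact hy' hyz hy.1.2

theorem forall_Ici_pos_of_ne_zero {u : ℝ → ℝ} {S : ℝ} (hu : ContinuousOn u (Ici S))
    (hne : ∀ s ≥ S, u s ≠ 0) (h0 : 0 < u S) : ∀ s ≥ S, 0 < u s := by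
  intro s hs
  by_contra! h
  obtain ⟨t, ht, ht0⟩ := intermediate_value_Icc' hs (hu.mono Icc_subset_Ici_self) ⟨h, h0.le⟩
  exact hne t ht.1 ht0

theorem exists_zero_gt {m : ℕ} (hm : 2 < m) {w v : ℝ → ℝ}
    (hw : ∀ s > 0, HasDerivAt w (v s) s)
    (hv : ∀ s > 0, HasDerivAt v (-(w s ^ (2 * m + 1) / s ^ 4)) s)
    (hmono : MonotoneOn (pohozaev m w v) (Ici 0)) (hP : ∀ s > 0, 0 < pohozaev m w v s) (T : ℝ) :
    ∃ s ∈ {s | 0 < s ∧ w s = 0}, T < s := by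
  by_contra! hcon
  set S := max T 0 + 1 with hSdef
  have hS : 0 < S := by positivity
  have hpos : ∀ s ≥ S, 0 < s := fun s hs ↦ hS.trans_le hs
  have hne : ∀ s ≥ S, w s ≠ 0 := fun s hs h ↦ by
    have h1 := hcon s ⟨hpos s hs, h⟩
    have h2 := le_max_left T 0
    have h3 : S ≤ s := hs
    linarith
  have hPS : ∀ s ≥ S, pohozaev m w v S ≤ pohozaev m w v s := fun s hs ↦
    hmono hS.le (hpos s hs).le hs
  have hcw : ContinuousOn w (Ici S) := fun s hs ↦
    (hw s (hpos s hs)).continuousAt.continuousWithinAt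
  rcases lt_or_gt_of_ne (hne S le_rfl) with h | h
  · refine not_eventually_pos_of_pohozaev hm (w := fun s ↦ -w s) (v := fun s ↦ -v s) hS
      (fun s hs ↦ (hw s (hpos s hs)).neg) (fun s hs ↦ ?_) (hP S hS)
      (fun s hs ↦ (hPS s hs).trans_eq (pohozaev_neg m w v s).symm)
      (forall_Ici_pos_of_ne_zero hcw.neg (fun s hs ↦ neg_ne_zero.2 (hne s hs)) (neg_pos.2 h))
    refine (hv s (hpos s hs)).neg.congr_deriv ?_
    rw [(odd_two_mul_add_one m).neg_pow, neg_div]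
  · exact not_eventually_pos_of_pohozaev hm hS (fun s hs ↦ hw s (hpos s hs))
      (fun s hs ↦ hv s (hpos s hs)) (hP S hS) hPS (forall_Ici_pos_of_ne_zero hcw hne h)

theorem contDiffOn_two_of_hasDerivAt {u u' u'' : ℝ → ℝ} {U : Set ℝ} (hU : IsOpen U)
    (hu : ∀ x ∈ U, HasDerivAt u (u' x) x) (hu' : ∀ x ∈ U, HasDerivAt u' (u'' x) x)
    (hu'' : ContinuousOn u'' U) : ContDiffOn ℝ 2 u U := by
  have h1 : ContDiffOn ℝ 1 u' U := by
    rw [show (1 : WithTop ℕ∞) = 0 + 1 by norm_num, contDiffOn_succ_iff_deriv_of_isOpen hU]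
    refine ⟨fun x hx ↦ (hu' x hx).differentiableAt.differentiableWithinAt, by simp, ?_⟩
    rw [contDiffOn_zero]
    exact hu''.congr fun x hx ↦ (hu' x hx).deriv
  rw [show (2 : WithTop ℕ∞) = 1 + 1 by norm_num, contDiffOn_succ_iff_deriv_of_isOpen hU]
  exact ⟨fun x hx ↦ (hu x hx).differentiableAt.differentiableWithinAt, by simp,
    h1.congr fun x hx ↦ (hu x hx).deriv⟩

/-- existence of the singular radial stationary solution `Z` with its
decay properties and its discrete zero set accumulating at the origin. -/
theorem stmt_0 (m : ℕ) (hm : 2 < m) :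
    ∃ (Z : ℝ → ℝ) (C : ℝ) (rs : ℕ → ℝ),
      0 < C ∧
      ContDiffOn ℝ 2 Z (Set.Ioi 0) ∧
      (∀ r > (0:ℝ), deriv (deriv Z) r + (2 / r) * deriv Z r + Z r ^ (2 * m + 1) = 0) ∧
      (∀ r ≥ (1:ℝ), |r * Z r - 1| ≤ C / r ^ 2) ∧
      Filter.Tendsto (fun r => r ^ 2 * deriv Z r) Filter.atTop (nhds (-1)) ∧
      (∀ j, 0 < rs j) ∧
      StrictAnti rs ∧
      Filter.Tendsto rs Filter.atTop (nhds 0) ∧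
      {r : ℝ | 0 < r ∧ Z r = 0} = Set.range rs := by
  obtain ⟨w, v, hcw, hcv, hw0, hv0, hw, hv, hle, -⟩ := exists_regular_solution hm
  have hlow : ∀ s ∈ Icc (0 : ℝ) 1, s - s ^ 3 / 6 ≤ w s := fun s hs ↦
    sub_cube_le_regular_solution hm hcw hcv hw0 hv0 hw hv hle hs
  have hpos : ∀ s ∈ Ioc (0 : ℝ) 1, 0 < w s := fun s hs ↦ by
    have h1 := hlow s ⟨hs.1.le, hs.2⟩
    have h2 : s ^ 3 ≤ s ^ 1 := pow_le_pow_of_le_one hs.1.le hs.2 (by norm_num)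
    linarith [hs.1]
  obtain ⟨hmono, hP⟩ := pohozaev_monotoneOn_and_pos hm hcw hcv hw0 hw hv hle hpos
  obtain ⟨s, hs_mono, hs_top, hs_range⟩ := exists_strictMono_range_eq
    (finite_zeros_inter_Iic hw hpos hP) (exists_zero_gt hm hw hv hmono hP)
  have hs_mem : ∀ j, 0 < s j ∧ w (s j) = 0 := fun j ↦ by
    have h : s j ∈ {s | 0 < s ∧ w s = 0} := hs_range ▸ mem_range_self j
    exact h
  set Z : ℝ → ℝ := fun r ↦ w r⁻¹ with hZ
  set Z' : ℝ → ℝ := fun r ↦ -(v r⁻¹ / r ^ 2) with hZ'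
  set Z'' : ℝ → ℝ := fun r ↦ 2 * v r⁻¹ / r ^ 3 - w r⁻¹ ^ (2 * m + 1) with hZ''
  have hdZ : ∀ r > 0, HasDerivAt Z (Z' r) r := fun r hr ↦ by
    refine ((hw r⁻¹ (inv_pos.2 hr)).comp r (hasDerivAt_inv hr.ne')).congr_deriv ?_
    simp only [hZ']
    field_simp
  have hdZ' : ∀ r > 0, HasDerivAt Z' (Z'' r) r := fun r hr ↦ by
    refine ((((hv r⁻¹ (inv_pos.2 hr)).comp r (hasDerivAt_inv hr.ne')).div (hasDerivAt_pow 2 r)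
      (pow_pos hr 2).ne').neg).congr_deriv ?_
    simp only [hZ'', Function.comp]
    field_simp
    ring
  have hderiv : ∀ r > 0, deriv (deriv Z) r = Z'' r := fun r hr ↦ by
    have h : deriv Z =ᶠ[𝓝 r] Z' := by
      filter_upwards [Ioi_mem_nhds hr] with x hx using (hdZ x hx).deriv
    rw [h.deriv_eq, (hdZ' r hr).deriv]
  have hinv : ContinuousOn (fun r : ℝ ↦ r⁻¹) (Ioi 0) :=
    continuousOn_inv₀.mono fun x hx ↦ (mem_Ioi.1 hx).ne'
  have hmaps : MapsTo (fun r : ℝ ↦ r⁻¹) (Ioi 0) (Ici 0) := fun x hx ↦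
    mem_Ici.2 (inv_pos.2 (mem_Ioi.1 hx)).le
  refine ⟨Z, 1, fun j ↦ (s j)⁻¹, one_pos, ?_, ?_, ?_, ?_, ?_, ?_, ?_, ?_⟩
  · refine contDiffOn_two_of_hasDerivAt isOpen_Ioi hdZ hdZ' ?_
    exact (((continuousOn_const.mul (hcv.comp hinv hmaps)).div (continuousOn_pow 3)
      fun x hx ↦ (pow_pos hx 3).ne').sub ((hcw.comp hinv hmaps).pow _))
  · intro r hr
    rw [hderiv r hr, (hdZ r hr).deriv]
    simp only [hZ, hZ', hZ'']
    field_simp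
    ring
  · intro r hr
    have hr0 : 0 < r := zero_lt_one.trans_le hr
    have hi : r⁻¹ ∈ Icc (0 : ℝ) 1 := ⟨(inv_pos.2 hr0).le, inv_le_one_of_one_le₀ hr⟩
    have h1 := mul_le_mul_of_nonneg_left (hlow _ hi) hr0.le
    have h2 := mul_le_mul_of_nonneg_left ((le_abs_self _).trans (hle _ hi.1)) hr0.le
    have e1 : r * (r⁻¹ - r⁻¹ ^ 3 / 6) = 1 - 1 / r ^ 2 / 6 := by field_simp
    have e2 : r * r⁻¹ = 1 := mul_inv_cancel₀ hr0.ne'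
    have h3 : 0 < 1 / r ^ 2 := by positivity
    rw [abs_le]
    simp only [hZ]
    constructor <;> linarith
  · have h : Tendsto (fun r ↦ -v r⁻¹) atTop (𝓝 (-1)) := by
      have hc := hcv 0 self_mem_Ici
      rw [ContinuousWithinAt, hv0] at hc
      refine (hc.comp (tendsto_nhdsWithin_iff.2 ⟨tendsto_inv_atTop_zero, ?_⟩)).neg
      filter_upwards [eventually_gt_atTop 0] with r hr using (inv_pos.2 hr).le
    refine h.congr' ?_
    filter_upwards [eventually_gt_atTop 0] with r hr
    rw [(hdZ r hr).deriv]
    simp only [hZ']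
    field_simp
  · exact fun j ↦ inv_pos.2 (hs_mem j).1
  · exact fun i j hij ↦ inv_strictAnti₀ (hs_mem i).1 (hs_mono hij)
  · exact tendsto_inv_atTop_zero.comp hs_top
  · ext r
    constructor
    · rintro ⟨hr, hr0⟩
      have h : r⁻¹ ∈ range s := hs_range ▸ ⟨inv_pos.2 hr, hr0⟩
      obtain ⟨j, hj⟩ := h
      exact ⟨j, by simp [hj]⟩
    · rintro ⟨j, rfl⟩
      exact ⟨inv_pos.2 (hs_mem j).1, by simpa [hZ] using (hs_mem j).2⟩
end

section
/- For every j ∈ ℕ, the set of real numbers μ < 0 for which there exists a nonzero twice continuously differentiable function ψ : [1,∞) → ℝ with ψ(1) = 0, ∫₁^∞ ψ(r)² dr < ∞, and ψ''(r) + (2m+1)·Q_j(r)^{2m}·ψ(r) + μ·ψ(r) = 0 for all r > 1, is finite and has exactly j + 1 elements. -/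
open Set Filter MeasureTheory

section PruferAngle

open Real Topology
open scoped NNReal

theorem exists_forall_hasDerivAt_of_lipschitz_bounded {E : Type*} [NormedAddCommGroup E]
    [NormedSpace ℝ E] [CompleteSpace E] {f : ℝ → E → E} {K L : ℝ≥0}
    (hlip : ∀ t, LipschitzWith K (f t)) (hcont : ∀ x, Continuous fun t => f t x)
    (hbd : ∀ t x, ‖f t x‖ ≤ L) (t₀ : ℝ) (x₀ : E) :
    ∃ α : ℝ → E, α t₀ = x₀ ∧ ∀ t, HasDerivAt α (f t (α t)) t := by
  have hloc : ∀ N : ℕ, ∃ α : ℝ → E, α t₀ = x₀ ∧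
      ∀ t ∈ Icc (t₀ - (N + 1)) (t₀ + (N + 1)),
        HasDerivWithinAt α (f t (α t)) (Icc (t₀ - (N + 1)) (t₀ + (N + 1))) t := by
    intro N
    have hN : (0 : ℝ) < N + 1 := by positivity
    have hpl : IsPicardLindelof f (tmin := t₀ - (N + 1)) (tmax := t₀ + (N + 1))
        ⟨t₀, by constructor <;> linarith⟩ x₀ (L * (N + 1)) 0 L K :=
      { lipschitzOnWith := fun t _ => (hlip t).lipschitzOnWith
        continuousOn := fun x _ => (hcont x).continuousOn
        norm_le := fun t _ x _ => hbd t x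
        mul_max_le := by simp }
    exact hpl.exists_eq_forall_mem_Icc_hasDerivWithinAt₀
  choose α hα0 hα using hloc
  have huniq : ∀ M N : ℕ, M ≤ N → ∀ t ∈ Icc (t₀ - (M + 1)) (t₀ + (M + 1)), α M t = α N t := by
    intro M N hMN
    have hMN' : (M : ℝ) ≤ N := by exact_mod_cast hMN
    have hM : (0 : ℝ) < M + 1 := by positivity
    have hsub : Icc (t₀ - (M + 1 : ℝ)) (t₀ + (M + 1)) ⊆ Icc (t₀ - (N + 1)) (t₀ + (N + 1)) :=
      Icc_subset_Icc (by linarith) (by linarith)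
    have hd : ∀ P : ℕ, M ≤ P → ∀ t ∈ Ioo (t₀ - (M + 1 : ℝ)) (t₀ + (M + 1)),
        HasDerivAt (α P) (f t (α P t)) t := by
      intro P hP t ht
      have hP' : (M : ℝ) ≤ P := by exact_mod_cast hP
      exact (hα P t ⟨by linarith [ht.1], by linarith [ht.2]⟩).hasDerivAt
        (Icc_mem_nhds (by linarith [ht.1]) (by linarith [ht.2]))
    refine ODE_solution_unique_of_mem_Icc (v := f) (s := fun _ => univ) (K := K) (t₀ := t₀)
      (fun t _ => (hlip t).lipschitzOnWith) ⟨by linarith, by linarith⟩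
      (fun t ht => (hα M t ht).continuousWithinAt) (hd M le_rfl) (fun _ _ => mem_univ _)
      (fun t ht => ((hα N t (hsub ht)).mono hsub).continuousWithinAt) (hd N hMN)
      (fun _ _ => mem_univ _) ?_
    rw [hα0, hα0]
  refine ⟨fun t => α ⌈|t - t₀|⌉₊ t, hα0 _, fun t => ?_⟩
  set M := ⌈|t - t₀|⌉₊ with hM
  have hMt : |t - t₀| < M + 1 := (Nat.le_ceil _).trans_lt (lt_add_one _)
  have hev : (fun s => α ⌈|s - t₀|⌉₊ s) =ᶠ[𝓝 t] α M := by
    have hopen : IsOpen {s : ℝ | |s - t₀| < M + 1} :=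
      isOpen_lt (by fun_prop) continuous_const
    filter_upwards [hopen.mem_nhds hMt] with s hs
    have hs' : |s - t₀| ≤ ⌈|s - t₀|⌉₊ := Nat.le_ceil _
    replace hs := abs_lt.1 hs
    rw [abs_le] at hs'
    rcases le_total ⌈|s - t₀|⌉₊ M with h | h
    · exact huniq _ _ h s ⟨by linarith, by linarith⟩
    · exact (huniq _ _ h s ⟨by linarith, by linarith⟩).symm
  have hlt := abs_lt.1 hMt
  exact ((hα M t ⟨by linarith, by linarith⟩).hasDerivAt
    (Icc_mem_nhds (by linarith) (by linarith))).congr_of_eventuallyEq hev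

theorem hasDerivAt_mul_exp_neg_integral {D c h : ℝ → ℝ} (hc : Continuous c)
    (hD : ∀ t, HasDerivAt D (c t * D t + h t) t) (t : ℝ) :
    HasDerivAt (fun t => D t * exp (-∫ s in (1 : ℝ)..t, c s))
      (h t * exp (-∫ s in (1 : ℝ)..t, c s)) t := by
  have hI : HasDerivAt (fun t => ∫ s in (1 : ℝ)..t, c s) (c t) t :=
    hc.integral_hasStrictDerivAt 1 t |>.hasDerivAt
  exact ((hD t).mul hI.neg.exp).congr_deriv (by simp only [Pi.neg_apply]; ring)

theorem monotone_mul_exp_neg_integral {D c h : ℝ → ℝ} (hc : Continuous c)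
    (hD : ∀ t, HasDerivAt D (c t * D t + h t) t) (hh : ∀ t, 0 ≤ h t) :
    Monotone (fun t => D t * exp (-∫ s in (1 : ℝ)..t, c s)) :=
  monotone_of_hasDerivAt_nonneg (hasDerivAt_mul_exp_neg_integral hc hD)
    (fun t => mul_nonneg (hh t) (exp_pos _).le)

theorem nonneg_of_hasDerivAt_linear {D c h : ℝ → ℝ} (hc : Continuous c)
    (hD : ∀ t, HasDerivAt D (c t * D t + h t) t) (hh : ∀ t, 0 ≤ h t) (h1 : 0 ≤ D 1)
    {t : ℝ} (ht : 1 ≤ t) : 0 ≤ D t := by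
  have := monotone_mul_exp_neg_integral hc hD hh ht
  simp only [intervalIntegral.integral_same, neg_zero, exp_zero, mul_one] at this
  exact nonneg_of_mul_nonneg_left (h1.trans this) (exp_pos _)

theorem pos_of_hasDerivAt_linear {D c h : ℝ → ℝ} (hc : Continuous c)
    (hD : ∀ t, HasDerivAt D (c t * D t + h t) t) (hh : ∀ t, 0 ≤ h t) (h1 : 0 < D 1)
    {t : ℝ} (ht : 1 ≤ t) : 0 < D t := by
  have := monotone_mul_exp_neg_integral hc hD hh ht
  simp only [intervalIntegral.integral_same, neg_zero, exp_zero, mul_one] at this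
  exact pos_of_mul_pos_left (h1.trans_le this) (exp_pos _).le

/-- `θ` is a Prüfer angle for `u'' + (V + μ) u = 0`: the phase of `(u', u) = ρ (cos θ, sin θ)`. -/
def IsPruferAngle (V : ℝ → ℝ) (μ : ℝ) (θ : ℝ → ℝ) : Prop :=
  ∀ t, HasDerivAt θ (cos (θ t) ^ 2 + (V t + μ) * sin (θ t) ^ 2) t

namespace IsPruferAngle

variable {V θ θ₁ θ₂ : ℝ → ℝ} {μ μ₁ μ₂ : ℝ}

theorem continuous (hθ : IsPruferAngle V μ θ) : Continuous θ :=
  continuous_iff_continuousAt.2 fun t => (hθ t).continuousAt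

theorem sub_hasDerivAt (h₁ : IsPruferAngle V μ₁ θ₁) (h₂ : IsPruferAngle V μ₂ θ₂) (t : ℝ) :
    HasDerivAt (fun t => θ₂ t - θ₁ t)
      ((V t + μ₁ - 1) * sinc (θ₂ t - θ₁ t) * sin (θ₂ t + θ₁ t) * (θ₂ t - θ₁ t)
        + (μ₂ - μ₁) * sin (θ₂ t) ^ 2) t := by
  refine ((h₂ t).sub (h₁ t)).congr_deriv ?_
  have hs : sinc (θ₂ t - θ₁ t) * (θ₂ t - θ₁ t) = sin (θ₂ t - θ₁ t) := by
    by_cases h : θ₂ t - θ₁ t = 0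
    · simp [h]
    · rw [sinc_of_ne_zero h, div_mul_cancel₀ _ h]
  have e : (V t + μ₁ - 1) * sinc (θ₂ t - θ₁ t) * sin (θ₂ t + θ₁ t) * (θ₂ t - θ₁ t)
      = (V t + μ₁ - 1) * (sin (θ₂ t - θ₁ t) * sin (θ₂ t + θ₁ t)) := by
    rw [← hs]; ring
  rw [e, sin_sub, sin_add]
  have c1 := cos_sq' (θ₁ t)
  have c2 := cos_sq' (θ₂ t)
  linear_combination (c2 - c1) - (V t + μ₁ - 1) * (sin (θ₂ t) ^ 2 * c1 - sin (θ₁ t) ^ 2 * c2)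

theorem continuous_coeff (hV : Continuous V) (h₁ : IsPruferAngle V μ₁ θ₁)
    (h₂ : IsPruferAngle V μ₂ θ₂) :
    Continuous fun t => (V t + μ₁ - 1) * sinc (θ₂ t - θ₁ t) * sin (θ₂ t + θ₁ t) := by
  have := h₁.continuous
  have := h₂.continuous
  have := continuous_sinc
  fun_prop

theorem le_of_le (hV : Continuous V) (h₁ : IsPruferAngle V μ₁ θ₁) (h₂ : IsPruferAngle V μ₂ θ₂)
    (hμ : μ₁ ≤ μ₂) (h : θ₁ 1 ≤ θ₂ 1) {t : ℝ} (ht : 1 ≤ t) : θ₁ t ≤ θ₂ t :=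
  sub_nonneg.1 <| nonneg_of_hasDerivAt_linear (continuous_coeff hV h₁ h₂) (h₁.sub_hasDerivAt h₂)
    (fun _ => mul_nonneg (sub_nonneg.2 hμ) (sq_nonneg _)) (sub_nonneg.2 h) ht

theorem lt_of_lt (hV : Continuous V) (h₁ : IsPruferAngle V μ₁ θ₁) (h₂ : IsPruferAngle V μ₂ θ₂)
    (hμ : μ₁ ≤ μ₂) (h : θ₁ 1 < θ₂ 1) {t : ℝ} (ht : 1 ≤ t) : θ₁ t < θ₂ t :=
  sub_pos.1 <| pos_of_hasDerivAt_linear (continuous_coeff hV h₁ h₂) (h₁.sub_hasDerivAt h₂)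
    (fun _ => mul_nonneg (sub_nonneg.2 hμ) (sq_nonneg _)) (sub_pos.2 h) ht

theorem add_pi (h : IsPruferAngle V μ θ) : IsPruferAngle V μ (fun t => θ t + π) := fun t => by
  simpa [cos_add_pi, sin_add_pi] using (h t).add_const π

theorem _root_.exists_isPruferAngle {M : ℝ} (hV : Continuous V) (hM : ∀ t, |V t| ≤ M) (μ α : ℝ) :
    ∃ θ, θ 1 = α ∧ IsPruferAngle V μ θ := by
  have hM0 : 0 ≤ M := (abs_nonneg _).trans (hM 0)
  obtain ⟨B, hB⟩ : ∃ B : ℝ≥0, (B : ℝ) = M + |μ| := ⟨Real.toNNReal (M + |μ|), by simp; positivity⟩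
  have hq : ∀ t, |V t + μ| ≤ B := fun t =>
    (abs_add_le _ _).trans (by linarith [hM t])
  refine exists_forall_hasDerivAt_of_lipschitz_bounded
    (f := fun t θ => cos θ ^ 2 + (V t + μ) * sin θ ^ 2)
    (K := (1 + B) * 2) (L := 1 + B)
    (fun t => ?_) (fun x => by fun_prop) (fun t x => ?_) 1 α
  · refine lipschitzWith_of_nnnorm_deriv_le (by fun_prop) fun x => ?_
    have hd : HasDerivAt (fun x => cos x ^ 2 + (V t + μ) * sin x ^ 2)
        ((V t + μ - 1) * (2 * (sin x * cos x))) x := by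
      refine (((hasDerivAt_cos x).pow 2).add
        (((hasDerivAt_sin x).pow 2).const_mul (V t + μ))).congr_deriv ?_
      push_cast
      ring
    rw [hd.deriv, ← NNReal.coe_le_coe]
    push_cast
    simp only [norm_eq_abs, abs_mul]
    have h1 : |V t + μ - 1| ≤ 1 + B :=
      (abs_sub _ _).trans (by rw [abs_one]; linarith [hq t])
    have h2 : |sin x| * |cos x| ≤ 1 :=
      mul_le_one₀ (abs_sin_le_one x) (abs_nonneg _) (abs_cos_le_one x)
    rw [abs_two]
    nlinarith [abs_nonneg (V t + μ - 1), abs_nonneg (sin x), abs_nonneg (cos x),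
      mul_nonneg (abs_nonneg (sin x)) (abs_nonneg (cos x))]
  · push_cast
    simp only [norm_eq_abs]
    refine (abs_add_le _ _).trans ?_
    rw [abs_mul, abs_of_nonneg (sq_nonneg (cos x)), abs_of_nonneg (sq_nonneg (sin x))]
    have := hq t
    nlinarith [sin_sq_add_cos_sq x, sq_nonneg (sin x), sq_nonneg (cos x), abs_nonneg (V t + μ)]

theorem dist_le {M : ℝ} (hM : ∀ t, |V t| ≤ M) (h₁ : IsPruferAngle V μ₁ θ₁)
    (h₂ : IsPruferAngle V μ₂ θ₂) (h : θ₁ 1 = θ₂ 1) {t : ℝ} (ht : 1 ≤ t) :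
    |θ₂ t - θ₁ t| ≤ gronwallBound 0 (M + |μ₁| + 1) |μ₂ - μ₁| (t - 1) := by
  refine norm_le_gronwallBound_of_norm_deriv_right_le (f := fun t => θ₂ t - θ₁ t) (a := 1) (b := t)
    (h₂.continuous.sub h₁.continuous).continuousOn
    (fun x _ => (h₁.sub_hasDerivAt h₂ x).hasDerivWithinAt) (by simp [h]) (fun x _ => ?_) t ⟨ht, le_rfl⟩
  simp only [norm_eq_abs]
  refine (abs_add_le _ _).trans (add_le_add ?_ ?_)
  · rw [abs_mul]
    gcongr
    rw [abs_mul, abs_mul]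
    have h1 : |V x + μ₁ - 1| ≤ M + |μ₁| + 1 :=
      (abs_sub _ _).trans (by rw [abs_one]; linarith [abs_add_le (V x) μ₁, hM x])
    have h2 : |sinc (θ₂ x - θ₁ x)| ≤ 1 := abs_sinc_le_one _
    have h3 := abs_sin_le_one (θ₂ x + θ₁ x)
    have h0 : 0 ≤ M + |μ₁| + 1 := (abs_nonneg _).trans h1
    calc _ ≤ (M + |μ₁| + 1) * 1 * 1 := by gcongr
      _ = _ := by ring
  · rw [abs_mul, abs_of_nonneg (sq_nonneg (sin (θ₂ x)))]
    exact mul_le_of_le_one_right (abs_nonneg _) (sin_sq_le_one _)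

theorem _root_.pos_of_deriv_pos_of_eq_zero {g g' : ℝ → ℝ} {p q : ℝ} (hpq : p < q)
    (hd : ∀ x ∈ Icc p q, HasDerivAt g (g' x) x) (hpos : ∀ x ∈ Icc p q, g x = 0 → 0 < g' x)
    (hp : 0 ≤ g p) : 0 < g q := by
  have hnn : ∀ ⦃x⦄, x ∈ Icc p q → 0 ≤ g x :=
    image_le_of_deriv_right_lt_deriv_boundary' (f := fun _ => 0) (f' := fun _ => 0)
      continuousOn_const (fun x _ => hasDerivWithinAt_const _ _ _) hp
      (fun x hx => (hd x hx).continuousAt.continuousWithinAt)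
      (fun x hx => (hd x (Ico_subset_Icc_self hx)).hasDerivWithinAt)
      (fun x hx h => hpos x (Ico_subset_Icc_self hx) h.symm)
  have hq : q ∈ Icc p q := ⟨hpq.le, le_rfl⟩
  refine (hnn hq).lt_of_ne' fun h0 => ?_
  have hev := eventually_nhdsWithin_sign_eq_of_deriv_pos (f := g) (x₀ := q)
    (by rw [(hd q hq).deriv]; exact hpos q hq h0) h0
  have hlt : ∀ᶠ x in 𝓝[<] q, SignType.sign (g x) = SignType.sign (x - q) :=
    hev.filter_mono nhdsWithin_le_nhds
  obtain ⟨x, hx, hxI⟩ := (hlt.and (Ioo_mem_nhdsLT hpq)).exists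
  rw [sign_neg (sub_neg.2 hxI.2), sign_eq_neg_one_iff] at hx
  exact absurd (hnn (Ioo_subset_Icc_self hxI)) (not_le.2 hx)

theorem natCast_mul_pi_lt (hθ : IsPruferAngle V μ θ) {k : ℕ} {s t : ℝ} (hst : s < t)
    (h : k * π ≤ θ s) : k * π < θ t := by
  refine sub_pos.1 (pos_of_deriv_pos_of_eq_zero (g := fun t => θ t - k * π) hst
    (fun x _ => (hθ x).sub_const _) (fun x _ hx => ?_) (sub_nonneg.2 h))
  rw [sub_eq_zero.1 hx, cos_nat_mul_pi, sin_nat_mul_pi, ← pow_mul, mul_comm k 2, pow_mul]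
  norm_num

theorem lt_natCast_mul_pi_add_half (hθ : IsPruferAngle V μ θ) {k : ℕ} {s t : ℝ} (hst : s ≤ t)
    (hV : ∀ x ≥ s, V x + μ < 0) (h : θ s < k * π + π / 2) : θ t < k * π + π / 2 := by
  rcases hst.eq_or_lt with rfl | hst
  · exact h
  refine sub_pos.1 (pos_of_deriv_pos_of_eq_zero (g := fun t => k * π + π / 2 - θ t) hst
    (fun x _ => (hθ x).const_sub _) (fun x hxI hx => ?_) (sub_nonneg.2 h.le))
  have hc : cos (k * π + π / 2) = 0 := by rw [cos_add_pi_div_two, sin_nat_mul_pi, neg_zero]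
  have hs : sin (k * π + π / 2) ^ 2 = 1 := by rw [sin_sq, hc]; norm_num
  rw [← sub_eq_zero.1 hx, hc, hs]
  linarith [hV x hxI.1]

theorem pos_of_one_lt (hθ : IsPruferAngle V μ θ) (h1 : 0 ≤ θ 1) {t : ℝ} (ht : 1 < t) :
    0 < θ t := by
  simpa using hθ.natCast_mul_pi_lt (k := 0) ht (by simpa using h1)

theorem continuousAt_parameter {Θ : ℝ → ℝ → ℝ} {M : ℝ} (hM : ∀ t, |V t| ≤ M)
    (hΘ : ∀ μ, IsPruferAngle V μ (Θ μ)) (hΘ1 : ∀ μ, Θ μ 1 = 0) (μ₀ : ℝ) {r : ℝ} (hr : 1 ≤ r) :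
    ContinuousAt (fun μ => Θ μ r) μ₀ := by
  rw [ContinuousAt, tendsto_iff_dist_tendsto_zero]
  refine squeeze_zero (g := fun μ => gronwallBound 0 (M + |μ₀| + 1) |μ - μ₀| (r - 1))
    (fun _ => dist_nonneg)
    (fun μ => (hΘ μ₀).dist_le hM (hΘ μ) (by rw [hΘ1, hΘ1]) hr) ?_
  have hc : Continuous fun μ => gronwallBound 0 (M + |μ₀| + 1) |μ - μ₀| (r - 1) :=
    (gronwallBound_continuous_ε 0 (M + |μ₀| + 1) (r - 1)).comp (by fun_prop)
  simpa [gronwallBound_ε0_δ0] using hc.tendsto μ₀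

/-- The angle `θ` is eventually trapped in the `k`-th quarter turn where `sin θ cos θ ≤ 0`. -/
def _root_.EventuallyTrapped (θ : ℝ → ℝ) (k : ℕ) : Prop :=
  ∀ᶠ r in atTop, k * π + π / 2 ≤ θ r ∧ θ r ≤ (k + 1 : ℕ) * π

theorem _root_.EventuallyTrapped.unique {k l : ℕ} (hk : EventuallyTrapped θ k)
    (hl : EventuallyTrapped θ l) : k = l := by
  obtain ⟨r, ⟨h1, h2⟩, h3, h4⟩ := (hk.and hl).exists
  have hπ := pi_pos
  push_cast at h2 h4
  have a : (k : ℝ) < l + 1 := by nlinarith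
  have b : (l : ℝ) < k + 1 := by nlinarith
  have a' : k < l + 1 := by exact_mod_cast a
  have b' : l < k + 1 := by exact_mod_cast b
  omega

theorem le_of_eventuallyTrapped (hθ : IsPruferAngle V μ θ) {k : ℕ} (hk : EventuallyTrapped θ k)
    (r : ℝ) : θ r ≤ (k + 1 : ℕ) * π := by
  by_contra! h
  obtain ⟨s, hs, hrs⟩ := (hk.and (eventually_gt_atTop r)).exists
  exact absurd (hθ.natCast_mul_pi_lt hrs h.le) (not_lt.2 hs.2)

theorem exists_eventuallyTrapped {Θ : ℝ → ℝ → ℝ} {M : ℝ} (hM : ∀ t, |V t| ≤ M)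
    (hV0 : Tendsto V atTop (𝓝 0)) (hΘ : ∀ μ, IsPruferAngle V μ (Θ μ)) (hΘ1 : ∀ μ, Θ μ 1 = 0)
    {k : ℕ} (hk : ∃ R ≥ 1, (k + 1 : ℕ) * π < Θ 0 R) :
    ∃ μ < 0, EventuallyTrapped (Θ μ) k := by
  set S : Set ℝ := {μ | μ < 0 ∧ ∃ R ≥ 1, (k + 1 : ℕ) * π < Θ μ R} with hS
  have hπ := pi_pos
  have hne : S.Nonempty := by
    obtain ⟨R, hR, h⟩ := hk
    have hev : ∀ᶠ μ in 𝓝[<] 0, (k + 1 : ℕ) * π < Θ μ R :=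
      ((continuousAt_parameter hM hΘ hΘ1 0 hR).eventually_const_lt h).filter_mono
        nhdsWithin_le_nhds
    obtain ⟨μ, hμ, hμ0⟩ := (hev.and self_mem_nhdsWithin).exists
    exact ⟨μ, hμ0, R, hR, hμ⟩
  have hbdd : BddBelow S := by
    refine ⟨-M, fun μ ⟨_, R, hR, hμR⟩ => ?_⟩
    by_contra! hlt
    have := (hΘ μ).lt_natCast_mul_pi_add_half (k := 0) hR
      (fun x _ => by linarith [(abs_le.1 (hM x)).2]) (by rw [hΘ1]; simp [hπ])
    push_cast at hμR this
    nlinarith [(Nat.cast_nonneg k : (0 : ℝ) ≤ k)]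
  set μ := sInf S with hμ
  have hμ0 : μ < 0 := by
    obtain ⟨ν, hν⟩ := hne
    exact (csInf_le hbdd hν).trans_lt hν.1
  have hμS : ∀ R ≥ 1, Θ μ R ≤ (k + 1 : ℕ) * π := by
    intro R hR
    by_contra! h
    have hev : ∀ᶠ ν in 𝓝[<] μ, (k + 1 : ℕ) * π < Θ ν R :=
      ((continuousAt_parameter hM hΘ hΘ1 μ hR).eventually_const_lt h).filter_mono
        nhdsWithin_le_nhds
    obtain ⟨ν, hν, hνμ⟩ := (hev.and self_mem_nhdsWithin).exists
    have hνμ : ν < μ := hνμ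
    exact absurd (csInf_le hbdd (show ν ∈ S from ⟨hνμ.trans hμ0, R, hR, hν⟩)) (not_le.2 hνμ)
  refine ⟨μ, hμ0, ?_⟩
  obtain ⟨R₀, hR₀⟩ := eventually_atTop.1
    (hV0.eventually_lt_const (show (0 : ℝ) < -μ / 2 by linarith))
  filter_upwards [eventually_ge_atTop R₀, eventually_ge_atTop 1] with r hr hr1
  refine ⟨?_, hμS r hr1⟩
  by_contra! hlt
  have hev : ∀ᶠ ν in 𝓝 μ, Θ ν r < k * π + π / 2 ∧ ν < μ / 2 :=
    ((continuousAt_parameter hM hΘ hΘ1 μ hr1).eventually_lt_const hlt).and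
      (eventually_lt_nhds (by linarith))
  obtain ⟨ε, hε, hball⟩ := Metric.eventually_nhds_iff.1 hev
  obtain ⟨ν, ⟨hν0, R, hR, hνR⟩, hνε⟩ := exists_lt_of_csInf_lt hne (show sInf S < μ + ε by linarith)
  have hμν : μ ≤ ν := csInf_le hbdd ⟨hν0, R, hR, hνR⟩
  obtain ⟨h1, h2⟩ := hball (show dist ν μ < ε by
    rw [Real.dist_eq, abs_of_nonneg (by linarith)]; linarith)
  have hlt' : (k : ℝ) * π + π / 2 < (k + 1 : ℕ) * π := by push_cast; nlinarith
  rcases lt_or_ge R r with hRr | hRr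
  · linarith [(hΘ ν).natCast_mul_pi_lt hRr hνR.le]
  · have := (hΘ ν).lt_natCast_mul_pi_add_half (k := k) hRr
      (fun x hx => by linarith [hR₀ x (hr.trans hx)]) h1
    linarith

theorem exists_lt_of_eventuallyTrapped {M : ℝ} (hV : Continuous V) (hM : ∀ t, |V t| ≤ M)
    (h₁ : IsPruferAngle V μ₁ θ₁) (h₂ : IsPruferAngle V μ₂ θ₂) (hμ : μ₁ < μ₂) (h : θ₁ 1 = θ₂ 1)
    {k : ℕ} (hk : EventuallyTrapped θ₁ k) : ∃ R ≥ 1, (k + 1 : ℕ) * π < θ₂ R := by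
  by_contra! hle
  have hπ := pi_pos
  obtain ⟨R, hR1, hR⟩ : ∃ R ≥ 1, ∀ r ≥ R, k * π + π / 2 ≤ θ₁ r := by
    obtain ⟨R, hR⟩ := eventually_atTop.1 hk
    exact ⟨max R 1, le_max_right _ _, fun r hr => (hR r ((le_max_left _ _).trans hr)).1⟩
  have hord : ∀ r ≥ R, θ₁ r ≤ θ₂ r := fun r hr => h₁.le_of_le hV h₂ hμ.le h.le (hR1.trans hr)
  have hlt : ∀ r ≥ R, θ₂ r < (k + 1 : ℕ) * π := by
    intro r hr
    refine (hle r (hR1.trans hr)).lt_of_ne fun he => ?_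
    exact absurd (h₂.natCast_mul_pi_lt (lt_add_one r) he.ge)
      (not_lt.2 (hle (r + 1) (by linarith)))
  -- shift by `k * π` to work in the second quadrant
  have key : ∀ x : ℝ, k * π + π / 2 ≤ x → x < (k + 1 : ℕ) * π →
      0 < sin (x - k * π) ∧ cos (x - k * π) ≤ 0 := by
    intro x h1 h2
    push_cast at h2
    exact ⟨sin_pos_of_pos_of_lt_pi (by linarith) (by linarith),
      cos_nonpos_of_pi_div_two_le_of_le (by linarith) (by linarith)⟩
  have hs : ∀ x : ℝ, sin (x - k * π) ^ 2 = sin x ^ 2 := by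
    intro x
    rw [sin_sub_nat_mul_pi, mul_pow, ← pow_mul, mul_comm k 2, pow_mul]; norm_num
  have hc : ∀ x : ℝ, cos (x - k * π) ^ 2 = cos x ^ 2 := by
    intro x
    rw [cos_sub_nat_mul_pi, mul_pow, ← pow_mul, mul_comm k 2, pow_mul]; norm_num
  have hq₁ : ∀ r ≥ R, 0 < sin (θ₁ r - k * π) ∧ cos (θ₁ r - k * π) ≤ 0 := fun r hr =>
    key _ (hR r hr) ((hord r hr).trans_lt (hlt r hr))
  have hq₂ : ∀ r ≥ R, 0 < sin (θ₂ r - k * π) ∧ cos (θ₂ r - k * π) ≤ 0 := fun r hr =>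
    key _ ((hR r hr).trans (hord r hr)) (hlt r hr)
  have hcot : ∀ (μ : ℝ) (θ : ℝ → ℝ), IsPruferAngle V μ θ → ∀ r, 0 < sin (θ r - k * π) →
      HasDerivAt (fun r => cos (θ r - k * π) / sin (θ r - k * π))
        (-(V r + μ) - (cos (θ r - k * π) / sin (θ r - k * π)) ^ 2) r := by
    intro μ θ hθ r hr
    have hd := (hθ r).sub_const (k * π)
    refine (hd.cos.div hd.sin hr.ne').congr_deriv ?_
    rw [← hs, ← hc]
    field_simp
    linear_combination (-cos (θ r - k * π) ^ 2 - (V r + μ) * sin (θ r - k * π) ^ 2) *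
      sin_sq_add_cos_sq (θ r - k * π)
  set y₁ : ℝ → ℝ := fun r => cos (θ₁ r - k * π) / sin (θ₁ r - k * π) with hy₁
  set y₂ : ℝ → ℝ := fun r => cos (θ₂ r - k * π) / sin (θ₂ r - k * π) with hy₂
  have hy₁0 : ∀ r ≥ R, y₁ r ≤ 0 := fun r hr =>
    div_nonpos_of_nonpos_of_nonneg (hq₁ r hr).2 (hq₁ r hr).1.le
  have hy₂0 : ∀ r ≥ R, y₂ r ≤ 0 := fun r hr =>
    div_nonpos_of_nonpos_of_nonneg (hq₂ r hr).2 (hq₂ r hr).1.le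
  have hyd : ∀ r ≥ R, 0 ≤ y₁ r - y₂ r := by
    intro r hr
    have e : y₁ r - y₂ r = sin (θ₂ r - θ₁ r) / (sin (θ₁ r - k * π) * sin (θ₂ r - k * π)) := by
      have := (hq₁ r hr).1.ne'
      have := (hq₂ r hr).1.ne'
      rw [show θ₂ r - θ₁ r = (θ₂ r - k * π) - (θ₁ r - k * π) by ring, sin_sub]
      simp only [hy₁, hy₂]
      field_simp
    rw [e]
    refine div_nonneg (sin_nonneg_of_nonneg_of_le_pi (by linarith [hord r hr]) ?_)
      (mul_pos (hq₁ r hr).1 (hq₂ r hr).1).le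
    have := hlt r hr
    push_cast at this
    linarith [hR r hr]
  have hgrow : ∀ r ≥ R, y₂ r ≤ -((μ₂ - μ₁) * (r - R)) := by
    intro r hr
    have hmono : MonotoneOn (fun r => y₁ r - y₂ r - (μ₂ - μ₁) * (r - R)) (Ici R) := by
      have hd : ∀ x ∈ Ici R, HasDerivAt (fun r => y₁ r - y₂ r - (μ₂ - μ₁) * (r - R))
          ((-(V x + μ₁) - y₁ x ^ 2) - (-(V x + μ₂) - y₂ x ^ 2) - (μ₂ - μ₁) * 1) x := fun x hx =>
        ((hcot _ _ h₁ x (hq₁ x hx).1).sub (hcot _ _ h₂ x (hq₂ x hx).1)).sub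
          (((hasDerivAt_id x).sub_const R).const_mul _)
      refine monotoneOn_of_deriv_nonneg (convex_Ici R)
        (fun x hx => (hd x hx).continuousAt.continuousWithinAt)
        (fun x hx => (hd x (interior_subset hx)).differentiableAt.differentiableWithinAt)
        (fun x hx => ?_)
      replace hx := interior_subset hx
      rw [(hd x hx).deriv]
      nlinarith [hyd x hx, hy₁0 x hx, hy₂0 x hx]
    have := hmono self_mem_Ici hr hr
    simp only [sub_self, mul_zero, sub_zero] at this
    linarith [hyd R le_rfl, hy₁0 r hr]
  obtain ⟨R', hR'R, hR'⟩ : ∃ R' ≥ R, ∀ r ≥ R', 2 * (M + |μ₂|) + 1 ≤ y₂ r ^ 2 := by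
    have hB : 0 ≤ M + |μ₂| := add_nonneg ((abs_nonneg _).trans (hM 0)) (abs_nonneg _)
    refine ⟨R + (2 * (M + |μ₂|) + 1) / (μ₂ - μ₁), ?_, fun r hr => ?_⟩
    · have : 0 ≤ (2 * (M + |μ₂|) + 1) / (μ₂ - μ₁) := div_nonneg (by linarith) (by linarith)
      linarith
    · have h0 : 0 ≤ (2 * (M + |μ₂|) + 1) / (μ₂ - μ₁) := div_nonneg (by linarith) (by linarith)
      have h1 := hgrow r (by linarith)
      have h2 : (2 * (M + |μ₂|) + 1) / (μ₂ - μ₁) ≤ r - R := by linarith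
      rw [div_le_iff₀ (by linarith)] at h2
      nlinarith
  have hfast : ∀ r ≥ R', 1 / 2 ≤ cos (θ₂ r) ^ 2 + (V r + μ₂) * sin (θ₂ r) ^ 2 := by
    intro r hr
    have h1 := hR' r hr
    have h2 := (hq₂ r (hR'R.trans hr)).1
    have h3 := abs_le.1 (hM r)
    have h4 := neg_abs_le μ₂
    have h5 := sin_sq_add_cos_sq (θ₂ r - k * π)
    simp only [hy₂] at h1
    rw [div_pow, le_div_iff₀ (by positivity)] at h1
    rw [← hs, ← hc]
    nlinarith [sq_nonneg (sin (θ₂ r - k * π))]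
  have hmono : MonotoneOn (fun r => θ₂ r - 1 / 2 * r) (Ici R') := by
    have hd : ∀ x, HasDerivAt (fun r => θ₂ r - 1 / 2 * r)
        (cos (θ₂ x) ^ 2 + (V x + μ₂) * sin (θ₂ x) ^ 2 - 1 / 2 * 1) x := fun x =>
      (h₂ x).sub ((hasDerivAt_id x).const_mul _)
    refine monotoneOn_of_deriv_nonneg (convex_Ici R')
      (fun x _ => (hd x).continuousAt.continuousWithinAt)
      (fun x _ => (hd x).differentiableAt.differentiableWithinAt) (fun x hx => ?_)
    rw [(hd x).deriv]
    linarith [hfast x (interior_subset hx)]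
  have h1 := hmono self_mem_Ici (show R' + 2 * π ∈ Ici R' from by simp [hπ.le])
    (by linarith : R' ≤ R' + 2 * π)
  have h2 := hlt (R' + 2 * π) (by linarith)
  have h3 := (hR R' hR'R).trans (hord R' hR'R)
  push_cast at h2
  simp only at h1
  linarith

/-- The amplitude `ρ` belonging to a Prüfer angle, normalised by `ρ 1 = 1`. -/
noncomputable def _root_.pruferRadius (V : ℝ → ℝ) (μ : ℝ) (θ : ℝ → ℝ) (r : ℝ) : ℝ :=
  exp (∫ s in (1 : ℝ)..r, (1 - V s - μ) * (sin (θ s) * cos (θ s)))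

theorem _root_.pruferRadius_pos (V : ℝ → ℝ) (μ : ℝ) (θ : ℝ → ℝ) (r : ℝ) :
    0 < pruferRadius V μ θ r := exp_pos _

theorem hasDerivAt_pruferRadius (hV : Continuous V) (hθ : IsPruferAngle V μ θ) (r : ℝ) :
    HasDerivAt (pruferRadius V μ θ)
      (pruferRadius V μ θ r * ((1 - V r - μ) * (sin (θ r) * cos (θ r)))) r := by
  have hc : Continuous fun s => (1 - V s - μ) * (sin (θ s) * cos (θ s)) := by
    have := hθ.continuous
    fun_prop
  exact ((hc.integral_hasStrictDerivAt 1 r).hasDerivAt).exp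

theorem hasDerivAt_radius_mul_sin (hV : Continuous V) (hθ : IsPruferAngle V μ θ) (r : ℝ) :
    HasDerivAt (fun r => pruferRadius V μ θ r * sin (θ r))
      (pruferRadius V μ θ r * cos (θ r)) r := by
  refine ((hasDerivAt_pruferRadius hV hθ r).mul (hθ r).sin).congr_deriv ?_
  linear_combination (pruferRadius V μ θ r * cos (θ r)) * sin_sq_add_cos_sq (θ r)

theorem hasDerivAt_radius_mul_cos (hV : Continuous V) (hθ : IsPruferAngle V μ θ) (r : ℝ) :
    HasDerivAt (fun r => pruferRadius V μ θ r * cos (θ r))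
      (-(V r + μ) * (pruferRadius V μ θ r * sin (θ r))) r := by
  refine ((hasDerivAt_pruferRadius hV hθ r).mul (hθ r).cos).congr_deriv ?_
  linear_combination (-(V r + μ) * (pruferRadius V μ θ r * sin (θ r))) * sin_sq_add_cos_sq (θ r)

theorem _root_.eq_of_hasDerivAt_eq_zero_Ioi {f : ℝ → ℝ} {a : ℝ} (hc : ContinuousOn f (Ici a))
    (hd : ∀ r > a, HasDerivAt f 0 r) {r : ℝ} (hr : a ≤ r) : f r = f a := by
  rcases hr.eq_or_lt with rfl | hr
  · rfl
  obtain ⟨c, -, h⟩ := exists_hasDerivAt_eq_slope f (fun _ => 0) hr (hc.mono Icc_subset_Ici_self)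
    (fun x hx => hd x hx.1)
  have := (div_eq_zero_iff.1 h.symm).resolve_right (sub_ne_zero.2 hr.ne')
  linarith

theorem exists_eq_mul_radius (hV : Continuous V) (hθ : IsPruferAngle V μ θ) {U W : ℝ → ℝ}
    (hUc : ContinuousOn U (Ici 1)) (hWc : ContinuousOn W (Ici 1))
    (hU : ∀ r > 1, HasDerivAt U (W r) r) (hW : ∀ r > 1, HasDerivAt W (-(V r + μ) * U r) r)
    (h1 : U 1 * cos (θ 1) = W 1 * sin (θ 1)) :
    ∃ B, ∀ r ≥ 1, U r = B * (pruferRadius V μ θ r * sin (θ r)) := by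
  set u : ℝ → ℝ := fun r => pruferRadius V μ θ r * sin (θ r) with hu
  set w : ℝ → ℝ := fun r => pruferRadius V μ θ r * cos (θ r) with hw
  have hu' : ∀ r, HasDerivAt u (w r) r := hasDerivAt_radius_mul_sin hV hθ
  have hw' : ∀ r, HasDerivAt w (-(V r + μ) * u r) r := hasDerivAt_radius_mul_cos hV hθ
  have huc : ContinuousOn u (Ici 1) := fun x _ => (hu' x).continuousAt.continuousWithinAt
  have hwc : ContinuousOn w (Ici 1) := fun x _ => (hw' x).continuousAt.continuousWithinAt
  have hpos : ∀ r, 0 < u r ^ 2 + w r ^ 2 := by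
    intro r
    have : u r ^ 2 + w r ^ 2 = pruferRadius V μ θ r ^ 2 := by
      simp only [hu, hw]
      linear_combination pruferRadius V μ θ r ^ 2 * sin_sq_add_cos_sq (θ r)
    rw [this]
    exact pow_pos (pruferRadius_pos V μ θ r) 2
  have hA : ∀ r ≥ 1, U r * w r - W r * u r = 0 := by
    intro r hr
    rw [eq_of_hasDerivAt_eq_zero_Ioi (f := fun r => U r * w r - W r * u r)
      ((hUc.mul hwc).sub (hWc.mul huc)) (fun r hr => ?_) hr]
    · simp only [hu, hw]
      linear_combination pruferRadius V μ θ 1 * h1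
    · refine (((hU r hr).mul (hw' r)).sub ((hW r hr).mul (hu' r))).congr_deriv ?_
      ring
  have hB : ∀ r ≥ 1, (U r * u r + W r * w r) / (u r ^ 2 + w r ^ 2)
      = (U 1 * u 1 + W 1 * w 1) / (u 1 ^ 2 + w 1 ^ 2) := by
    intro r hr
    refine eq_of_hasDerivAt_eq_zero_Ioi
      (f := fun r => (U r * u r + W r * w r) / (u r ^ 2 + w r ^ 2))
      (((hUc.mul huc).add (hWc.mul hwc)).div ((huc.pow 2).add (hwc.pow 2))
        fun x _ => (hpos x).ne') (fun r hr => ?_) hr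
    refine ((((hU r hr).mul (hu' r)).add ((hW r hr).mul (hw' r))).div
      (((hu' r).pow 2).add ((hw' r).pow 2)) (hpos r).ne').congr_deriv ?_
    rw [div_eq_zero_iff]
    left
    simp only [Pi.add_apply, Pi.mul_apply, Pi.pow_apply]
    push_cast
    linear_combination (-(1 - V r - μ) * (u r ^ 2 - w r ^ 2)) * hA r hr.le
  refine ⟨(U 1 * u 1 + W 1 * w 1) / (u 1 ^ 2 + w 1 ^ 2), fun r hr => ?_⟩
  rw [← hB r hr, div_mul_eq_mul_div, eq_div_iff (hpos r).ne']
  linear_combination w r * hA r hr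

theorem hasDerivAt_radius_sq_mul_sin_mul_cos (hV : Continuous V) (hθ : IsPruferAngle V μ θ)
    (r : ℝ) :
    HasDerivAt
      (fun r => pruferRadius V μ θ r * sin (θ r) * (pruferRadius V μ θ r * cos (θ r)))
      ((pruferRadius V μ θ r * cos (θ r)) ^ 2
        - (V r + μ) * (pruferRadius V μ θ r * sin (θ r)) ^ 2) r :=
  ((hasDerivAt_radius_mul_sin hV hθ r).mul (hasDerivAt_radius_mul_cos hV hθ r)).congr_deriv
    (by ring)

theorem _root_.sin_mul_cos_pos_of_mem_Ioo {k : ℕ} {x : ℝ} (h1 : k * π < x)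
    (h2 : x < k * π + π / 2) : 0 < sin x * cos x := by
  have hs : sin (x - k * π) * cos (x - k * π) = sin x * cos x := by
    rw [sin_sub_nat_mul_pi, cos_sub_nat_mul_pi, mul_mul_mul_comm, ← mul_pow]
    norm_num
  rw [← hs]
  exact mul_pos (sin_pos_of_pos_of_lt_pi (by linarith) (by linarith [pi_pos]))
    (cos_pos_of_mem_Ioo ⟨by linarith [pi_pos], by linarith⟩)

theorem _root_.sin_mul_cos_nonpos_of_mem_Icc {k : ℕ} {x : ℝ} (h1 : k * π + π / 2 ≤ x)
    (h2 : x ≤ (k + 1 : ℕ) * π) : sin x * cos x ≤ 0 := by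
  have hs : sin (x - k * π) * cos (x - k * π) = sin x * cos x := by
    rw [sin_sub_nat_mul_pi, cos_sub_nat_mul_pi, mul_mul_mul_comm, ← mul_pow]
    norm_num
  push_cast at h2
  rw [← hs]
  exact mul_nonpos_of_nonneg_of_nonpos
    (sin_nonneg_of_nonneg_of_le_pi (by linarith [pi_pos]) (by linarith))
    (cos_nonpos_of_pi_div_two_le_of_le (by linarith) (by linarith [pi_pos]))

theorem eventuallyTrapped_of_sin_mul_cos_nonpos (hθ : IsPruferAngle V μ θ) {R : ℝ}
    (hR : ∀ r ≥ R, V r + μ < 0) (h0 : 0 < θ R) (h : ∀ r ≥ R, sin (θ r) * cos (θ r) ≤ 0) :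
    ∃ k, EventuallyTrapped θ k := by
  have hπ := pi_pos
  have hn : ⌈θ R / π⌉₊ ≠ 0 := (Nat.ceil_pos.2 (div_pos h0 hπ)).ne'
  obtain ⟨k, hk⟩ := Nat.exists_eq_succ_of_ne_zero hn
  have h1 : k * π < θ R := by
    rw [← lt_div_iff₀ hπ]
    exact Nat.lt_ceil.1 (by omega)
  have h2 : θ R ≤ (k + 1 : ℕ) * π := by
    rw [← div_le_iff₀ hπ]
    exact (Nat.le_ceil _).trans (by rw [hk])
  refine ⟨k, ?_⟩
  filter_upwards [eventually_ge_atTop R] with r hr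
  have h3 : k * π < θ r := by
    rcases hr.eq_or_lt with rfl | hr
    · exact h1
    · exact hθ.natCast_mul_pi_lt hr h1.le
  have h4 : θ r < (k + 1 : ℕ) * π + π / 2 :=
    hθ.lt_natCast_mul_pi_add_half hr hR (by linarith)
  refine ⟨?_, ?_⟩
  · by_contra! hlt
    exact absurd (sin_mul_cos_pos_of_mem_Ioo h3 hlt) (not_lt.2 (h r hr))
  · by_contra! hlt
    exact absurd (sin_mul_cos_pos_of_mem_Ioo hlt h4) (not_lt.2 (h r hr))

/-- `ψ` is a square integrable Dirichlet eigenfunction of `-d²/dr² - V` on `(1, ∞)`. -/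
def _root_.IsDirichletEigenfunction (V : ℝ → ℝ) (μ : ℝ) (ψ : ℝ → ℝ) : Prop :=
  (∃ r ≥ (1 : ℝ), ψ r ≠ 0) ∧ ContDiffOn ℝ 2 ψ (Ici 1) ∧ ψ 1 = 0 ∧
    IntegrableOn (fun r => ψ r ^ 2) (Ioi 1) ∧
    ∀ r > (1 : ℝ), deriv (deriv ψ) r + V r * ψ r + μ * ψ r = 0

theorem eventuallyTrapped_of_isDirichletEigenfunction (hV : Continuous V)
    (hV0 : Tendsto V atTop (𝓝 0)) (hμ : μ < 0) (hθ : IsPruferAngle V μ θ) (hθ1 : θ 1 = 0)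
    {ψ : ℝ → ℝ} (hψ : IsDirichletEigenfunction V μ ψ) : ∃ k, EventuallyTrapped θ k := by
  obtain ⟨⟨r₀, hr₀, hne⟩, hreg, hψ1, hsq, hode⟩ := hψ
  have hev : ∀ r > (1 : ℝ), derivWithin ψ (Ici 1) =ᶠ[𝓝 r] deriv ψ := by
    intro r hr
    filter_upwards [Ioi_mem_nhds hr] with s hs
    exact derivWithin_of_mem_nhds (Ici_mem_nhds hs)
  have hreg' : ContDiffOn ℝ 1 (derivWithin ψ (Ici 1)) (Ici 1) :=
    hreg.derivWithin (uniqueDiffOn_Ici 1) (by norm_num)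
  have hdψ : ∀ r > (1 : ℝ), HasDerivAt ψ (derivWithin ψ (Ici 1) r) r := by
    intro r hr
    rw [(hev r hr).eq_of_nhds]
    exact ((hreg.differentiableOn (by norm_num)).differentiableAt (Ici_mem_nhds hr)).hasDerivAt
  have hddψ : ∀ r > (1 : ℝ), HasDerivAt (derivWithin ψ (Ici 1)) (-(V r + μ) * ψ r) r := by
    intro r hr
    have := ((hreg'.differentiableOn (by norm_num)).differentiableAt (Ici_mem_nhds hr)).hasDerivAt
    rw [(hev r hr).deriv_eq] at this
    refine this.congr_deriv ?_
    linarith [hode r hr]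
  obtain ⟨B, hB⟩ := exists_eq_mul_radius hV hθ hreg.continuousOn hreg'.continuousOn hdψ hddψ
    (by simp [hψ1, hθ1])
  set u : ℝ → ℝ := fun r => pruferRadius V μ θ r * sin (θ r) with hu
  set w : ℝ → ℝ := fun r => pruferRadius V μ θ r * cos (θ r) with hw
  have hB0 : B ≠ 0 := by
    rintro rfl
    exact hne (by rw [hB r₀ hr₀, zero_mul])
  have hu2 : IntegrableOn (fun r => u r ^ 2) (Ioi 1) := by
    have h := hsq.const_mul (B ^ 2)⁻¹
    refine IntegrableOn.congr_fun h (fun r hr => ?_) measurableSet_Ioi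
    rw [hB r (le_of_lt hr), mul_pow, inv_mul_cancel_left₀ (pow_ne_zero 2 hB0)]
  obtain ⟨R, hR⟩ := eventually_atTop.1
    ((hV0.eventually_lt_const (show (0 : ℝ) < -μ by linarith)).and (eventually_gt_atTop 1))
  refine hθ.eventuallyTrapped_of_sin_mul_cos_nonpos (R := R)
    (fun r hr => by linarith [(hR r hr).1]) (hθ.pos_of_one_lt hθ1.ge (hR R le_rfl).2)
    fun r₁ hr₁ => ?_
  by_contra! hpos
  have hp0 : 0 < u r₁ * w r₁ := by
    have := pow_pos (pruferRadius_pos V μ θ r₁) 2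
    calc 0 < pruferRadius V μ θ r₁ ^ 2 * (sin (θ r₁) * cos (θ r₁)) := mul_pos this hpos
      _ = _ := by simp only [hu, hw]; ring
  have hpmono : ∀ r ≥ r₁, u r₁ * w r₁ ≤ u r * w r := by
    have hd := hasDerivAt_radius_sq_mul_sin_mul_cos hV hθ
    have hm : MonotoneOn (fun r => u r * w r) (Ici r₁) := by
      refine monotoneOn_of_deriv_nonneg (convex_Ici r₁)
        (fun x _ => (hd x).continuousAt.continuousWithinAt)
        (fun x _ => (hd x).differentiableAt.differentiableWithinAt) (fun x hx => ?_)
      have hx : r₁ ≤ x := interior_subset hx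
      rw [(hd x).deriv]
      have := (hR x (hr₁.trans hx)).1
      nlinarith [sq_nonneg (w x), sq_nonneg (u x)]
    exact fun r hr => hm self_mem_Ici hr hr
  have hsq : ∀ r ≥ r₁ + 1, 2 * (u r₁ * w r₁) ≤ u r ^ 2 := by
    intro r hr
    have hd : ∀ x, HasDerivAt (fun r => u r ^ 2 - 2 * (u r₁ * w r₁) * r)
        (2 * u x * w x - 2 * (u r₁ * w r₁)) x := fun x => by
      refine (((hasDerivAt_radius_mul_sin hV hθ x).pow 2).sub
        ((hasDerivAt_id x).const_mul (2 * (u r₁ * w r₁)))).congr_deriv ?_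
      simp only [hu, hw]
      push_cast
      ring
    have hm : MonotoneOn (fun r => u r ^ 2 - 2 * (u r₁ * w r₁) * r) (Ici r₁) := by
      refine monotoneOn_of_deriv_nonneg (convex_Ici r₁)
        (fun x _ => (hd x).continuousAt.continuousWithinAt)
        (fun x _ => (hd x).differentiableAt.differentiableWithinAt) (fun x hx => ?_)
      rw [(hd x).deriv]
      linarith [hpmono x (interior_subset hx)]
    have := hm self_mem_Ici (show r ∈ Ici r₁ by simp only [mem_Ici]; linarith) (by linarith)
    simp only at this
    nlinarith [sq_nonneg (u r₁)]
  have hconst : IntegrableOn (fun _ : ℝ => 2 * (u r₁ * w r₁)) (Ioi (r₁ + 1)) := by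
    have hsub : Ioi (r₁ + 1) ⊆ Ioi (1 : ℝ) := Ioi_subset_Ioi (by linarith [(hR r₁ hr₁).2])
    refine Integrable.mono' (hu2.mono_set hsub) aestronglyMeasurable_const ?_
    filter_upwards [ae_restrict_mem measurableSet_Ioi] with r hr
    rw [norm_of_nonneg (by linarith)]
    exact hsq r (le_of_lt hr)
  rw [integrableOn_const_iff] at hconst
  simp only [volume_Ioi, lt_self_iff_false,
    or_false] at hconst
  exact hp0.ne' (mul_eq_zero.2 (by simpa using hconst))

theorem isDirichletEigenfunction_of_eventuallyTrapped (hV : Continuous V)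
    (hV0 : Tendsto V atTop (𝓝 0)) (hμ : μ < 0) (hθ : IsPruferAngle V μ θ) (hθ1 : θ 1 = 0)
    {k : ℕ} (hk : EventuallyTrapped θ k) :
    IsDirichletEigenfunction V μ (fun r => pruferRadius V μ θ r * sin (θ r)) := by
  set u : ℝ → ℝ := fun r => pruferRadius V μ θ r * sin (θ r) with hu
  set w : ℝ → ℝ := fun r => pruferRadius V μ θ r * cos (θ r) with hw
  have hu' : ∀ r, HasDerivAt u (w r) r := hasDerivAt_radius_mul_sin hV hθ
  have hw' : ∀ r, HasDerivAt w (-(V r + μ) * u r) r := hasDerivAt_radius_mul_cos hV hθ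
  have hdu : deriv u = w := funext fun r => (hu' r).deriv
  have hdw : deriv w = fun r => -(V r + μ) * u r := funext fun r => (hw' r).deriv
  have huc : Continuous u := continuous_iff_continuousAt.2 fun r => (hu' r).continuousAt
  refine ⟨?_, ?_, by simp [hu, hθ1], ?_, fun r _ => ?_⟩
  · by_contra! h0
    have hev : u =ᶠ[𝓝 2] fun _ => 0 := by
      filter_upwards [Ioi_mem_nhds (show (1 : ℝ) < 2 by norm_num)] with r hr
      exact h0 r (le_of_lt hr)
    have h2 : w 2 = 0 := by
      rw [← hdu, hev.deriv_eq, deriv_const]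
    have h1 : u 2 = 0 := hev.eq_of_nhds
    have hρ := (pruferRadius_pos V μ θ 2).ne'
    have hs := (mul_eq_zero.1 h1).resolve_left hρ
    have hc := (mul_eq_zero.1 h2).resolve_left hρ
    simpa [hs, hc] using sin_sq_add_cos_sq (θ 2)
  · have hw1 : ContDiff ℝ 1 w := by
      rw [contDiff_one_iff_deriv, hdw]
      exact ⟨fun r => (hw' r).differentiableAt, by fun_prop⟩
    have : ContDiff ℝ (1 + 1) u := by
      rw [contDiff_succ_iff_deriv, hdu]
      exact ⟨fun r => (hu' r).differentiableAt, by simp, hw1⟩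
    exact (by simpa [one_add_one_eq_two] using this : ContDiff ℝ 2 u).contDiffOn
  · obtain ⟨R, hR⟩ := eventually_atTop.1
      ((hV0.eventually_lt_const (show (0 : ℝ) < -μ / 2 by linarith)).and
        (hk.and (eventually_ge_atTop 1)))
    have hp : ∀ r ≥ R, u r * w r ≤ 0 := by
      intro r hr
      have h1 := sin_mul_cos_nonpos_of_mem_Icc (hR r hr).2.1.1 (hR r hr).2.1.2
      have h2 := pow_pos (pruferRadius_pos V μ θ r) 2
      calc u r * w r = pruferRadius V μ θ r ^ 2 * (sin (θ r) * cos (θ r)) := by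
            simp only [hu, hw]; ring
        _ ≤ 0 := mul_nonpos_of_nonneg_of_nonpos h2.le h1
    have hd : ∀ r, HasDerivAt (fun r => u r * w r) (w r ^ 2 - (V r + μ) * u r ^ 2) r :=
      hasDerivAt_radius_sq_mul_sin_mul_cos hV hθ
    have hge : ∀ r ≥ R, -μ / 2 * u r ^ 2 ≤ w r ^ 2 - (V r + μ) * u r ^ 2 := by
      intro r hr
      nlinarith [(hR r hr).1, sq_nonneg (u r), sq_nonneg (w r)]
    have hnn : ∀ r ≥ R, 0 ≤ w r ^ 2 - (V r + μ) * u r ^ 2 := fun r hr =>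
      (mul_nonneg (by linarith) (sq_nonneg _)).trans (hge r hr)
    have hm : MonotoneOn (fun r => u r * w r) (Ici R) := by
      refine monotoneOn_of_deriv_nonneg (convex_Ici R)
        (fun x _ => (hd x).continuousAt.continuousWithinAt)
        (fun x _ => (hd x).differentiableAt.differentiableWithinAt) (fun x hx => ?_)
      rw [(hd x).deriv]
      exact hnn x (interior_subset hx)
    have hfar : IntegrableOn (fun r => w r ^ 2 - (V r + μ) * u r ^ 2) (Ioi R) := by
      refine integrableOn_Ioi_of_intervalIntegral_norm_bounded (-(u R * w R)) R (b := id)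
        (fun b => ?_) tendsto_id ?_
      · have hcont : Continuous fun r => w r ^ 2 - (V r + μ) * u r ^ 2 := by
          have : Continuous w := continuous_iff_continuousAt.2 fun r => (hw' r).continuousAt
          fun_prop
        exact hcont.integrableOn_Ioc
      · filter_upwards [eventually_ge_atTop R] with b hb
        have hcont : Continuous fun r => w r ^ 2 - (V r + μ) * u r ^ 2 := by
          have : Continuous w := continuous_iff_continuousAt.2 fun r => (hw' r).continuousAt
          fun_prop
        have e : ∫ r in R..b, ‖w r ^ 2 - (V r + μ) * u r ^ 2‖ = u b * w b - u R * w R := by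
          rw [← intervalIntegral.integral_eq_sub_of_hasDerivAt (fun r _ => hd r)
            (hcont.intervalIntegrable _ _)]
          refine intervalIntegral.integral_congr fun r hr => ?_
          rw [uIcc_of_le hb] at hr
          exact norm_of_nonneg (hnn r hr.1)
        rw [id, e]
        linarith [hp b hb]
    have hfar' : IntegrableOn (fun r => u r ^ 2) (Ioi R) := by
      refine Integrable.mono' (hfar.const_mul (-μ / 2)⁻¹)
        (huc.pow 2).aestronglyMeasurable ?_
      filter_upwards [ae_restrict_mem measurableSet_Ioi] with r hr
      rw [norm_of_nonneg (sq_nonneg _), ← div_eq_inv_mul, le_div_iff₀ (by linarith)]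
      linarith [hge r (le_of_lt hr)]
    have h1R : (1 : ℝ) ≤ R := (hR R le_rfl).2.2
    rw [← Ioc_union_Ioi_eq_Ioi h1R]
    exact ((huc.pow 2).integrableOn_Ioc).union hfar'
  · rw [hdu, hdw]
    ring

theorem _root_.finite_and_ncard_negative_eigenvalues {M : ℝ} (hV : Continuous V)
    (hM : ∀ t, |V t| ≤ M) (hV0 : Tendsto V atTop (𝓝 0)) {n : ℕ} {θ₀ : ℝ → ℝ}
    (hθ₀ : IsPruferAngle V 0 θ₀) (hθ₀1 : θ₀ 1 = 0)
    (hn : ∀ k : ℕ, (∃ R ≥ 1, (k + 1 : ℕ) * π < θ₀ R) ↔ k < n) :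
    {μ : ℝ | μ < 0 ∧ ∃ ψ, IsDirichletEigenfunction V μ ψ}.Finite ∧
      {μ : ℝ | μ < 0 ∧ ∃ ψ, IsDirichletEigenfunction V μ ψ}.ncard = n := by
  choose Θ' hΘ'1 hΘ' using fun μ => exists_isPruferAngle hV hM μ 0
  obtain ⟨Θ, hΘ1, hΘ, hΘ0⟩ : ∃ Θ : ℝ → ℝ → ℝ, (∀ μ, Θ μ 1 = 0) ∧ (∀ μ, IsPruferAngle V μ (Θ μ)) ∧
      Θ 0 = θ₀ := by
    refine ⟨Function.update Θ' 0 θ₀, fun μ => ?_, fun μ => ?_, by simp⟩ <;>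
    · rcases eq_or_ne μ 0 with rfl | h
      · simpa
      · simpa [h] using by first | exact hΘ'1 μ | exact hΘ' μ
  have hiff : ∀ μ < 0, (∃ ψ, IsDirichletEigenfunction V μ ψ) ↔ ∃ k, EventuallyTrapped (Θ μ) k :=
    fun μ hμ => ⟨fun ⟨_, hψ⟩ =>
      eventuallyTrapped_of_isDirichletEigenfunction hV hV0 hμ (hΘ μ) (hΘ1 μ) hψ,
      fun ⟨_, hk⟩ =>
        ⟨_, isDirichletEigenfunction_of_eventuallyTrapped hV hV0 hμ (hΘ μ) (hΘ1 μ) hk⟩⟩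
  have hex : ∀ k < n, ∃ μ < 0, EventuallyTrapped (Θ μ) k := fun k hk =>
    exists_eventuallyTrapped hM hV0 hΘ hΘ1 (by rw [hΘ0]; exact (hn k).2 hk)
  choose! e he0 he using hex
  have hlt : ∀ μ ν, μ < ν → ∀ k, EventuallyTrapped (Θ μ) k → ¬ EventuallyTrapped (Θ ν) k := by
    intro μ ν hμν k hk hk'
    obtain ⟨R, -, hR⟩ := exists_lt_of_eventuallyTrapped hV hM (hΘ μ) (hΘ ν) hμν
      (by rw [hΘ1, hΘ1]) hk
    exact absurd ((hΘ ν).le_of_eventuallyTrapped hk' R) (not_le.2 hR)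
  have himage : {μ : ℝ | μ < 0 ∧ ∃ ψ, IsDirichletEigenfunction V μ ψ} = e '' (Finset.range n) := by
    ext μ
    constructor
    · rintro ⟨hμ, hψ⟩
      obtain ⟨k, hk⟩ := (hiff μ hμ).1 hψ
      have hkn : k < n := by
        rw [← hn k, ← hΘ0]
        exact exists_lt_of_eventuallyTrapped hV hM (hΘ μ) (hΘ 0) hμ (by rw [hΘ1, hΘ1]) hk
      refine ⟨k, by simpa using hkn, ?_⟩
      rcases lt_trichotomy (e k) μ with h | h | h
      · exact absurd hk (hlt _ _ h k (he k hkn))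
      · exact h
      · exact absurd (he k hkn) (hlt _ _ h k hk)
    · rintro ⟨k, hk, rfl⟩
      have hk : k < n := by simpa using hk
      exact ⟨he0 k hk, (hiff _ (he0 k hk)).2 ⟨k, he k hk⟩⟩
  have hinj : InjOn e (Finset.range n) := by
    intro k hk l hl hkl
    have hk : k < n := by simpa using hk
    have hl : l < n := by simpa using hl
    exact (he k hk).unique (hkl ▸ he l hl)
  rw [himage]
  exact ⟨(Finset.finite_toSet _).image _, by
    rw [hinj.ncard_image, ncard_coe_finset, Finset.card_range]⟩

theorem _root_.Nat.eq_Iio_ncard_of_isLowerSet {s : Set ℕ} (hs : IsLowerSet s) (hf : s.Finite) :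
    s = Iio s.ncard := by
  obtain ⟨n, hn, hmin⟩ : ∃ n, n ∉ s ∧ ∀ k < n, k ∈ s := by
    classical
    have hex : ∃ n, n ∉ s := hf.exists_notMem
    exact ⟨Nat.find hex, Nat.find_spec hex, fun k hk => not_not.1 (Nat.find_min hex hk)⟩
  have h : s = Iio n := by
    ext k
    exact ⟨fun hk => lt_of_not_ge fun hnk => hn (hs hnk hk), hmin k⟩
  rw [h, ← Finset.coe_Iio, ncard_coe_finset, Nat.card_Iio, Finset.coe_Iio]

theorem exists_lt_iff_lt_ncard_zeros (hV : Continuous V) {M : ℝ} (hM : ∀ t, |V t| ≤ M)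
    {θ₀ : ℝ → ℝ} (hθ₀ : IsPruferAngle V 0 θ₀) (hθ₀1 : θ₀ 1 = 0) {U W : ℝ → ℝ}
    (hUc : ContinuousOn U (Ici 1)) (hWc : ContinuousOn W (Ici 1))
    (hU : ∀ r > 1, HasDerivAt U (W r) r) (hW : ∀ r > 1, HasDerivAt W (-V r * U r) r)
    (hU1 : U 1 ≠ 0) {C : ℝ} (hUC : ∀ᶠ r in atTop, |U r| ≤ C)
    (hfin : {r | 1 < r ∧ U r = 0}.Finite) (k : ℕ) :
    (∃ R ≥ 1, (k + 1 : ℕ) * π < θ₀ R) ↔ k < {r | 1 < r ∧ U r = 0}.ncard := by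
  have hπ := pi_pos
  obtain ⟨θ, hθ1, hθ⟩ := exists_isPruferAngle hV hM 0 (π / 2 - arctan (W 1 / U 1))
  have hθpos : 0 < θ 1 := by rw [hθ1]; linarith [arctan_lt_pi_div_two (W 1 / U 1)]
  have hθlt : θ 1 < π := by rw [hθ1]; linarith [neg_pi_div_two_lt_arctan (W 1 / U 1)]
  obtain ⟨B, hB⟩ := exists_eq_mul_radius hV hθ hUc hWc hU (by simpa using hW) (by
    rw [hθ1, cos_pi_div_two_sub, sin_pi_div_two_sub, ← tan_mul_cos (cos_arctan_pos _).ne',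
      tan_arctan]
    field_simp)
  have hB0 : B ≠ 0 := by
    rintro rfl
    exact hU1 (by rw [hB 1 le_rfl, zero_mul])
  have hzero : ∀ r > 1, U r = 0 ↔ ∃ k : ℕ, θ r = (k + 1 : ℕ) * π := by
    intro r hr
    rw [hB r (le_of_lt hr), mul_eq_zero, or_iff_right hB0, mul_eq_zero,
      or_iff_right (pruferRadius_pos V 0 θ r).ne']
    constructor
    · intro h
      obtain ⟨z, hz⟩ := sin_eq_zero_iff.1 h
      have hpos := hθ.pos_of_one_lt hθpos.le hr
      rw [← hz] at hpos
      have hz0 : 0 < z := by exact_mod_cast pos_of_mul_pos_left hpos hπ.le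
      refine ⟨(z - 1).toNat, ?_⟩
      have hcast : ((((z - 1).toNat + 1 : ℕ) : ℤ) : ℝ) = z := by
        rw [show (((z - 1).toNat + 1 : ℕ) : ℤ) = z by omega]
      rw [Int.cast_natCast] at hcast
      rw [← hz, hcast]
    · rintro ⟨k, hk⟩
      rw [hk, sin_nat_mul_pi]
  have hivt : ∀ (k : ℕ) (r : ℝ), 1 ≤ r → (k + 1 : ℕ) * π ≤ θ r →
      ∃ s > 1, s ≤ r ∧ θ s = (k + 1 : ℕ) * π := by
    intro k r hr hk
    have hk1 : θ 1 < (k + 1 : ℕ) * π := by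
      push_cast
      nlinarith [(Nat.cast_nonneg k : (0 : ℝ) ≤ k)]
    obtain ⟨s, hs, hsk⟩ := intermediate_value_Icc hr hθ.continuous.continuousOn ⟨hk1.le, hk⟩
    refine ⟨s, hs.1.lt_of_ne fun h => ?_, hs.2, hsk⟩
    rw [← h] at hsk
    exact hk1.ne hsk
  set K : Set ℕ := {k | ∃ r > 1, θ r = (k + 1 : ℕ) * π} with hK
  have hcard : K.ncard = {r | 1 < r ∧ U r = 0}.ncard ∧ K.Finite := by
    choose! z hz1 hz using (fun k (hk : k ∈ K) => hk)
    have hinj : InjOn z K := by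
      intro k hk l hl hkl
      have h := hz k hk
      rw [hkl, hz l hl] at h
      have := mul_right_cancel₀ hπ.ne' h
      exact_mod_cast (by exact_mod_cast this : l + 1 = k + 1) |> Nat.succ.inj |>.symm
    have himage : z '' K = {r | 1 < r ∧ U r = 0} := by
      ext r
      constructor
      · rintro ⟨k, hk, rfl⟩
        exact ⟨hz1 k hk, (hzero _ (hz1 k hk)).2 ⟨k, hz k hk⟩⟩
      · rintro ⟨hr, h0⟩
        obtain ⟨k, hk⟩ := (hzero r hr).1 h0
        have hkK : k ∈ K := ⟨r, hr, hk⟩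
        refine ⟨k, hkK, ?_⟩
        rcases lt_trichotomy (z k) r with h | h | h
        · exact absurd (hθ.natCast_mul_pi_lt h (hz k hkK).ge) (by rw [hk]; exact lt_irrefl _)
        · exact h
        · exact absurd (hθ.natCast_mul_pi_lt h hk.ge) (by rw [hz k hkK]; exact lt_irrefl _)
    rw [← himage] at hfin ⊢
    exact ⟨hinj.ncard_image.symm, hfin.of_finite_image hinj⟩
  have hlow : IsLowerSet K := by
    rintro k l hlk ⟨r, hr, hk⟩
    obtain ⟨s, hs, -, hsl⟩ := hivt l r (le_of_lt hr) (by
      rw [hk]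
      gcongr)
    exact ⟨s, hs, hsl⟩
  have hKn : ∀ k, k ∈ K ↔ k < {r | 1 < r ∧ U r = 0}.ncard := by
    intro k
    rw [← hcard.1]
    conv_lhs => rw [Nat.eq_Iio_ncard_of_isLowerSet hlow hcard.2]
    rfl
  set n := {r | 1 < r ∧ U r = 0}.ncard with hn
  constructor
  · rintro ⟨R, hR, h⟩
    rw [← hKn]
    obtain ⟨s, hs, -, hsk⟩ := hivt k R hR
      (h.le.trans (hθ₀.le_of_le hV hθ le_rfl (by rw [hθ₀1]; exact hθpos.le) hR))
    exact ⟨s, hs, hsk⟩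
  intro hkn
  obtain ⟨l, hl⟩ := Nat.exists_eq_succ_of_ne_zero (Nat.ne_zero_of_lt hkn)
  obtain ⟨r₁, hr₁, hr₁l⟩ := (hKn l).2 (by omega)
  by_contra! hle
  have hle' : ∀ r ≥ 1, θ₀ r ≤ (l + 1 : ℕ) * π := fun r hr =>
    (hle r hr).trans (by gcongr; omega)
  have hord : ∀ r ≥ 1, θ₀ r < θ r := fun r hr =>
    hθ₀.lt_of_lt hV hθ le_rfl (by rw [hθ₀1]; exact hθpos) hr
  have hord' : ∀ r ≥ 1, θ r < θ₀ r + π := fun r hr =>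
    hθ.lt_of_lt hV hθ₀.add_pi le_rfl (by rw [hθ₀1]; linarith) hr
  have hlo : ∀ r > r₁, (l + 1 : ℕ) * π < θ r := fun r hr => hθ.natCast_mul_pi_lt hr hr₁l.ge
  have hhi : ∀ r > r₁, θ r < (l + 1 : ℕ) * π + π := by
    intro r hr
    linarith [hord' r (hr₁.trans hr).le, hle' r (hr₁.trans hr).le]
  have hlt₀ : ∀ r > r₁, θ₀ r < (l + 1 : ℕ) * π := by
    intro r hr
    refine (hle' r (hr₁.trans hr).le).lt_of_ne fun he => ?_
    exact absurd (hθ₀.natCast_mul_pi_lt (lt_add_one r) he.ge)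
      (not_lt.2 (hle' (r + 1) (by linarith [hr₁.trans hr])))
  set u₀ : ℝ → ℝ := fun r => pruferRadius V 0 θ₀ r * sin (θ₀ r) with hu₀
  set w₀ : ℝ → ℝ := fun r => pruferRadius V 0 θ₀ r * cos (θ₀ r) with hw₀
  set u : ℝ → ℝ := fun r => pruferRadius V 0 θ r * sin (θ r) with hu
  set w : ℝ → ℝ := fun r => pruferRadius V 0 θ r * cos (θ r) with hw
  have hu₀' : ∀ r, HasDerivAt u₀ (w₀ r) r := hasDerivAt_radius_mul_sin hV hθ₀
  have hw₀' : ∀ r, HasDerivAt w₀ (-(V r + 0) * u₀ r) r := hasDerivAt_radius_mul_cos hV hθ₀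
  have hu' : ∀ r, HasDerivAt u (w r) r := hasDerivAt_radius_mul_sin hV hθ
  have hw' : ∀ r, HasDerivAt w (-(V r + 0) * u r) r := hasDerivAt_radius_mul_cos hV hθ
  have hwr : ∀ r ≥ 1, w₀ r * u r - u₀ r * w r = sin (θ 1) := by
    have hd : ∀ r, HasDerivAt (fun r => w₀ r * u r - u₀ r * w r) 0 r := fun r =>
      (((hw₀' r).mul (hu' r)).sub ((hu₀' r).mul (hw' r))).congr_deriv (by ring)
    intro r hr
    rw [eq_of_hasDerivAt_eq_zero_Ioi (f := fun r => w₀ r * u r - u₀ r * w r)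
      (fun x _ => (hd x).continuousAt.continuousWithinAt) (fun r _ => hd r) hr]
    simp [hu₀, hw₀, hu, hw, hθ₀1, pruferRadius]
  have hκ : 0 < sin (θ 1) := sin_pos_of_pos_of_lt_pi hθpos hθlt
  have hsgn : ∀ r > r₁, u₀ r * u r < 0 := by
    intro r hr
    have h1 : 0 < sin (θ r - (l + 1 : ℕ) * π) :=
      sin_pos_of_pos_of_lt_pi (by linarith [hlo r hr]) (by linarith [hhi r hr])
    have h2 : sin (θ₀ r - (l + 1 : ℕ) * π) < 0 :=
      sin_neg_of_neg_of_neg_pi_lt (by linarith [hlt₀ r hr])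
        (by linarith [hlo r hr, hord' r (hr₁.trans hr).le])
    have h3 : sin (θ₀ r) * sin (θ r) < 0 := by
      have e : sin (θ₀ r - (l + 1 : ℕ) * π) * sin (θ r - (l + 1 : ℕ) * π)
          = sin (θ₀ r) * sin (θ r) := by
        rw [sin_sub_nat_mul_pi, sin_sub_nat_mul_pi, mul_mul_mul_comm, ← mul_pow]
        norm_num
      rw [← e]
      exact mul_neg_of_neg_of_pos h2 h1
    calc u₀ r * u r = pruferRadius V 0 θ₀ r * pruferRadius V 0 θ r * (sin (θ₀ r) * sin (θ r)) := by
          simp only [hu₀, hu]; ring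
      _ < 0 := mul_neg_of_pos_of_neg
          (mul_pos (pruferRadius_pos V 0 θ₀ r) (pruferRadius_pos V 0 θ r)) h3
  have hu0 : ∀ r > r₁, u r ≠ 0 := fun r hr h => by simpa [h] using hsgn r hr
  have hneg : ∀ r > r₁, u₀ r / u r < 0 := by
    intro r hr
    have hur := hu0 r hr
    rw [show u₀ r / u r = u₀ r * u r / u r ^ 2 by field_simp]
    exact div_neg_of_neg_of_pos (hsgn r hr) (sq_pos_of_ne_zero hur)
  have hquot : ∀ r > r₁, HasDerivAt (fun r => u₀ r / u r) (sin (θ 1) / u r ^ 2) r := fun r hr =>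
    ((hu₀' r).div (hu' r) (hu0 r hr)).congr_deriv (by rw [hwr r (hr₁.trans hr).le])
  obtain ⟨R, hR⟩ := eventually_atTop.1 (hUC.and (eventually_gt_atTop r₁))
  have hC0 : 0 < |C / B| := by
    rw [abs_pos, div_ne_zero_iff]
    refine ⟨fun h => ?_, hB0⟩
    have h1 := (hR R le_rfl).1
    rw [h, abs_nonpos_iff, hB R (hr₁.trans (hR R le_rfl).2).le, mul_eq_zero, or_iff_right hB0] at h1
    exact hu0 R (hR R le_rfl).2 h1
  have hbd : ∀ r ≥ R, u r ^ 2 ≤ |C / B| ^ 2 := by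
    intro r hr
    have h1 := (hR r hr).1
    rw [hB r (hr₁.trans (hR r hr).2).le, abs_mul] at h1
    rw [← sq_abs (u r)]
    refine pow_le_pow_left₀ (abs_nonneg _) ?_ 2
    rw [abs_div, le_div_iff₀ (abs_pos.2 hB0), mul_comm]
    exact h1.trans (le_abs_self C)
  set c := sin (θ 1) / |C / B| ^ 2 with hc
  have hc0 : 0 < c := by positivity
  have hm : MonotoneOn (fun r => u₀ r / u r - c * r) (Ici R) := by
    have hd : ∀ x ∈ Ici R, HasDerivAt (fun r => u₀ r / u r - c * r)
        (sin (θ 1) / u x ^ 2 - c * 1) x := fun x hx =>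
      (hquot x (hR x hx).2).sub ((hasDerivAt_id x).const_mul c)
    refine monotoneOn_of_deriv_nonneg (convex_Ici R)
      (fun x hx => (hd x hx).continuousAt.continuousWithinAt)
      (fun x hx => (hd x (interior_subset hx)).differentiableAt.differentiableWithinAt)
      (fun x hx => ?_)
    replace hx := interior_subset hx
    rw [(hd x hx).deriv, mul_one, sub_nonneg, hc]
    have := hbd x hx
    have := sq_pos_of_ne_zero (hu0 x (hR x hx).2)
    gcongr
  have hstep : 0 ≤ -(u₀ R / u R) / c := div_nonneg (by linarith [hneg R (hR R le_rfl).2]) hc0.le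
  have h1 := hm self_mem_Ici (show R + -(u₀ R / u R) / c ∈ Ici R by simp [hstep]) (by linarith)
  have h2 := hneg (R + -(u₀ R / u R) / c) (hR _ (by linarith)).2
  have h3 : c * (-(u₀ R / u R) / c) = -(u₀ R / u R) := mul_div_cancel₀ _ hc0.ne'
  simp only at h1
  linarith

end IsPruferAngle

end PruferAngle

section LaneEmden

open Real Topology

/-- `Z` solves the radial equation `Z'' + (2 / r) Z' + Z ^ (2 m + 1) = 0` on `(0, ∞)`, with
derivative `Y`. -/
def IsLaneEmden (m : ℕ) (Z Y : ℝ → ℝ) : Prop :=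
  ∀ r > 0, HasDerivAt Z (Y r) r ∧ HasDerivAt Y (-(2 / r) * Y r - Z r ^ (2 * m + 1)) r

/-- The generator of the scaling symmetry of the Lane-Emden equation, applied to `Z`. -/
noncomputable def scalingGenerator (m : ℕ) (Z Y : ℝ → ℝ) (r : ℝ) : ℝ := Z r / m + r * Y r

namespace IsLaneEmden

variable {m : ℕ} {Z Y : ℝ → ℝ}

theorem hasDerivAt_scalingGenerator (h : IsLaneEmden m Z Y) {r : ℝ} (hr : 0 < r) :
    HasDerivAt (scalingGenerator m Z Y) ((1 / m - 1) * Y r - r * Z r ^ (2 * m + 1)) r := by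
  refine (((h r hr).1.div_const (m : ℝ)).add ((hasDerivAt_id r).mul (h r hr).2)).congr_deriv ?_
  simp only [id]
  field_simp
  ring

theorem hasDerivAt_mul_scalingGenerator (h : IsLaneEmden m Z Y) {r : ℝ} (hr : 0 < r) :
    HasDerivAt (fun r => r * scalingGenerator m Z Y r)
      (Z r / m + r * Y r / m - r ^ 2 * Z r ^ (2 * m + 1)) r := by
  refine ((hasDerivAt_id r).mul (h.hasDerivAt_scalingGenerator hr)).congr_deriv ?_
  simp only [id, scalingGenerator]
  ring

/-- The scaling generator, multiplied by `r`, solves the linearized equation. -/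
theorem hasDerivAt_deriv_mul_scalingGenerator (h : IsLaneEmden m Z Y) (hm : m ≠ 0) {r : ℝ}
    (hr : 0 < r) :
    HasDerivAt (fun r => Z r / m + r * Y r / m - r ^ 2 * Z r ^ (2 * m + 1))
      (-((2 * m + 1) * Z r ^ (2 * m)) * (r * scalingGenerator m Z Y r)) r := by
  have hm' : (m : ℝ) ≠ 0 := by exact_mod_cast hm
  refine ((((h r hr).1.div_const (m : ℝ)).add
    (((hasDerivAt_id r).mul (h r hr).2).div_const (m : ℝ))).sub
    ((hasDerivAt_pow 2 r).mul ((h r hr).1.pow (2 * m + 1)))).congr_deriv ?_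
  simp only [id, scalingGenerator, Nat.add_sub_cancel, Pi.pow_apply]
  push_cast
  rw [pow_succ (Z r)]
  field_simp
  ring

/-- The energy of `Z` in the scale invariant variables. -/
noncomputable def energy (m : ℕ) (Z Y : ℝ → ℝ) (r : ℝ) : ℝ :=
  scalingGenerator m Z Y r ^ 2 / 2 - (1 / m) * (1 - 1 / m) * Z r ^ 2 / 2 +
    r ^ 2 * Z r ^ (2 * m + 2) / (2 * m + 2)

theorem antitoneOn_rpow_mul_energy (h : IsLaneEmden m Z Y) (hm : 2 ≤ m) :
    AntitoneOn (fun r => r ^ (2 / m : ℝ) * energy m Z Y r) (Ioi 0) := by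
  have hm' : (2 : ℝ) ≤ m := by exact_mod_cast hm
  have hd : ∀ r ∈ Ioi (0 : ℝ), HasDerivAt (fun r => r ^ (2 / m : ℝ) * energy m Z Y r)
      (-(r ^ (2 / m : ℝ) * ((1 - 2 / m) * scalingGenerator m Z Y r ^ 2 / r))) r := by
    intro r hr
    have hr' : r ≠ 0 := (ne_of_gt hr)
    have hE : HasDerivAt (energy m Z Y) _ r :=
      ((((h.hasDerivAt_scalingGenerator hr).pow 2).div_const 2).sub
        ((((h r hr).1.pow 2).const_mul ((1 / m : ℝ) * (1 - 1 / m))).div_const 2)).add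
        (((hasDerivAt_pow 2 r).mul ((h r hr).1.pow (2 * m + 2))).div_const (2 * m + 2 : ℝ))
    refine ((hasDerivAt_rpow_const (p := (2 / m : ℝ)) (Or.inl hr')).mul hE).congr_deriv ?_
    rw [rpow_sub_one hr']
    simp only [energy, scalingGenerator, Pi.pow_apply]
    have e1 : 2 * m + 2 - 1 = 2 * m + 1 := by omega
    have e2 : Z r ^ (2 * m + 2) = Z r ^ (2 * m) * Z r ^ 2 := pow_add _ _ _
    have e3 : Z r ^ (2 * m + 1) = Z r ^ (2 * m) * Z r := pow_succ _ _
    rw [e1, e2, e3]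
    push_cast
    generalize Z r ^ (2 * m) = P
    generalize r ^ (2 / m : ℝ) = X
    have : (m : ℝ) ≠ 0 := by positivity
    have : (2 * m + 2 : ℝ) ≠ 0 := by positivity
    field_simp
    ring
  refine antitoneOn_of_deriv_nonpos (convex_Ioi 0)
    (fun x hx => (hd x hx).continuousAt.continuousWithinAt)
    (fun x hx => (hd x (interior_subset hx)).differentiableAt.differentiableWithinAt)
    (fun x hx => ?_)
  replace hx : 0 < x := interior_subset hx
  rw [(hd x hx).deriv, neg_nonpos]
  have : 0 ≤ 1 - 2 / (m : ℝ) := by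
    rw [sub_nonneg, div_le_one (by positivity)]
    exact hm'
  positivity

theorem tendsto_mul_scalingGenerator (hZ : Tendsto (fun r => r * Z r) atTop (𝓝 1))
    (hY : Tendsto (fun r => r ^ 2 * Y r) atTop (𝓝 (-1))) :
    Tendsto (fun r => r * scalingGenerator m Z Y r) atTop (𝓝 (1 / m - 1)) := by
  refine ((hZ.div_const (m : ℝ)).add hY).congr fun r => ?_
  simp only [scalingGenerator]
  ring

theorem energy_pos (h : IsLaneEmden m Z Y) (hm : 2 < m)
    (hZ : Tendsto (fun r => r * Z r) atTop (𝓝 1))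
    (hY : Tendsto (fun r => r ^ 2 * Y r) atTop (𝓝 (-1))) {r : ℝ} (hr : 0 < r) :
    0 < energy m Z Y r := by
  have hm' : (2 : ℝ) < m := by exact_mod_cast hm
  have hlim : Tendsto (fun r => r ^ 2 * energy m Z Y r) atTop
      (𝓝 ((1 / m - 1) ^ 2 / 2 - (1 / m) * (1 - 1 / m) * 1 ^ 2 / 2 + 1 ^ 4 * 0 / (2 * m + 2))) := by
    have hZ0 : Tendsto Z atTop (𝓝 0) := by
      have := tendsto_inv_atTop_zero.mul hZ
      rw [zero_mul] at this
      refine this.congr' ?_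
      filter_upwards [eventually_gt_atTop 0] with x hx
      rw [inv_mul_cancel_left₀ hx.ne']
    have hZ2 : Tendsto (fun r => Z r ^ (2 * m - 2)) atTop (𝓝 0) := by
      simpa [show 2 * m - 2 ≠ 0 by omega] using hZ0.pow (2 * m - 2)
    refine ((((tendsto_mul_scalingGenerator hZ hY).pow 2).div_const 2).sub
      (((hZ.pow 2).const_mul ((1 / m : ℝ) * (1 - 1 / m))).div_const 2)).add
      (((hZ.pow 4).mul hZ2).div_const (2 * m + 2 : ℝ)) |>.congr fun r => ?_
    have e : Z r ^ (2 * m + 2) = Z r ^ 4 * Z r ^ (2 * m - 2) := by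
      rw [← pow_add]
      congr 1
      omega
    simp only [energy, e]
    ring
  have hpos : 0 < (1 / m - 1 : ℝ) ^ 2 / 2 - (1 / m) * (1 - 1 / m) * 1 ^ 2 / 2 +
      1 ^ 4 * 0 / (2 * m + 2) := by
    have h1 : (1 / m : ℝ) < 1 / 2 := by gcongr
    have h2 : (0 : ℝ) < (1 - 1 / m) * (1 - 2 * (1 / m)) :=
      mul_pos (by linarith) (by linarith)
    calc 0 < (1 - 1 / m : ℝ) * (1 - 2 * (1 / m)) / 2 := by linarith
      _ = _ := by ring
  obtain ⟨R, hRlim, hRr⟩ :=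
    ((hlim.eventually (lt_mem_nhds hpos)).and (eventually_gt_atTop r)).exists
  have hR : 0 < R := hr.trans hRr
  have hER : 0 < energy m Z Y R := pos_of_mul_pos_right hRlim (by positivity)
  have hanti := h.antitoneOn_rpow_mul_energy hm.le hr hR hRr.le
  simp only at hanti
  have : 0 < R ^ (2 / m : ℝ) * energy m Z Y R := mul_pos (rpow_pos_of_pos hR _) hER
  exact pos_of_mul_pos_right (this.trans_le hanti) (rpow_pos_of_pos hr _).le

/-- At a zero of the scaling generator, its derivative has sign opposite to `Z`. -/
theorem mul_deriv_scalingGenerator_neg (hm : 2 < m) {r : ℝ} (hr : 0 < r)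
    (hE : 0 < energy m Z Y r) (h0 : scalingGenerator m Z Y r = 0) :
    Z r * ((1 / m - 1) * Y r - r * Z r ^ (2 * m + 1)) < 0 := by
  have hm' : (2 : ℝ) < m := by exact_mod_cast hm
  have e2 : Z r ^ (2 * m + 2) = Z r ^ (2 * m) * Z r ^ 2 := pow_add _ _ _
  have e3 : Z r ^ (2 * m + 1) = Z r ^ (2 * m) * Z r := pow_succ _ _
  have hY : r * Y r = -(Z r / m) := by rw [scalingGenerator] at h0; linarith
  rw [energy, h0, e2] at hE
  have hP : 0 ≤ Z r ^ (2 * m) * Z r ^ 2 := by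
    rw [← e2]
    exact Even.pow_nonneg ⟨m + 1, by omega⟩ _
  have hle : r ^ 2 * (Z r ^ (2 * m) * Z r ^ 2) / (2 * m + 2)
      ≤ r ^ 2 * (Z r ^ (2 * m) * Z r ^ 2) / 2 := by
    gcongr
    linarith
  refine neg_of_mul_neg_right (a := r) ?_ hr.le
  calc r * (Z r * ((1 / m - 1) * Y r - r * Z r ^ (2 * m + 1)))
      = Z r * ((1 / m - 1) * (r * Y r)) - r ^ 2 * (Z r ^ (2 * m) * Z r ^ 2) := by rw [e3]; ring
    _ < 0 := by
      rw [hY]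
      have : Z r * ((1 / m - 1) * -(Z r / m)) = (1 / m) * (1 - 1 / m) * Z r ^ 2 := by ring
      rw [this]
      linarith

theorem ne_zero_of_scalingGenerator_eq_zero {r : ℝ} (hE : 0 < energy m Z Y r)
    (h0 : scalingGenerator m Z Y r = 0) : Z r ≠ 0 := by
  intro hZ
  simp [energy, h0, hZ] at hE

theorem exists_zero_between_zeros_scalingGenerator (h : IsLaneEmden m Z Y) (hm : 2 < m)
    (hE : ∀ r > 0, 0 < energy m Z Y r) {x y : ℝ} (hx : 0 < x) (hxy : x < y)
    (hGx : scalingGenerator m Z Y x = 0) (hGy : scalingGenerator m Z Y y = 0) :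
    ∃ z ∈ Icc x y, Z z = 0 := by
  by_contra! hne
  have hZx : Z x ≠ 0 := ne_zero_of_scalingGenerator_eq_zero (hE x hx) hGx
  have hsign : ∀ r ∈ Icc x y, 0 < Z x * Z r := by
    intro r hr
    by_contra! hle
    have hc : ContinuousOn (fun r => Z x * Z r) (Icc x r) := fun s hs =>
      ((h s (hx.trans_le hs.1)).1.const_mul (Z x)).continuousAt.continuousWithinAt
    obtain ⟨s, hs, hs0⟩ := intermediate_value_Icc' hr.1 hc ⟨hle, mul_self_nonneg (Z x)⟩
    rcases mul_eq_zero.1 hs0 with h1 | h1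
    · exact hZx h1
    · exact hne s ⟨hs.1, hs.2.trans hr.2⟩ h1
  have hpos := pos_of_deriv_pos_of_eq_zero (g := fun r => -Z x * scalingGenerator m Z Y r) hxy
    (fun r hr => (h.hasDerivAt_scalingGenerator (hx.trans_le hr.1)).const_mul (-Z x))
    (fun r hr h0 => ?_) (by simp [hGx])
  · simp [hGy] at hpos
  · have hr0 : 0 < r := hx.trans_le hr.1
    rw [mul_eq_zero, or_iff_right (neg_ne_zero.2 hZx)] at h0
    have hneg := mul_deriv_scalingGenerator_neg hm hr0 (hE r hr0) h0
    rw [neg_mul, neg_pos]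
    by_contra! hle
    have h1 : 0 ≤ (Z x * ((1 / m - 1) * Y r - r * Z r ^ (2 * m + 1))) * (Z x * Z r) :=
      mul_nonneg hle (hsign r hr).le
    have h2 : 0 < Z x ^ 2 := by positivity
    nlinarith [mul_neg_of_pos_of_neg h2 hneg]

theorem hasDerivAt_rpow_mul (h : IsLaneEmden m Z Y) {r : ℝ} (hr : 0 < r) :
    HasDerivAt (fun r => r ^ (1 / m : ℝ) * Z r)
      (r ^ (1 / m : ℝ) / r * scalingGenerator m Z Y r) r := by
  refine ((hasDerivAt_rpow_const (p := (1 / m : ℝ)) (Or.inl hr.ne')).mul (h r hr).1).congr_deriv ?_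
  rw [rpow_sub_one hr.ne', scalingGenerator]
  field_simp

theorem exists_scalingGenerator_eq_zero_between_zeros (h : IsLaneEmden m Z Y) {x y : ℝ}
    (hx : 0 < x) (hxy : x < y) (hZx : Z x = 0) (hZy : Z y = 0) :
    ∃ z ∈ Ioo x y, scalingGenerator m Z Y z = 0 := by
  obtain ⟨z, hz, hz0⟩ := exists_hasDerivAt_eq_zero hxy
    (fun r hr => (h.hasDerivAt_rpow_mul (hx.trans_le hr.1)).continuousAt.continuousWithinAt)
    (by simp [hZx, hZy]) (fun r hr => h.hasDerivAt_rpow_mul (hx.trans hr.1))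
  have hz' : 0 < z := hx.trans hz.1
  exact ⟨z, hz, (mul_eq_zero.1 hz0).resolve_left (by positivity)⟩

theorem exists_scalingGenerator_eq_zero_of_lt (h : IsLaneEmden m Z Y) (hm : 2 ≤ m)
    (hZ : Tendsto (fun r => r * Z r) atTop (𝓝 1))
    (hY : Tendsto (fun r => r ^ 2 * Y r) atTop (𝓝 (-1))) {x : ℝ} (hx : 0 < x) (hZx : Z x = 0) :
    ∃ z > x, scalingGenerator m Z Y z = 0 := by
  have hm' : (2 : ℝ) ≤ m := by exact_mod_cast hm
  have hneg : (1 / m - 1 : ℝ) < 0 := by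
    rw [sub_neg, div_lt_one (by positivity)]
    linarith
  obtain ⟨R, ⟨hR1, hR2⟩, hxR⟩ := (((hZ.eventually (lt_mem_nhds one_pos)).and
    ((tendsto_mul_scalingGenerator (m := m) hZ hY).eventually (gt_mem_nhds hneg))).and
    (eventually_gt_atTop x)).exists
  have hR : 0 < R := hx.trans hxR
  have hZR : 0 < Z R := pos_of_mul_pos_right hR1 hR.le
  have hGR : scalingGenerator m Z Y R < 0 := neg_of_mul_neg_right hR2 hR.le
  obtain ⟨c, hc, hcs⟩ := exists_hasDerivAt_eq_slope _ _ hxR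
    (fun r hr => (h.hasDerivAt_rpow_mul (hx.trans_le hr.1)).continuousAt.continuousWithinAt)
    (fun r hr => h.hasDerivAt_rpow_mul (hx.trans hr.1))
  have hc0 : 0 < c := hx.trans hc.1
  have hGc : 0 < scalingGenerator m Z Y c := by
    refine pos_of_mul_pos_right (a := c ^ (1 / m : ℝ) / c) ?_ (by positivity)
    rw [hcs, hZx, mul_zero, sub_zero]
    exact div_pos (by positivity) (sub_pos.2 hxR)
  obtain ⟨z, hz, hz0⟩ := intermediate_value_Icc' hc.2.le
    (fun r hr => (h.hasDerivAt_scalingGenerator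
      (hc0.trans_le hr.1)).continuousAt.continuousWithinAt) ⟨hGR.le, hGc.le⟩
  exact ⟨z, hc.1.trans_le hz.1, hz0⟩

theorem finite_and_ncard_zeros_scalingGenerator (h : IsLaneEmden m Z Y) (hm : 2 < m)
    (hZ : Tendsto (fun r => r * Z r) atTop (𝓝 1))
    (hY : Tendsto (fun r => r ^ 2 * Y r) atTop (𝓝 (-1))) {rs : ℕ → ℝ} (hrs : StrictAnti rs)
    (hzeros : {r : ℝ | 0 < r ∧ Z r = 0} = range rs) (j : ℕ) :
    {r | rs j < r ∧ scalingGenerator m Z Y r = 0}.Finite ∧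
      {r | rs j < r ∧ scalingGenerator m Z Y r = 0}.ncard = j + 1 := by
  have hE : ∀ r > 0, 0 < energy m Z Y r := fun r hr => h.energy_pos hm hZ hY hr
  have hrs' : ∀ i, 0 < rs i ∧ Z (rs i) = 0 := fun i => hzeros.symm.subset (mem_range_self i)
  have hz : ∀ i, ∃ z > rs i, scalingGenerator m Z Y z = 0 ∧ ∀ k < i, z < rs k := by
    rintro (_ | i)
    · obtain ⟨z, hz, hz0⟩ :=
        h.exists_scalingGenerator_eq_zero_of_lt hm.le hZ hY (hrs' 0).1 (hrs' 0).2
      exact ⟨z, hz, hz0, fun k hk => absurd hk (Nat.not_lt_zero k)⟩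
    · obtain ⟨z, hz, hz0⟩ := h.exists_scalingGenerator_eq_zero_between_zeros (hrs' (i + 1)).1
        (hrs i.lt_succ_self) (hrs' (i + 1)).2 (hrs' i).2
      exact ⟨z, hz.1, hz0, fun k hk => hz.2.trans_le (hrs.antitone (Nat.lt_succ_iff.1 hk))⟩
  choose z hz1 hz0 hzlt using hz
  have hanti : StrictAnti z := fun i k hik => (hzlt k i hik).trans (hz1 i)
  have heq : {r | rs j < r ∧ scalingGenerator m Z Y r = 0} = z '' Finset.range (j + 1) := by
    ext r
    constructor
    · rintro ⟨hjr, hr0⟩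
      classical
      have hex : ∃ i, rs i < r := ⟨j, hjr⟩
      set i := Nat.find hex with hi
      have hir : rs i < r := Nat.find_spec hex
      have hlt : ∀ k < i, r ≤ rs k := fun k hk => not_lt.1 (Nat.find_min hex hk)
      refine ⟨i, Finset.mem_range.2 (Nat.lt_succ_iff.2 (Nat.find_min' hex hjr)), ?_⟩
      have hno : ∀ s > rs i, Z s = 0 → r ≤ s ∧ z i < s := by
        intro s hs hs0
        obtain ⟨l, rfl⟩ := hzeros.subset ⟨(hrs' i).1.trans hs, hs0⟩
        have hli : l < i := hrs.lt_iff_gt.1 hs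
        exact ⟨hlt l hli, hzlt i l hli⟩
      rcases lt_trichotomy (z i) r with hzr | hzr | hzr
      · obtain ⟨s, hs, hs0⟩ := h.exists_zero_between_zeros_scalingGenerator hm hE
          ((hrs' i).1.trans (hz1 i)) hzr (hz0 i) hr0
        have hrs_eq : s = r := hs.2.antisymm (hno s ((hz1 i).trans_le hs.1) hs0).1
        rw [hrs_eq] at hs0
        exact absurd hs0 (ne_zero_of_scalingGenerator_eq_zero (hE r ((hrs' i).1.trans hir)) hr0)
      · exact hzr
      · obtain ⟨s, hs, hs0⟩ := h.exists_zero_between_zeros_scalingGenerator hm hE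
          ((hrs' i).1.trans hir) hzr hr0 (hz0 i)
        exact absurd (hno s (hir.trans_le hs.1) hs0).2 (not_lt.2 hs.2)
    · rintro ⟨i, hi, rfl⟩
      have hij : i ≤ j := by simpa [Nat.lt_succ_iff] using hi
      exact ⟨(hrs.antitone hij).trans_lt (hz1 i), hz0 i⟩
  rw [heq]
  refine ⟨(Finset.finite_toSet _).image z, ?_⟩
  rw [ncard_image_of_injective _ hanti.injective, ncard_coe_finset, Finset.card_range]

end IsLaneEmden

end LaneEmden

/-- the linearized operator $L_j$ around $Q_j$ has exactly $j+1$
negative (radial Dirichlet) eigenvalues, expressed via the substitution $ψ(r)=rφ(r)$. -/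
theorem stmt_1
    (m : ℕ) (hm : 2 < m)
    (Z : ℝ → ℝ) (rs : ℕ → ℝ)
    (hZreg : ContDiffOn ℝ 2 Z (Set.Ioi 0))
    (hZode : ∀ r > (0:ℝ), deriv (deriv Z) r + (2 / r) * deriv Z r + Z r ^ (2 * m + 1) = 0)
    (hZdecay : ∃ C > (0:ℝ), ∀ r ≥ (1:ℝ), |r * Z r - 1| ≤ C / r ^ 2)
    (hZderiv : Filter.Tendsto (fun r => r ^ 2 * deriv Z r) Filter.atTop (nhds (-1)))
    (hrs_pos : ∀ j, 0 < rs j)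
    (hrs_anti : StrictAnti rs)
    (hrs_lim : Filter.Tendsto rs Filter.atTop (nhds 0))
    (hrs_zeros : {r : ℝ | 0 < r ∧ Z r = 0} = Set.range rs)
    (Q : ℕ → ℝ → ℝ)
    (hQ : ∀ j r, Q j r = rs j ^ ((1:ℝ) / (m:ℝ)) * Z (rs j * r))
    (j : ℕ) :
    {μ : ℝ | μ < 0 ∧ ∃ ψ : ℝ → ℝ,
        (∃ r ≥ (1:ℝ), ψ r ≠ 0) ∧
        ContDiffOn ℝ 2 ψ (Set.Ici 1) ∧
        ψ 1 = 0 ∧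
        MeasureTheory.IntegrableOn (fun r => ψ r ^ 2) (Set.Ioi 1) ∧
        (∀ r > (1:ℝ), deriv (deriv ψ) r + (2 * m + 1) * Q j r ^ (2 * m) * ψ r + μ * ψ r = 0)}.Finite
    ∧
    {μ : ℝ | μ < 0 ∧ ∃ ψ : ℝ → ℝ,
        (∃ r ≥ (1:ℝ), ψ r ≠ 0) ∧
        ContDiffOn ℝ 2 ψ (Set.Ici 1) ∧
        ψ 1 = 0 ∧
        MeasureTheory.IntegrableOn (fun r => ψ r ^ 2) (Set.Ioi 1) ∧
        (∀ r > (1:ℝ), deriv (deriv ψ) r + (2 * m + 1) * Q j r ^ (2 * m) * ψ r + μ * ψ r = 0)}.ncard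
      = j + 1 := by
  have hm0 : m ≠ 0 := by omega
  have hmR : (m : ℝ) ≠ 0 := by exact_mod_cast hm0
  have hLE : IsLaneEmden m Z (deriv Z) := by
    intro r hr
    have hreg' : ContDiffOn ℝ 1 (deriv Z) (Ioi 0) := hZreg.deriv_of_isOpen isOpen_Ioi (by norm_num)
    refine ⟨((hZreg.differentiableOn (by norm_num)).differentiableAt
      (Ioi_mem_nhds hr)).hasDerivAt, ?_⟩
    refine ((hreg'.differentiableOn (by norm_num)).differentiableAt
      (Ioi_mem_nhds hr)).hasDerivAt.congr_deriv ?_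
    linarith [hZode r hr]
  have hZlim : Tendsto (fun r => r * Z r) atTop (nhds 1) := by
    obtain ⟨C, -, hC⟩ := hZdecay
    rw [tendsto_iff_norm_sub_tendsto_zero]
    refine squeeze_zero' (Eventually.of_forall fun r => norm_nonneg _)
      ((eventually_ge_atTop 1).mono hC) ?_
    exact tendsto_const_nhds.div_atTop (tendsto_pow_atTop two_ne_zero)
  have hj := hrs_pos j
  have hQpow : ∀ r, Q j r ^ (2 * m) = rs j ^ 2 * Z (rs j * r) ^ (2 * m) := by
    intro r
    rw [hQ, mul_pow, ← Real.rpow_mul_natCast hj.le, ← Real.rpow_natCast (rs j) 2]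
    congr 2
    push_cast
    field_simp
  set V : ℝ → ℝ := fun r => (2 * m + 1) * Q j (max r 1) ^ (2 * m) with hVdef
  have hVeq : ∀ r > 1, V r = (2 * m + 1) * Q j r ^ (2 * m) := fun r hr => by
    simp only [hVdef, max_eq_left (le_of_lt hr)]
  have hV : Continuous V := by
    have hc : Continuous fun r => Z (rs j * max r 1) :=
      hZreg.continuousOn.comp_continuous (by fun_prop)
        (fun r => mul_pos hj (one_pos.trans_le (le_max_right r 1)))
    simp only [hVdef, hQpow]
    exact continuous_const.mul (continuous_const.mul (hc.pow (2 * m)))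
  have hV0 : Tendsto V atTop (nhds 0) := by
    have hZ0 : Tendsto Z atTop (nhds 0) := by
      have := tendsto_inv_atTop_zero.mul hZlim
      rw [zero_mul] at this
      refine this.congr' ?_
      filter_upwards [eventually_gt_atTop 0] with x hx
      rw [inv_mul_cancel_left₀ hx.ne']
    have h1 : Tendsto (fun r => (2 * m + 1) * (rs j ^ 2 * Z (rs j * r) ^ (2 * m))) atTop
        (nhds ((2 * m + 1) * (rs j ^ 2 * 0 ^ (2 * m)))) :=
      (((hZ0.comp (tendsto_id.const_mul_atTop hj)).pow (2 * m)).const_mul _).const_mul _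
    rw [zero_pow (by omega), mul_zero, mul_zero] at h1
    refine h1.congr' ?_
    filter_upwards [eventually_gt_atTop 1] with r hr
    rw [hVeq r hr, hQpow]
  obtain ⟨M, hM⟩ : ∃ M, ∀ t, |V t| ≤ M := by
    obtain ⟨R, hR⟩ := eventually_atTop.1 (hV0.abs.eventually (gt_mem_nhds (by simp :
      |(0 : ℝ)| < 1)))
    obtain ⟨B, hB⟩ := (isCompact_Icc (a := 1) (b := max R 1)).exists_bound_of_continuousOn
      hV.continuousOn
    refine ⟨max B 1, fun t => ?_⟩
    have ht : V t = V (max t 1) := by simp [hVdef]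
    rw [ht]
    rcases le_total R (max t 1) with h | h
    · exact (hR _ h).le.trans (le_max_right _ _)
    · exact (hB _ ⟨le_max_right _ _, h.trans (le_max_left _ _)⟩).trans (le_max_left _ _)
  obtain ⟨θ₀, hθ₀1, hθ₀⟩ := exists_isPruferAngle hV hM 0 0
  obtain ⟨hGfin, hGcard⟩ :=
    hLE.finite_and_ncard_zeros_scalingGenerator hm hZlim hZderiv hrs_anti hrs_zeros j
  set G := scalingGenerator m Z (deriv Z) with hG
  set U : ℝ → ℝ := fun r => rs j * r * G (rs j * r) with hUdef
  set W : ℝ → ℝ := fun r => (Z (rs j * r) / m + rs j * r * deriv Z (rs j * r) / m -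
    (rs j * r) ^ 2 * Z (rs j * r) ^ (2 * m + 1)) * (rs j * 1) with hWdef
  have hscale : ∀ r : ℝ, HasDerivAt (fun r => rs j * r) (rs j * 1) r := fun r =>
    (hasDerivAt_id r).const_mul (rs j)
  have hU : ∀ r ≥ 1, HasDerivAt U (W r) r := fun r hr =>
    (hLE.hasDerivAt_mul_scalingGenerator (mul_pos hj (one_pos.trans_le hr))).comp r (hscale r)
  have hW : ∀ r ≥ 1, HasDerivAt W (-((2 * m + 1) * Z (rs j * r) ^ (2 * m)) *
      (rs j * r * G (rs j * r)) * (rs j * 1) * (rs j * 1)) r := fun r hr =>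
    ((hLE.hasDerivAt_deriv_mul_scalingGenerator hm0
      (mul_pos hj (one_pos.trans_le hr))).comp r (hscale r)).mul_const (rs j * 1)
  have hUzeros : (fun r => rs j * r) '' {r | 1 < r ∧ U r = 0} = {r | rs j < r ∧ G r = 0} := by
    ext x
    constructor
    · rintro ⟨r, ⟨hr, hr0⟩, rfl⟩
      have hr' : 0 < rs j * r := mul_pos hj (one_pos.trans hr)
      exact ⟨lt_mul_of_one_lt_right hj hr, (mul_eq_zero.1 hr0).resolve_left hr'.ne'⟩
    · rintro ⟨hx, hx0⟩
      have hxr : rs j * (x / rs j) = x := mul_div_cancel₀ x hj.ne'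
      refine ⟨x / rs j, ⟨(one_lt_div hj).2 hx, ?_⟩, hxr⟩
      simp only [hUdef, hxr, hx0, mul_zero]
  have hinj : Function.Injective fun r => rs j * r := mul_right_injective₀ hj.ne'
  have hUfin : {r | 1 < r ∧ U r = 0}.Finite := by
    rw [← hUzeros] at hGfin
    exact hGfin.of_finite_image hinj.injOn
  have hUcard : {r | 1 < r ∧ U r = 0}.ncard = j + 1 := by
    rw [← hGcard, ← hUzeros, ncard_image_of_injective _ hinj]
  have hU1 : U 1 ≠ 0 := by
    have hZj : Z (rs j) = 0 := (hrs_zeros.symm.subset (mem_range_self j)).2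
    have hE := hLE.energy_pos hm hZlim hZderiv hj
    intro h0
    simp only [hUdef, mul_one] at h0
    exact IsLaneEmden.ne_zero_of_scalingGenerator_eq_zero hE
      ((mul_eq_zero.1 h0).resolve_left hj.ne') hZj
  have hUlim : Tendsto U atTop (nhds (1 / m - 1)) :=
    (IsLaneEmden.tendsto_mul_scalingGenerator hZlim hZderiv).comp (tendsto_id.const_mul_atTop hj)
  obtain ⟨C, hUC⟩ : ∃ C, ∀ᶠ r in atTop, |U r| ≤ C :=
    ⟨_, (hUlim.abs.eventually (gt_mem_nhds (lt_add_one _))).mono fun _ h => h.le⟩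
  have hmain := finite_and_ncard_negative_eigenvalues hV hM hV0 hθ₀ hθ₀1
    (fun k => hUcard ▸ IsPruferAngle.exists_lt_iff_lt_ncard_zeros hV hM hθ₀ hθ₀1
      (fun r hr => (hU r hr).continuousAt.continuousWithinAt)
      (fun r hr => (hW r hr).continuousAt.continuousWithinAt)
      (fun r hr => hU r (le_of_lt hr))
      (fun r hr => (hW r (le_of_lt hr)).congr_deriv (by
        rw [hVeq r hr, hQpow]
        ring))
      hU1 hUC hUfin k)
  have hset : ∀ μ ψ, IsDirichletEigenfunction V μ ψ ↔ ((∃ r ≥ (1:ℝ), ψ r ≠ 0) ∧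
      ContDiffOn ℝ 2 ψ (Set.Ici 1) ∧ ψ 1 = 0 ∧
      MeasureTheory.IntegrableOn (fun r => ψ r ^ 2) (Set.Ioi 1) ∧
      (∀ r > (1:ℝ), deriv (deriv ψ) r + (2 * m + 1) * Q j r ^ (2 * m) * ψ r + μ * ψ r = 0)) := by
    intro μ ψ
    have hode : (∀ r > (1 : ℝ), deriv (deriv ψ) r + V r * ψ r + μ * ψ r = 0) ↔
        ∀ r > (1:ℝ), deriv (deriv ψ) r + (2 * m + 1) * Q j r ^ (2 * m) * ψ r + μ * ψ r = 0 :=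
      forall₂_congr fun r hr => by rw [hVeq r hr]
    rw [IsDirichletEigenfunction, hode]
  simp only [hset] at hmain
  exact hmain
end

section
/- For every j ∈ ℕ, there is no nonzero twice continuously differentiable function h : [1,∞) → ℝ such that h(1) = 0, ∫₁^∞ h(r)² dr < ∞, and h''(r) + (2/r)h'(r) + (2m+1)·Q_j(r)^{2m}·h(r) = 0 for all r > 1. -/
open Set Filter MeasureTheory

/-- A solution of `y'' + (2/r) y' + q y = 0` on `(a, ∞)` with vanishing Cauchy data at `a ≥ 0`
vanishes identically. -/
theorem eq_zero_of_radial_linear_ode {y p q : ℝ → ℝ} {a : ℝ} (ha : 0 ≤ a)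
    (hq : ContinuousOn q (Ici a)) (hyc : ContinuousOn y (Ici a)) (hpc : ContinuousOn p (Ici a))
    (hy : ∀ r > a, HasDerivAt y (p r) r)
    (hp : ∀ r > a, HasDerivAt p (-(2 / r) * p r - q r * y r) r)
    (hya : y a = 0) (hpa : p a = 0) : ∀ r ≥ a, y r = 0 := by
  intro b hb
  have hsub : Icc a b ⊆ Ici a := Icc_subset_Ici_self
  obtain ⟨M, hM⟩ := isCompact_Icc.exists_bound_of_continuousOn (hq.mono hsub)
  have hderiv : ∀ r > a, HasDerivAt (fun r => (y r ^ 2 + p r ^ 2) * Real.exp (-(1 + M) * r))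
      ((2 * y r * p r + 2 * p r * (-(2 / r) * p r - q r * y r)) * Real.exp (-(1 + M) * r)
        + (y r ^ 2 + p r ^ 2) * (Real.exp (-(1 + M) * r) * (-(1 + M)))) r := by
    intro r hr
    have h1 := ((hy r hr).pow 2).add ((hp r hr).pow 2)
    have h2 := ((hasDerivAt_id r).const_mul (-(1 + M))).exp
    refine (h1.mul h2).congr_deriv ?_
    simp
  have hanti : AntitoneOn (fun r => (y r ^ 2 + p r ^ 2) * Real.exp (-(1 + M) * r)) (Icc a b) := by
    refine antitoneOn_of_deriv_nonpos (convex_Icc a b) ?_ ?_ ?_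
    · refine ContinuousOn.mul ?_ (by fun_prop)
      exact ((hyc.mono hsub).pow 2).add ((hpc.mono hsub).pow 2)
    · intro r hr
      rw [interior_Icc] at hr
      exact (hderiv r hr.1).differentiableAt.differentiableWithinAt
    · intro r hr
      rw [interior_Icc] at hr
      rw [(hderiv r hr.1).deriv]
      have hr0 : 0 < r := ha.trans_lt hr.1
      have hq' := abs_le.1 (hM r ⟨hr.1.le, hr.2.le⟩)
      have hpos : 0 ≤ 2 / r * p r ^ 2 := by positivity
      have key : 2 * y r * p r + 2 * p r * (-(2 / r) * p r - q r * y r)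
          - (1 + M) * (y r ^ 2 + p r ^ 2) ≤ 0 := by
        nlinarith [sq_nonneg (y r - p r), sq_nonneg (y r + p r),
          mul_nonneg (sub_nonneg.2 hq'.2) (sq_nonneg (y r - p r)),
          mul_nonneg (sub_nonneg.2 hq'.1) (sq_nonneg (y r + p r))]
      nlinarith [Real.exp_pos (-(1 + M) * r)]
  have h := hanti (left_mem_Icc.2 hb) (right_mem_Icc.2 hb) hb
  simp only [hya, hpa] at h
  have h' : y b ^ 2 + p b ^ 2 ≤ 0 := by
    by_contra! hcon
    have := mul_pos hcon (Real.exp_pos (-(1 + M) * b))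
    rw [zero_pow two_ne_zero, add_zero, zero_mul] at h
    exact this.not_ge h
  nlinarith [sq_nonneg (y b), sq_nonneg (p b)]

/-- The radial Wronskian of two solutions of `y'' + (2/r) y' + q y = 0` on `(1, ∞)` is constant. -/
theorem radial_wronskian_const {h p v s q : ℝ → ℝ}
    (hhc : ContinuousOn h (Ici 1)) (hpc : ContinuousOn p (Ici 1))
    (hvc : ContinuousOn v (Ici 1)) (hsc : ContinuousOn s (Ici 1))
    (hh : ∀ r > 1, HasDerivAt h (p r) r)
    (hp : ∀ r > 1, HasDerivAt p (-(2 / r) * p r - q r * h r) r)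
    (hv : ∀ r > 1, HasDerivAt v (s r) r)
    (hs : ∀ r > 1, HasDerivAt s (-(2 / r) * s r - q r * v r) r) :
    ∀ r ≥ 1, r ^ 2 * (h r * s r - p r * v r) = h 1 * s 1 - p 1 * v 1 := by
  have hd : ∀ r > 1, HasDerivAt (fun r => r ^ 2 * (h r * s r - p r * v r)) 0 r := by
    intro r hr
    have hr0 : r ≠ 0 := by linarith
    refine ((hasDerivAt_pow 2 r).mul
      (((hh r hr).mul (hs r hr)).sub ((hp r hr).mul (hv r hr)))).congr_deriv ?_
    simp
    field_simp
    ring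
  have hc : ContinuousOn (fun r => r ^ 2 * (h r * s r - p r * v r)) (Ici 1) :=
    (continuousOn_id.pow 2).mul ((hhc.mul hsc).sub (hpc.mul hvc))
  have hdiff : DifferentiableOn ℝ (fun r => r ^ 2 * (h r * s r - p r * v r))
      (interior (Ici 1)) := by
    rw [interior_Ici]
    exact fun r hr => (hd r hr).differentiableAt.differentiableWithinAt
  have hz : ∀ r ∈ interior (Ici (1 : ℝ)),
      deriv (fun r => r ^ 2 * (h r * s r - p r * v r)) r = 0 := by
    rw [interior_Ici]
    exact fun r hr => (hd r hr).deriv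
  intro r hr
  have h1 := antitoneOn_of_deriv_nonpos (convex_Ici 1) hc hdiff (fun x hx => (hz x hx).le)
    self_mem_Ici hr hr
  have h2 := monotoneOn_of_deriv_nonneg (convex_Ici 1) hc hdiff (fun x hx => (hz x hx).ge)
    self_mem_Ici hr hr
  have := le_antisymm h1 h2
  simpa using this

/-- If `r v(r)` has a nonzero limit at infinity and `h` is square integrable, then a constant
radial Wronskian of `h` and `v` vanishes. -/
theorem radial_wronskian_eq_zero {h p v s : ℝ → ℝ} {W c : ℝ} (hc : c ≠ 0)
    (hh : ∀ r > 1, HasDerivAt h (p r) r) (hv : ∀ r > 1, HasDerivAt v (s r) r)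
    (hW : ∀ r ≥ 1, r ^ 2 * (h r * s r - p r * v r) = W)
    (hlim : Tendsto (fun r => r * v r) atTop (nhds c))
    (hint : IntegrableOn (fun r => h r ^ 2) (Ioi 1)) : W = 0 := by
  by_contra hW0
  have habs := hlim.abs
  have hc' : 0 < |c| := abs_pos.2 hc
  obtain ⟨R, hR⟩ := eventually_atTop.1 (((habs.eventually (lt_mem_nhds (half_lt_self hc'))).and
    (habs.eventually (gt_mem_nhds (by linarith : |c| < 2 * |c|)))).and (eventually_gt_atTop 1))
  have hR1 : 1 < R := (hR R le_rfl).2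
  have hvne : ∀ r ≥ R, v r ≠ 0 := by
    intro r hr h0
    have := (hR r hr).1.1
    rw [h0] at this
    simp at this
    linarith
  set κ := W ^ 2 / (2 * |c|) ^ 2 with hκ
  have hκ0 : 0 < κ := by positivity
  have hG : ∀ r ≥ R, HasDerivAt (fun r => W * (h r / v r)) (-(W ^ 2 / (r * v r) ^ 2)) r := by
    intro r hr
    have hr1 : 1 < r := hR1.trans_le hr
    have hr0 : r ≠ 0 := by linarith
    have hv0 := hvne r hr
    refine (((hh r hr1).div (hv r hr1) hv0).const_mul W).congr_deriv ?_
    rw [pow_two W]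
    nth_rewrite 3 [← hW r hr1.le]
    field_simp
    ring
  have hG' : ∀ r ≥ R, W * (h r / v r) ≤ W * (h R / v R) - κ * (r - R) := by
    intro r hr
    have hd : ∀ x ≥ R, HasDerivAt (fun r => W * (h r / v r) + κ * r)
        (-(W ^ 2 / (x * v x) ^ 2) + κ) x := by
      intro x hx
      exact ((hG x hx).add ((hasDerivAt_id x).const_mul κ)).congr_deriv (by simp)
    have := antitoneOn_of_deriv_nonpos (convex_Ici R)
      (fun x hx => (hd x hx).continuousAt.continuousWithinAt)
      (fun x hx => (hd x (interior_subset hx)).differentiableAt.differentiableWithinAt)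
      (fun x hx => by
        have hx' := interior_subset hx
        rw [(hd x hx').deriv]
        have h1 := (hR x hx').1
        have h2 : κ ≤ W ^ 2 / (x * v x) ^ 2 := by
          rw [hκ, ← sq_abs (x * v x)]
          have : 0 < |x * v x| := by linarith [h1.1]
          gcongr
          exact h1.2.le
        linarith) self_mem_Ici (mem_Ici.2 hr) hr
    simp only at this
    linarith
  obtain ⟨T, hT⟩ := eventually_atTop.1 ((eventually_ge_atTop R).and
    (eventually_ge_atTop ((W * (h R / v R) + κ * R) / (κ / 2))))
  set δ := κ / 2 * (|c| / 2) with hδ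
  have hδ0 : 0 < δ := by positivity
  have hlow : ∀ r ≥ T, δ ^ 2 ≤ W ^ 2 * h r ^ 2 := by
    intro r hr
    have hrR := (hT r hr).1
    have hr0 : 0 < r := by linarith
    have h1 := hG' r hrR
    have h2 := (hT r hr).2
    rw [div_le_iff₀ (by positivity)] at h2
    have h3 : κ / 2 * r ≤ |W * (h r / v r)| := by
      rw [← abs_neg]
      exact le_trans (by linarith) (le_abs_self _)
    have h4 := (hR r hrR).1.1.le
    have h5 : (κ / 2 * r) * (|c| / 2) ≤ |W * (h r / v r)| * |r * v r| := by gcongr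
    rw [← abs_mul] at h5
    have h6 : W * (h r / v r) * (r * v r) = (W * h r) * r := by
      field_simp [hvne r hrR]
    rw [h6, abs_mul, abs_of_pos hr0] at h5
    have h7 : δ ≤ |W * h r| := by
      refine le_of_mul_le_mul_right ?_ hr0
      rw [hδ]
      linarith
    rw [← mul_pow, ← sq_abs (W * h r)]
    gcongr
  have hi : IntegrableOn (fun r => W ^ 2 * h r ^ 2) (Ioi (max T 1)) :=
    (hint.mono_set (Ioi_subset_Ioi (le_max_right _ _))).const_mul _
  have hi2 : IntegrableOn (fun _ : ℝ => δ ^ 2) (Ioi (max T 1)) := by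
    refine Integrable.mono' hi aestronglyMeasurable_const ?_
    refine (ae_restrict_iff' measurableSet_Ioi).2 (Eventually.of_forall fun r hr => ?_)
    rw [Real.norm_of_nonneg (by positivity)]
    exact hlow r ((le_max_left _ _).trans (le_of_lt hr))
  rw [integrableOn_const_iff] at hi2
  simp [hδ0.ne'] at hi2

/-- The generator of scaling `Q/m + r Q'` applied to a solution of `Q'' + (2/r) Q' + Q^(2m+1) = 0`
solves the linearized equation. -/
theorem hasDerivAt_deriv_scaling_generator {m : ℕ} (hm : m ≠ 0) {Q P : ℝ → ℝ} {r : ℝ} (hr : r ≠ 0)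
    (hQ : HasDerivAt Q (P r) r) (hP : HasDerivAt P (-(2 / r) * P r - Q r ^ (2 * m + 1)) r) :
    HasDerivAt (fun r => Q r / m + r * P r) ((1 / m - 1) * P r - r * Q r ^ (2 * m + 1)) r ∧
    HasDerivAt (fun r => (1 / m - 1) * P r - r * Q r ^ (2 * m + 1))
      (-(2 / r) * ((1 / m - 1) * P r - r * Q r ^ (2 * m + 1))
        - (2 * m + 1) * Q r ^ (2 * m) * (Q r / m + r * P r)) r := by
  have hm' : (m : ℝ) ≠ 0 := Nat.cast_ne_zero.2 hm
  constructor
  · refine ((hQ.div_const _).add ((hasDerivAt_id r).mul hP)).congr_deriv ?_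
    simp
    field_simp
    ring
  · refine ((hP.const_mul _).sub ((hasDerivAt_id r).mul (hQ.pow (2 * m + 1)))).congr_deriv ?_
    simp
    rw [pow_succ]
    field_simp
    ring

/-- the linearized operator $L_j$ has no radial zero energy state. -/
theorem stmt_2
    (m : ℕ) (hm : 2 < m)
    (Z : ℝ → ℝ) (rs : ℕ → ℝ)
    (hZreg : ContDiffOn ℝ 2 Z (Set.Ioi 0))
    (hZode : ∀ r > (0:ℝ), deriv (deriv Z) r + (2 / r) * deriv Z r + Z r ^ (2 * m + 1) = 0)
    (hZdecay : ∃ C > (0:ℝ), ∀ r ≥ (1:ℝ), |r * Z r - 1| ≤ C / r ^ 2)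
    (hZderiv : Filter.Tendsto (fun r => r ^ 2 * deriv Z r) Filter.atTop (nhds (-1)))
    (hrs_pos : ∀ j, 0 < rs j)
    (hrs_anti : StrictAnti rs)
    (hrs_lim : Filter.Tendsto rs Filter.atTop (nhds 0))
    (hrs_zeros : {r : ℝ | 0 < r ∧ Z r = 0} = Set.range rs)
    (Q : ℕ → ℝ → ℝ)
    (hQ : ∀ j r, Q j r = rs j ^ ((1:ℝ) / (m:ℝ)) * Z (rs j * r))
    (j : ℕ) :
    ¬ ∃ h : ℝ → ℝ,
        (∃ r ≥ (1:ℝ), h r ≠ 0) ∧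
        ContDiffOn ℝ 2 h (Set.Ici 1) ∧
        h 1 = 0 ∧
        MeasureTheory.IntegrableOn (fun r => h r ^ 2) (Set.Ioi 1) ∧
        (∀ r > (1:ℝ), deriv (deriv h) r + (2 / r) * deriv h r
          + (2 * m + 1) * Q j r ^ (2 * m) * h r = 0) := by
  rintro ⟨h, ⟨r₁, hr₁, hne⟩, hreg, h1, hint, hode⟩
  have hm0 : m ≠ 0 := by omega
  have hm' : (m : ℝ) ≠ 0 := Nat.cast_ne_zero.2 hm0
  have hZ : ∀ r > 0, HasDerivAt Z (deriv Z r) r := fun r hr =>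
    ((hZreg.differentiableOn (by norm_num)).differentiableAt (Ioi_mem_nhds hr)).hasDerivAt
  have hZ1 : ContDiffOn ℝ 1 (deriv Z) (Ioi 0) :=
    ((contDiffOn_succ_iff_deriv_of_isOpen (n := 1) isOpen_Ioi).1 hZreg).2.2
  have hZ' : ∀ r > 0, HasDerivAt (deriv Z) (-(2 / r) * deriv Z r - Z r ^ (2 * m + 1)) r := by
    intro r hr
    refine ((hZ1.differentiableOn (by norm_num)).differentiableAt
      (Ioi_mem_nhds hr)).hasDerivAt.congr_deriv ?_
    linarith [hZode r hr]
  have hZlim : Tendsto (fun r => r * Z r) atTop (nhds 1) := by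
    obtain ⟨C, -, hC⟩ := hZdecay
    rw [tendsto_iff_norm_sub_tendsto_zero]
    refine squeeze_zero' (Eventually.of_forall fun _ => norm_nonneg _)
      ((eventually_ge_atTop 1).mono hC) ?_
    exact tendsto_const_nhds.div_atTop (tendsto_pow_atTop two_ne_zero)
  have hρ := hrs_pos j
  set ρ := rs j with hρdef
  have hZρ : Z ρ = 0 := by
    have : ρ ∈ {r : ℝ | 0 < r ∧ Z r = 0} := by rw [hrs_zeros]; exact mem_range_self j
    exact this.2
  have hZ'ρ : deriv Z ρ ≠ 0 := by
    intro h0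
    have hsub : ∀ r ∈ Ici ρ, 0 < r := fun r hr => hρ.trans_le hr
    have hZc : ContinuousOn Z (Ici ρ) :=
      fun r hr => (hZ r (hsub r hr)).continuousAt.continuousWithinAt
    have hz := eq_zero_of_radial_linear_ode (q := fun r => Z r ^ (2 * m)) hρ.le (hZc.pow _) hZc
      (fun r hr => (hZ' r (hsub r hr)).continuousAt.continuousWithinAt)
      (fun r hr => hZ r (hρ.trans hr))
      (fun r hr => by simpa only [pow_succ] using hZ' r (hρ.trans hr)) hZρ h0
    have : Tendsto (fun r => r * Z r) atTop (nhds 0) := by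
      refine tendsto_const_nhds.congr' ((eventually_ge_atTop ρ).mono fun r hr => ?_)
      simp [hz r hr]
    exact one_ne_zero (tendsto_nhds_unique hZlim this)
  set α := ρ ^ ((1 : ℝ) / m) with hα
  have hα0 : 0 < α := Real.rpow_pos_of_pos hρ _
  have hα2 : α ^ (2 * m) = ρ ^ 2 := by
    rw [mul_comm, pow_mul, hα, one_div, Real.rpow_inv_natCast_pow hρ.le hm0]
  have hQj : Q j = fun r => α * Z (ρ * r) := funext (hQ j)
  set P : ℝ → ℝ := fun r => α * (ρ * deriv Z (ρ * r)) with hPdef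
  have hmul : ∀ r : ℝ, HasDerivAt (fun r => ρ * r) ρ r := fun r => by
    simpa using (hasDerivAt_id r).const_mul ρ
  have hQd : ∀ r > 0, HasDerivAt (Q j) (P r) r := by
    intro r hr
    rw [hQj]
    refine (((hZ _ (mul_pos hρ hr)).comp r (hmul r)).const_mul α).congr_deriv ?_
    simp only [hPdef]
    ring
  have hPd : ∀ r > 0, HasDerivAt P (-(2 / r) * P r - Q j r ^ (2 * m + 1)) r := by
    intro r hr
    refine ((((hZ' _ (mul_pos hρ hr)).comp r (hmul r)).const_mul ρ).const_mul α).congr_deriv ?_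
    simp only [hQj, hPdef, mul_pow, pow_succ α, hα2]
    field_simp
  have htop : Tendsto (fun r => ρ * r) atTop atTop := tendsto_id.const_mul_atTop hρ
  set v : ℝ → ℝ := fun r => Q j r / m + r * P r with hvdef
  set s : ℝ → ℝ := fun r => (1 / m - 1) * P r - r * Q j r ^ (2 * m + 1) with hsdef
  have hvs := fun r (hr : 0 < r) =>
    hasDerivAt_deriv_scaling_generator hm0 hr.ne' (hQd r hr) (hPd r hr)
  have hvlim : Tendsto (fun r => r * v r) atTop (nhds (α / ρ / m * 1 + α / ρ * -1)) := by
    refine (((hZlim.comp htop).const_mul (α / ρ / m)).add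
      ((hZderiv.comp htop).const_mul (α / ρ))).congr fun r => ?_
    simp only [hvdef, hPdef, hQj, Function.comp]
    field_simp
  have hc : α / ρ / m * 1 + α / ρ * -1 ≠ 0 := by
    have hm1 : (1 : ℝ) - m ≠ 0 := by
      rw [sub_ne_zero, ne_comm, Nat.cast_ne_one]
      omega
    have : α / ρ / m * 1 + α / ρ * -1 = α / ρ / m * (1 - m) := by
      field_simp
      ring
    rw [this]
    positivity
  set p := derivWithin h (Ici 1) with hpdef
  have hp1 : ContDiffOn ℝ 1 p (Ici 1) :=
    hreg.derivWithin (uniqueDiffOn_Ici 1) (by norm_num)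
  have hpe : ∀ r > 1, p r = deriv h r := fun r hr => derivWithin_of_mem_nhds (Ici_mem_nhds hr)
  have hhd : ∀ r > 1, HasDerivAt h (p r) r := fun r hr => by
    rw [hpe r hr]
    exact ((hreg.differentiableOn (by norm_num)).differentiableAt (Ici_mem_nhds hr)).hasDerivAt
  have hpd : ∀ r > 1, HasDerivAt p (-(2 / r) * p r - (2 * m + 1) * Q j r ^ (2 * m) * h r) r := by
    intro r hr
    refine ((hp1.differentiableOn (by norm_num)).differentiableAt
      (Ici_mem_nhds hr)).hasDerivAt.congr_deriv ?_
    have : p =ᶠ[nhds r] deriv h := eventually_of_mem (Ioi_mem_nhds hr) hpe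
    rw [this.deriv_eq, hpe r hr]
    linarith [hode r hr]
  have hpos : ∀ r ∈ Ici (1 : ℝ), 0 < r := fun r hr => one_pos.trans_le hr
  have hpos' : ∀ r > (1 : ℝ), 0 < r := fun r hr => one_pos.trans hr
  have hW := radial_wronskian_const (q := fun r => (2 * m + 1) * Q j r ^ (2 * m))
    hreg.continuousOn hp1.continuousOn
    (fun r hr => (hvs r (hpos r hr)).1.continuousAt.continuousWithinAt)
    (fun r hr => (hvs r (hpos r hr)).2.continuousAt.continuousWithinAt)
    hhd hpd (fun r hr => (hvs r (hpos' r hr)).1) (fun r hr => (hvs r (hpos' r hr)).2)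
  have hW0 := radial_wronskian_eq_zero hc hhd (fun r hr => (hvs r (hpos' r hr)).1) hW hvlim hint
  have hp0 : p 1 = 0 := by
    have hv1 : Q j 1 / m + 1 * P 1 ≠ 0 := by
      simp [hQj, hPdef, hZρ, hZ'ρ, hα0.ne', hρ.ne']
    rw [h1, zero_mul, zero_sub, neg_eq_zero] at hW0
    exact (mul_eq_zero.1 hW0).resolve_right hv1
  refine hne (eq_zero_of_radial_linear_ode (q := fun r => (2 * m + 1) * Q j r ^ (2 * m))
    zero_le_one ?_ hreg.continuousOn hp1.continuousOn hhd hpd h1 hp0 r₁ hr₁)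
  exact continuousOn_const.mul (ContinuousOn.pow
    (fun r hr => (hQd r (hpos r hr)).continuousAt.continuousWithinAt) _)
end

section
/- Let m > 2 be an integer, e > 0, and let Q : [1,∞) → ℝ be continuous with |Q(r)| ≤ C₀/r for all r ≥ 1 and some constant C₀ > 0. Suppose Y : [1,∞) → ℝ is twice continuously differentiable, not identically zero, satisfies Y''(r) + (2/r)Y'(r) + (2m+1)·Q(r)^{2m}·Y(r) = e²·Y(r) for all r > 1, and ∫₁^∞ Y(r)²·r² dr < ∞. Then there exist a constant c ≠ 0, a constant C > 0, and R ≥ 1 such that for all r ≥ R: |r·Y(r) − c·e^{−e·r}| ≤ C·r^{1−2m}·e^{−e·r} and |r·Y'(r) + c·e·e^{−e·r}| ≤ C·r^{−1}·e^{−e·r}. -/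
open Set Filter MeasureTheory

lemma monotoneOn_of_hasDerivAt_nonneg {D : Set ℝ} (hD : Convex ℝ D) {f f' : ℝ → ℝ}
    (hf : ∀ x ∈ D, HasDerivAt f (f' x) x) (hf' : ∀ x ∈ D, 0 ≤ f' x) : MonotoneOn f D :=
  monotoneOn_of_hasDerivWithinAt_nonneg hD
    (fun x hx => (hf x hx).continuousAt.continuousWithinAt)
    (fun x hx => (hf x (interior_subset hx)).hasDerivWithinAt)
    (fun x hx => hf' x (interior_subset hx))

lemma antitoneOn_of_hasDerivAt_nonpos {D : Set ℝ} (hD : Convex ℝ D) {f f' : ℝ → ℝ}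
    (hf : ∀ x ∈ D, HasDerivAt f (f' x) x) (hf' : ∀ x ∈ D, f' x ≤ 0) : AntitoneOn f D :=
  antitoneOn_of_hasDerivWithinAt_nonpos hD
    (fun x hx => (hf x hx).continuousAt.continuousWithinAt)
    (fun x hx => (hf x (interior_subset hx)).hasDerivWithinAt)
    (fun x hx => hf' x (interior_subset hx))

lemma MonotoneOn.le_of_tendsto_atTop {f : ℝ → ℝ} {R l : ℝ} (hf : MonotoneOn f (Ici R))
    (hl : Tendsto f atTop (nhds l)) {r : ℝ} (hr : R ≤ r) : f r ≤ l :=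
  ge_of_tendsto hl <| by
    filter_upwards [eventually_ge_atTop r] with s hs using hf hr (hr.trans hs) hs

lemma AntitoneOn.le_of_tendsto_atTop {f : ℝ → ℝ} {R l : ℝ} (hf : AntitoneOn f (Ici R))
    (hl : Tendsto f atTop (nhds l)) {r : ℝ} (hr : R ≤ r) : l ≤ f r :=
  le_of_tendsto hl <| by
    filter_upwards [eventually_ge_atTop r] with s hs using hf hr (hr.trans hs) hs

lemma hasDerivAt_exp_mul (a x : ℝ) :
    HasDerivAt (fun s => Real.exp (a * s)) (a * Real.exp (a * x)) x := by
  simpa [mul_comm] using ((hasDerivAt_id x).const_mul a).exp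

lemma tendsto_exp_neg_mul_atTop {α : ℝ} (hα : 0 < α) :
    Tendsto (fun s => Real.exp (-α * s)) atTop (nhds 0) :=
  Real.tendsto_exp_atBot.comp (tendsto_id.const_mul_atTop_of_neg (neg_neg_of_pos hα))

/-- A function on a half line whose logarithmic derivative lies between `0` and `B * r ^ (-N)`
converges to a positive limit, with rate `r ^ (1 - N)`. -/
lemma exists_limit_of_deriv_le_rpow {R B N : ℝ} (hR : 1 ≤ R) (hB : 0 ≤ B) (hN : 1 < N)
    {g g' : ℝ → ℝ} (hg : ∀ r ≥ R, HasDerivAt g (g' r) r) (hpos : ∀ r ≥ R, 0 < g r)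
    (hg0 : ∀ r ≥ R, 0 ≤ g' r) (hg1 : ∀ r ≥ R, g' r ≤ B * r ^ (-N) * g r) :
    ∃ c > 0, ∃ C > 0, ∀ r ≥ R, g r ≤ c ∧ c - g r ≤ C * r ^ (1 - N) := by
  have hmono : MonotoneOn g (Ici R) := monotoneOn_of_hasDerivAt_nonneg (convex_Ici R) hg hg0
  have hN' : 0 < N - 1 := by linarith
  set h : ℝ → ℝ := fun r => B / (N - 1) * r ^ (1 - N) with hh
  have hh0 : ∀ r ≥ R, 0 ≤ h r := fun r hr => by
    have : 0 < r := by linarith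
    positivity
  have hdh : ∀ r ≥ R, HasDerivAt h (-(B * r ^ (-N))) r := fun r hr => by
    have hr0 : r ≠ 0 := by linarith
    have := (Real.hasDerivAt_rpow_const (p := 1 - N) (Or.inl hr0)).const_mul (B / (N - 1))
    refine this.congr_deriv ?_
    rw [show 1 - N - 1 = -N by ring]
    field_simp
    ring
  have hexp : AntitoneOn (fun r => g r * Real.exp (h r)) (Ici R) := by
    refine antitoneOn_of_hasDerivAt_nonpos (convex_Ici R)
      (fun r hr => (hg r hr).mul (hdh r hr).exp) fun r hr => ?_
    have := mul_nonpos_of_nonpos_of_nonneg (sub_nonpos.2 (hg1 r hr)) (Real.exp_pos (h r)).le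
    nlinarith
  set G := g R * Real.exp (h R) with hG
  have hGpos : 0 < G := mul_pos (hpos R le_rfl) (Real.exp_pos _)
  have hgG : ∀ r ≥ R, g r ≤ G := fun r hr =>
    (le_mul_of_one_le_right (hpos r hr).le (Real.one_le_exp (hh0 r hr))).trans
      (hexp self_mem_Ici hr hr)
  obtain ⟨c, hc⟩ : ∃ c, Tendsto g atTop (nhds c) := by
    have hm : Monotone fun r => g (max R r) := fun a b hab =>
      hmono (mem_Ici.2 (le_max_left _ _)) (mem_Ici.2 (le_max_left _ _)) (max_le_max le_rfl hab)
    refine ⟨_, (tendsto_atTop_ciSup hm ⟨G, ?_⟩).congr' ?_⟩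
    · rintro _ ⟨r, rfl⟩
      exact hgG _ (le_max_left _ _)
    · filter_upwards [eventually_ge_atTop R] with r hr
      rw [max_eq_right hr]
  have hanti : AntitoneOn (fun r => g r + G * h r) (Ici R) := by
    refine antitoneOn_of_hasDerivAt_nonpos (convex_Ici R)
      (fun r hr => (hg r hr).add ((hdh r hr).const_mul G)) fun r hr => ?_
    have hr0 : 0 < r := by linarith [show R ≤ r from hr]
    have : B * r ^ (-N) * g r ≤ B * r ^ (-N) * G :=
      mul_le_mul_of_nonneg_left (hgG r hr) (by positivity)
    linarith [hg1 r hr]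
  have hlim : Tendsto (fun r => g r + G * h r) atTop (nhds c) := by
    have := (tendsto_rpow_neg_atTop hN').const_mul (B / (N - 1))
    rw [neg_sub] at this
    simpa using hc.add (this.const_mul G)
  refine ⟨c, (hpos R le_rfl).trans_le (hmono.le_of_tendsto_atTop hc le_rfl),
    G * (B / (N - 1)) + 1, by positivity, fun r hr => ⟨hmono.le_of_tendsto_atTop hc hr, ?_⟩⟩
  have h1 := hanti.le_of_tendsto_atTop hlim hr
  have h2 : 0 ≤ r ^ (1 - N) := Real.rpow_nonneg (by linarith) _
  simp only [hh] at h1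
  nlinarith

/-- Asymptotics of a positive decreasing solution of `φ'' = (α² - V) φ`. -/
lemma asymptotics_of_pos_of_deriv_nonpos {R α K N : ℝ} (hR : 1 ≤ R) (hα : 0 < α) (hK : 0 ≤ K)
    (hN : 1 < N) {φ φ' V : ℝ → ℝ} (hφ : ∀ r ≥ R, HasDerivAt φ (φ' r) r)
    (hφ' : ∀ r ≥ R, HasDerivAt φ' ((α ^ 2 - V r) * φ r) r)
    (hV0 : ∀ r ≥ R, 0 ≤ V r) (hVα : ∀ r ≥ R, V r ≤ α ^ 2) (hVK : ∀ r ≥ R, V r ≤ K * r ^ (-N))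
    (hpos : ∀ r ≥ R, 0 < φ r) (hdec : ∀ r ≥ R, φ' r ≤ 0) :
    ∃ c > 0, ∃ C > 0, ∀ r ≥ R,
      |φ r - c * Real.exp (-α * r)| ≤ C * r ^ (1 - N) * Real.exp (-α * r) ∧
      |φ' r + c * α * Real.exp (-α * r)| ≤ C * r ^ (1 - N) * Real.exp (-α * r) := by
  have hanti : AntitoneOn φ (Ici R) := antitoneOn_of_hasDerivAt_nonpos (convex_Ici R) hφ hdec
  have hmono' : MonotoneOn φ' (Ici R) :=
    monotoneOn_of_hasDerivAt_nonneg (convex_Ici R) hφ' fun r hr =>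
      mul_nonneg (sub_nonneg.2 (hVα r hr)) (hpos r hr).le
  set u : ℝ → ℝ := fun r => φ' r + α * φ r with hu
  have hdu : ∀ r ≥ R, HasDerivAt u (α * u r - V r * φ r) r := fun r hr =>
    ((hφ' r hr).add ((hφ r hr).const_mul α)).congr_deriv (by simp only [hu]; ring)
  have hubdd : ∀ r ≥ R, |u r| ≤ |φ' R| + α * φ R := fun r hr => by
    have h1 := hmono' self_mem_Ici hr hr
    have h2 := hanti self_mem_Ici hr hr
    have h3 := hdec r hr
    have h4 := mul_le_mul_of_nonneg_left h2 hα.le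
    have h5 := mul_pos hα (hpos r hr)
    have h6 := neg_abs_le (φ' R)
    have h7 := abs_nonneg (φ' R)
    exact abs_le.2 ⟨by simp only [hu]; linarith, by simp only [hu]; linarith⟩
  have hE := tendsto_exp_neg_mul_atTop hα
  have hulim : Tendsto (fun r => u r * Real.exp (-α * r)) atTop (nhds 0) := by
    refine squeeze_zero_norm' ?_ ((hE.const_mul (|φ' R| + α * φ R)).trans (by simp))
    filter_upwards [eventually_ge_atTop R] with r hr
    rw [norm_mul, Real.norm_eq_abs, Real.norm_eq_abs, Real.abs_exp]
    exact mul_le_mul_of_nonneg_right (hubdd r hr) (Real.exp_pos _).le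
  have hu0 : ∀ r ≥ R, 0 ≤ u r := fun r hr => by
    have : AntitoneOn (fun r => u r * Real.exp (-α * r)) (Ici R) := by
      refine antitoneOn_of_hasDerivAt_nonpos (convex_Ici R)
        (fun s hs => (hdu s hs).mul (hasDerivAt_exp_mul (-α) s)) fun s hs => ?_
      have := mul_nonneg (mul_nonneg (hV0 s hs) (hpos s hs).le) (Real.exp_pos (-α * s)).le
      nlinarith
    exact nonneg_of_mul_nonneg_left (this.le_of_tendsto_atTop hulim hr) (Real.exp_pos _)
  have hu1 : ∀ r ≥ R, u r ≤ K / α * r ^ (-N) * φ r := fun r hr => by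
    have hr0 : 0 < r := by linarith
    set A := K / α * r ^ (-N) * φ r with hA
    have hαA : α * A = K * r ^ (-N) * φ r := by rw [hA]; field_simp
    have hm : MonotoneOn (fun s => (u s - A) * Real.exp (-α * s)) (Ici r) := by
      refine monotoneOn_of_hasDerivAt_nonneg (convex_Ici r)
        (fun s hs => ((hdu s (hr.le.trans hs)).sub_const A).mul (hasDerivAt_exp_mul (-α) s))
        fun s hs => ?_
      have hs' : R ≤ s := hr.le.trans hs
      have h1 : V s * φ s ≤ K * r ^ (-N) * φ r :=
        mul_le_mul ((hVK s hs').trans (mul_le_mul_of_nonneg_left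
          (Real.rpow_le_rpow_of_nonpos hr0 hs (by linarith)) hK)) (hanti hr hs' hs)
          (hpos s hs').le (by positivity)
      have := mul_nonneg (sub_nonneg.2 (h1.trans_eq hαA.symm)) (Real.exp_pos (-α * s)).le
      nlinarith
    have hl : Tendsto (fun s => (u s - A) * Real.exp (-α * s)) atTop (nhds 0) := by
      simpa [sub_mul] using hulim.sub (hE.const_mul A)
    have := hm.le_of_tendsto_atTop hl le_rfl
    linarith [nonpos_of_mul_nonpos_left this (Real.exp_pos _)]
  have hexp_cancel : ∀ r x : ℝ, x * Real.exp (α * r) * Real.exp (-α * r) = x := fun r x => by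
    rw [mul_assoc, ← Real.exp_add]; simp
  obtain ⟨c, hc, C, hC, hlim⟩ := exists_limit_of_deriv_le_rpow (g := fun r => φ r * Real.exp (α * r))
    (g' := fun r => u r * Real.exp (α * r)) hR (div_nonneg hK hα.le) hN
    (fun r hr => ((hφ r hr).mul (hasDerivAt_exp_mul α r)).congr_deriv (by simp only [hu]; ring))
    (fun r hr => mul_pos (hpos r hr) (Real.exp_pos _))
    (fun r hr => mul_nonneg (hu0 r hr) (Real.exp_pos _).le)
    (fun r hr => by
      have := mul_le_mul_of_nonneg_right (hu1 r hr) (Real.exp_pos (α * r)).le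
      linarith)
  refine ⟨c, hc, C + α * C + K / α * c, by positivity, fun r hr => ?_⟩
  obtain ⟨h1, h2⟩ := hlim r hr
  have hr1 : 1 ≤ r := hR.trans hr
  have hr0 : 0 < r := by linarith
  have hEr := Real.exp_pos (-α * r)
  have e1 := mul_le_mul_of_nonneg_right h1 hEr.le
  have e2 := mul_le_mul_of_nonneg_right h2 hEr.le
  rw [sub_mul, hexp_cancel r] at e2
  rw [hexp_cancel r] at e1
  have hpow : r ^ (-N) ≤ r ^ (1 - N) := Real.rpow_le_rpow_of_exponent_le hr1 (by linarith)
  set E := Real.exp (-α * r)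
  have hu2 : u r ≤ K / α * c * r ^ (1 - N) * E := calc
    u r ≤ K / α * r ^ (-N) * φ r := hu1 r hr
    _ ≤ K / α * r ^ (1 - N) * (c * E) := by
      have := (hpos r hr).le
      gcongr
    _ = _ := by ring
  have p1 : 0 ≤ C * r ^ (1 - N) * E := by positivity
  have p2 : 0 ≤ K / α * c * r ^ (1 - N) * E := by positivity
  have e3 := mul_le_mul_of_nonneg_left e2 hα.le
  have e4 := mul_le_mul_of_nonneg_left e1 hα.le
  have hu3 := hu0 r hr
  have p3 : 0 ≤ α * (C * r ^ (1 - N) * E) := by positivity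
  simp only [hu] at hu2 hu3
  constructor <;> rw [abs_le] <;> constructor <;> linarith

/-- Backward uniqueness for `φ'' = W φ` with bounded `W`. -/
lemma eq_zero_of_initial_eq_zero {a b M : ℝ} {φ φ' W : ℝ → ℝ}
    (hφ : ∀ r > a, HasDerivAt φ (φ' r) r) (hφ' : ∀ r > a, HasDerivAt φ' (W r * φ r) r)
    (hW : ∀ r > a, |W r| ≤ M) (h0 : φ b = 0) (h0' : φ' b = 0) {r : ℝ} (har : a < r)
    (hrb : r ≤ b) : φ r = 0 := by
  have hm : MonotoneOn (fun s => (φ s ^ 2 + φ' s ^ 2) * Real.exp ((1 + M) * s)) (Ioi a) := by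
    refine monotoneOn_of_hasDerivAt_nonneg (convex_Ioi a)
      (fun s hs => (((hφ s hs).pow 2).add ((hφ' s hs).pow 2)).mul
        (hasDerivAt_exp_mul (1 + M) s)) fun s hs => ?_
    have hM := abs_le.1 (hW s hs)
    have key : 0 ≤ 2 * φ s * φ' s + 2 * φ' s * (W s * φ s)
        + (1 + M) * (φ s ^ 2 + φ' s ^ 2) := by
      nlinarith [mul_nonneg (show 0 ≤ M + W s by linarith) (sq_nonneg (φ s + φ' s)),
        mul_nonneg (show 0 ≤ M - W s by linarith) (sq_nonneg (φ s - φ' s)),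
        sq_nonneg (φ s + φ' s)]
    have := mul_nonneg key (Real.exp_pos ((1 + M) * s)).le
    simp only [Nat.cast_ofNat, Nat.add_one_sub_one, pow_one, Pi.add_apply, Pi.pow_apply]
    linarith
  have := hm har (har.trans_le hrb) hrb
  simp only [h0, h0'] at this
  have h1 := nonpos_of_mul_nonpos_left (this.trans_eq (by ring)) (Real.exp_pos _)
  nlinarith [sq_nonneg (φ' r), sq_nonneg (φ r)]

/-- A square integrable solution of `φ'' = W φ` with `W ≥ 0` satisfies `φ φ' ≤ 0`. -/
lemma mul_deriv_nonpos_of_integrableOn_sq {R : ℝ} {φ φ' W : ℝ → ℝ}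
    (hφ : ∀ r ≥ R, HasDerivAt φ (φ' r) r) (hφ' : ∀ r ≥ R, HasDerivAt φ' (W r * φ r) r)
    (hW : ∀ r ≥ R, 0 ≤ W r) (hint : IntegrableOn (fun r => φ r ^ 2) (Ioi R)) {r : ℝ}
    (hr : R ≤ r) : φ r * φ' r ≤ 0 := by
  by_contra! hlt
  have hm : MonotoneOn (fun s => φ s * φ' s) (Ici R) :=
    monotoneOn_of_hasDerivAt_nonneg (convex_Ici R) (fun s hs => (hφ s hs).mul (hφ' s hs))
      fun s hs => by nlinarith [mul_nonneg (hW s hs) (sq_nonneg (φ s)), sq_nonneg (φ' s)]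
  have hsq : MonotoneOn (fun s => φ s ^ 2) (Ici r) :=
    monotoneOn_of_hasDerivAt_nonneg (convex_Ici r) (fun s hs => (hφ s (hr.trans hs)).pow 2)
      fun s hs => by
        have : φ r * φ' r ≤ φ s * φ' s := hm hr (hr.trans hs) hs
        simp only [Nat.cast_ofNat, Nat.add_one_sub_one, pow_one]
        linarith
  have hne : φ r ≠ 0 := left_ne_zero_of_mul hlt.ne'
  have hconst : IntegrableOn (fun _ : ℝ => φ r ^ 2) (Ioi r) := by
    refine Integrable.mono (hint.mono_set (Ioi_subset_Ioi hr)) aestronglyMeasurable_const ?_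
    filter_upwards [ae_restrict_mem measurableSet_Ioi] with s hs
    rw [Real.norm_of_nonneg (sq_nonneg _), Real.norm_of_nonneg (sq_nonneg _)]
    have hs' : r ≤ s := le_of_lt hs
    exact hsq self_mem_Ici hs' hs'
  simp [hne] at hconst

/-- A square integrable nonzero solution of `φ'' = (α² - V) φ` with `0 ≤ V ≤ K r ^ (-N)` is
asymptotic to a nonzero multiple of `exp (-α r)`. -/
lemma asymptotics_of_integrableOn_sq {a α K N : ℝ} (ha : 1 ≤ a) (hα : 0 < α) (hK : 0 ≤ K)
    (hN : 1 < N) {φ φ' V : ℝ → ℝ} (hφ : ∀ r > a, HasDerivAt φ (φ' r) r)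
    (hφ' : ∀ r > a, HasDerivAt φ' ((α ^ 2 - V r) * φ r) r)
    (hV0 : ∀ r > a, 0 ≤ V r) (hVK : ∀ r > a, V r ≤ K * r ^ (-N))
    (hne : ∃ r > a, φ r ≠ 0) (hint : IntegrableOn (fun r => φ r ^ 2) (Ioi a)) :
    ∃ c : ℝ, c ≠ 0 ∧ ∃ C > 0, ∃ R > a, ∀ r ≥ R,
      |φ r - c * Real.exp (-α * r)| ≤ C * r ^ (1 - N) * Real.exp (-α * r) ∧
      |φ' r + c * α * Real.exp (-α * r)| ≤ C * r ^ (1 - N) * Real.exp (-α * r) := by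
  obtain ⟨r₀, hr₀, hφr₀⟩ := hne
  set R := max (a + 1) (max r₀ (K / α ^ 2)) with hRdef
  have hRa : a < R := (lt_add_one a).trans_le (le_max_left _ _)
  have hRr₀ : r₀ ≤ R := (le_max_left _ _).trans (le_max_right _ _)
  have hRK : K / α ^ 2 ≤ R := (le_max_right _ _).trans (le_max_right _ _)
  have hgt : ∀ r ≥ R, a < r := fun r hr => hRa.trans_le hr
  have hVα : ∀ r ≥ R, V r ≤ α ^ 2 := fun r hr => by
    have hr1 : 1 ≤ r := ha.trans (hgt r hr).le
    have hr0 : 0 < r := by linarith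
    have h1 : r ^ (-N) ≤ r⁻¹ := by
      rw [← Real.rpow_neg_one]
      exact Real.rpow_le_rpow_of_exponent_le hr1 (by linarith)
    refine (hVK r (hgt r hr)).trans ((mul_le_mul_of_nonneg_left h1 hK).trans ?_)
    rw [← div_eq_mul_inv, div_le_iff₀ hr0]
    have := (div_le_iff₀ (by positivity)).1 (hRK.trans hr)
    linarith
  have hφφ' : ∀ r ≥ R, φ r * φ' r ≤ 0 := fun r hr =>
    mul_deriv_nonpos_of_integrableOn_sq (fun s hs => hφ s (hgt s hs))
      (fun s hs => hφ' s (hgt s hs)) (fun s hs => sub_nonneg.2 (hVα s hs))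
      (hint.mono_set (Ioi_subset_Ioi hRa.le)) hr
  have hsq : AntitoneOn (fun s => φ s ^ 2) (Ici R) :=
    antitoneOn_of_hasDerivAt_nonpos (convex_Ici R) (fun s hs => (hφ s (hgt s hs)).pow 2)
      fun s hs => by
        simp only [Nat.cast_ofNat, Nat.add_one_sub_one, pow_one]
        linarith [hφφ' s hs]
  have hW : ∀ r > a, |α ^ 2 - V r| ≤ α ^ 2 + K := fun r hr => by
    have h1 : r ^ (-N) ≤ 1 := Real.rpow_le_one_of_one_le_of_nonpos (by linarith) (by linarith)
    have h2 := mul_le_mul_of_nonneg_left h1 hK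
    have h3 := hV0 r hr
    have h4 := hVK r hr
    exact abs_le.2 ⟨by nlinarith, by linarith⟩
  have hnz : ∀ r ≥ R, φ r ≠ 0 := fun r hr h0 => by
    have hzero : ∀ s ≥ r, φ s = 0 := fun s hs => by
      have : φ s ^ 2 ≤ φ r ^ 2 := hsq hr (hr.trans hs) hs
      rw [h0] at this
      nlinarith [sq_nonneg (φ s)]
    have hr1 : r < r + 1 := lt_add_one r
    have h0' : φ' (r + 1) = 0 := (hφ (r + 1) (by linarith [hgt r hr])).unique <|
      (hasDerivAt_const (r + 1) (0 : ℝ)).congr_of_eventuallyEq <| by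
        filter_upwards [Ioi_mem_nhds hr1] with s hs using hzero s (le_of_lt hs)
    exact hφr₀ (eq_zero_of_initial_eq_zero hφ hφ' hW (hzero _ hr1.le) h0' hr₀ (by linarith))
  have hcont : ContinuousOn φ (Ici R) := fun s hs =>
    (hφ s (hgt s hs)).continuousAt.continuousWithinAt
  have hsign : (∀ r ≥ R, 0 < φ r) ∨ ∀ r ≥ R, φ r < 0 := by
    by_contra! h
    obtain ⟨⟨x, hx, hx0⟩, y, hy, hy0⟩ := h
    obtain ⟨z, hz, hz0⟩ := isPreconnected_Ici.intermediate_value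
      (show x ∈ Ici R from hx) (show y ∈ Ici R from hy) hcont ⟨hx0, hy0⟩
    exact hnz z hz hz0
  rcases hsign with h | h
  · obtain ⟨c, hc, C, hC, H⟩ := asymptotics_of_pos_of_deriv_nonpos (ha.trans hRa.le) hα hK hN
      (fun r hr => hφ r (hgt r hr)) (fun r hr => hφ' r (hgt r hr))
      (fun r hr => hV0 r (hgt r hr)) hVα (fun r hr => hVK r (hgt r hr)) h
      (fun r hr => nonpos_of_mul_nonpos_right (hφφ' r hr) (h r hr))
    exact ⟨c, hc.ne', C, hC, R, hRa, H⟩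
  · obtain ⟨c, hc, C, hC, H⟩ := asymptotics_of_pos_of_deriv_nonpos (ha.trans hRa.le) hα hK hN
      (φ := fun r => -φ r) (φ' := fun r => -φ' r)
      (fun r hr => (hφ r (hgt r hr)).neg)
      (fun r hr => (hφ' r (hgt r hr)).neg.congr_deriv (by ring))
      (fun r hr => hV0 r (hgt r hr)) hVα (fun r hr => hVK r (hgt r hr))
      (fun r hr => neg_pos.2 (h r hr))
      (fun r hr => by nlinarith [hφφ' r hr, h r hr])
    refine ⟨-c, (neg_neg_of_pos hc).ne, C, hC, R, hRa, fun r hr => ?_⟩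
    obtain ⟨h1, h2⟩ := H r hr
    rw [← abs_neg] at h1 h2
    exact ⟨h1.trans_eq' (by congr 1; ring), h2.trans_eq' (by congr 1; ring)⟩

/-- Agmon-type asymptotics for eigenfunctions with negative eigenvalue
`-e²` of the radial Schrödinger operator `-Δ - (2m+1)Q^{2m}`. -/
theorem stmt_3 (m : ℕ) (hm : 2 < m) (e : ℝ) (he : 0 < e)
    (Q : ℝ → ℝ) (C₀ : ℝ) (hC₀ : 0 < C₀)
    (hQcont : ContinuousOn Q (Set.Ici 1))
    (hQbound : ∀ r ≥ (1:ℝ), |Q r| ≤ C₀ / r)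
    (Y : ℝ → ℝ)
    (hYreg : ContDiffOn ℝ 2 Y (Set.Ici 1))
    (hYne : ∃ r ≥ (1:ℝ), Y r ≠ 0)
    (hYode : ∀ r > (1:ℝ), deriv (deriv Y) r + (2 / r) * deriv Y r
        + (2 * m + 1) * Q r ^ (2 * m) * Y r = e ^ 2 * Y r)
    (hYint : MeasureTheory.IntegrableOn (fun r => Y r ^ 2 * r ^ 2) (Set.Ioi 1)) :
    ∃ c : ℝ, c ≠ 0 ∧ ∃ C > (0:ℝ), ∃ R ≥ (1:ℝ), ∀ r ≥ R,
      |r * Y r - c * Real.exp (-e * r)| ≤ C * r ^ ((1:ℝ) - 2 * (m:ℝ)) * Real.exp (-e * r) ∧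
      |r * deriv Y r + c * e * Real.exp (-e * r)| ≤ C * r⁻¹ * Real.exp (-e * r) := by
  have hK : 0 ≤ (2 * (m : ℝ) + 1) * C₀ ^ (2 * m) := by positivity
  have hm' : (2 : ℝ) < m := by exact_mod_cast hm
  have hY2 : ContDiffOn ℝ 2 Y (Ioi 1) := hYreg.mono Ioi_subset_Ici_self
  have hY : ∀ r > (1 : ℝ), HasDerivAt Y (deriv Y r) r := fun r hr =>
    ((hY2.differentiableOn (by norm_num)).differentiableAt (Ioi_mem_nhds hr)).hasDerivAt
  have hY' : ∀ r > (1 : ℝ), HasDerivAt (deriv Y) (deriv (deriv Y) r) r := fun r hr => by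
    have : ContDiffOn ℝ 1 (deriv Y) (Ioi 1) := hY2.deriv_of_isOpen isOpen_Ioi (by norm_num)
    exact ((this.differentiableOn (by norm_num)).differentiableAt (Ioi_mem_nhds hr)).hasDerivAt
  have hne : ∃ r > (1 : ℝ), r * Y r ≠ 0 := by
    by_contra! h
    have h0 : ∀ r > (1 : ℝ), Y r = 0 := fun r hr =>
      (mul_eq_zero.1 (h r hr)).resolve_left (by linarith)
    obtain ⟨r, hr, hYr⟩ := hYne
    have hcl : EqOn Y 0 (closure (Ioi 1)) := by
      refine EqOn.of_subset_closure (s := Ioi 1) (t := closure (Ioi 1)) (fun x hx => h0 x hx)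
        ?_ continuousOn_const subset_closure le_rfl
      rw [closure_Ioi]
      exact hYreg.continuousOn
    rw [closure_Ioi] at hcl
    exact hYr (hcl hr)
  have hVK : ∀ r > (1 : ℝ), (2 * (m : ℝ) + 1) * Q r ^ (2 * m)
      ≤ (2 * (m : ℝ) + 1) * C₀ ^ (2 * m) * r ^ (-(2 * (m : ℝ))) := fun r hr => by
    have hr0 : 0 < r := by linarith
    have h1 : Q r ^ (2 * m) ≤ (C₀ / r) ^ (2 * m) := by
      rw [← Even.pow_abs (even_two_mul m)]
      exact pow_le_pow_left₀ (abs_nonneg _) (hQbound r hr.le) _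
    have h2 : r ^ (-(2 * (m : ℝ))) = (r ^ (2 * m))⁻¹ := by
      rw [Real.rpow_neg hr0.le, ← Real.rpow_natCast]
      push_cast
      rfl
    rw [h2, mul_assoc, ← div_eq_mul_inv, ← div_pow]
    exact mul_le_mul_of_nonneg_left h1 (by positivity)
  obtain ⟨c, hc, C, hC, R, hR, H⟩ := asymptotics_of_integrableOn_sq (a := 1)
    (φ := fun r => r * Y r) (φ' := fun r => Y r + r * deriv Y r)
    (V := fun r => (2 * (m : ℝ) + 1) * Q r ^ (2 * m)) le_rfl he hK
    (show (1 : ℝ) < 2 * (m : ℝ) by linarith)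
    (fun r hr => ((hasDerivAt_id r).mul (hY r hr)).congr_deriv (by simp))
    (fun r hr => ((hY r hr).add ((hasDerivAt_id r).mul (hY' r hr))).congr_deriv (by
      have hr0 : r ≠ 0 := by linarith
      have h := hYode r hr
      field_simp at h
      simp only [id]
      linarith))
    (fun r _ => mul_nonneg (by positivity) (Even.pow_nonneg (even_two_mul m) _))
    hVK hne (by simpa only [mul_pow, mul_comm] using hYint)
  refine ⟨c, hc, |c| + 2 * C, by positivity, R, hR.le, fun r hr => ?_⟩
  obtain ⟨h1, h2⟩ := H r hr
  have hr1 : 1 ≤ r := hR.le.trans hr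
  have hr0 : 0 < r := by linarith
  set E := Real.exp (-e * r)
  have hE : 0 < E := Real.exp_pos _
  have hp1 : r ^ (1 - 2 * (m : ℝ)) ≤ 1 :=
    Real.rpow_le_one_of_one_le_of_nonpos hr1 (by linarith)
  have hp2 : r ^ (1 - 2 * (m : ℝ)) ≤ r⁻¹ := by
    rw [← Real.rpow_neg_one]
    exact Real.rpow_le_rpow_of_exponent_le hr1 (by linarith)
  refine ⟨h1.trans ?_, ?_⟩
  · gcongr
    linarith [abs_nonneg c]
  · have hrY : |r * Y r| ≤ (|c| + C) * E := calc
      |r * Y r| = |(r * Y r - c * E) + c * E| := by rw [sub_add_cancel]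
      _ ≤ |r * Y r - c * E| + |c * E| := abs_add_le _ _
      _ ≤ C * 1 * E + |c| * E := by
        rw [abs_mul c, abs_of_pos hE]
        gcongr
        exact h1.trans (by gcongr)
      _ = _ := by ring
    have hYr : |Y r| ≤ (|c| + C) * r⁻¹ * E := by
      rw [abs_mul, abs_of_pos hr0] at hrY
      have := mul_le_mul_of_nonneg_left hrY (inv_pos.2 hr0).le
      rw [inv_mul_cancel_left₀ hr0.ne'] at this
      linarith
    calc |r * deriv Y r + c * e * E|
        = |(Y r + r * deriv Y r + c * e * E) - Y r| := by congr 1; ring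
      _ ≤ |Y r + r * deriv Y r + c * e * E| + |Y r| := abs_sub _ _
      _ ≤ C * r⁻¹ * E + (|c| + C) * r⁻¹ * E := by
        gcongr
        exact h2.trans (by gcongr)
      _ = _ := by ring
end
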